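/- arXiv:0803.2424 — 6 statements merged into one kernel-verified Lean document; each statement's English description precedes it below -/
import Mathlib

section
/- (Hajian–Kakutani) A nonsingular transformation T of a standard σ-finite measure space (X, ℬ, μ) admits a finite T-invariant measure equivalent to μ if and only if T has no weakly wandering set of positive measure. -/
open MeasureTheory Set Filter ENNReal

/-- The `n`-th power (`n ∈ ℤ`) of an invertible transformation `T`, as a map `X → X`. -/
def Tpow {X : Type*} [MeasurableSpace X] (T : X ≃ᵐ X) (n : ℤ) : X → X :=
  ⇑((T.toEquiv : Equiv.Perm X) ^ n)

/-- `W` is *weakly wandering* for `T`: there is a strictly increasing sequence of integers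
`n₁ < n₂ < ⋯` with `T^{nᵢ}W ∩ T^{nⱼ}W = ∅` for `i ≠ j`. -/
def WeaklyWandering {X : Type*} [MeasurableSpace X] (T : X ≃ᵐ X) (W : Set X) : Prop :=
  ∃ n : ℕ → ℤ, StrictMono n ∧
    ∀ i j : ℕ, i ≠ j → Disjoint (Tpow T (n i) '' W) (Tpow T (n j) '' W)

namespace HajianKakutani

open Topology

variable {X : Type*} [MeasurableSpace X]

/-! ### Weakly wandering sets -/

lemma exists_pos_forall_measure_lt_of_absolutelyContinuous {m m' : Measure X}
    [IsFiniteMeasure m] [IsFiniteMeasure m'] (h : m' ≪ m) {ε : ℝ≥0∞} (hε : ε ≠ 0) :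
    ∃ δ > 0, ∀ s, m s < δ → m' s < ε := by
  obtain ⟨δ, hδ, H⟩ := exists_pos_setLIntegral_lt_of_measure_lt
    (Measure.lintegral_rnDeriv_lt_top m' m).ne hε
  refine ⟨δ, hδ, fun s hs => ?_⟩
  rw [← Measure.setLIntegral_rnDeriv h s]
  exact H s hs

lemma preimage_symm_iterate_preimage_iterate (T : X ≃ᵐ X) {j n : ℕ} (hj : j ≤ n) (A : Set X) :
    (T.symm^[j]) ⁻¹' (T^[n] ⁻¹' A) = T^[n - j] ⁻¹' A := by
  obtain ⟨d, rfl⟩ := Nat.exists_eq_add_of_le' hj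
  have h : Function.LeftInverse T^[j] T.symm^[j] :=
    Function.LeftInverse.iterate T.apply_symm_apply j
  ext x
  simp [Function.iterate_add_apply, h x]

lemma Tpow_natCast (T : X ≃ᵐ X) (n : ℕ) : Tpow T n = T^[n] := by
  rw [Tpow, zpow_natCast]
  exact (Equiv.Perm.iterate_eq_pow T.toEquiv n).symm

lemma exists_lt_forall_measure_preimage_iterate_lt {m : Measure X} [IsFiniteMeasure m]
    {T : X ≃ᵐ X} (hT : ∀ k : ℕ, m.map (T.symm^[k]) ≪ m) {A : Set X} (hmA : m A ≠ 0)
    (hA : ∀ ε > 0, ∃ k : ℕ, m (T^[k] ⁻¹' A) < ε) (N : ℕ) {ε : ℝ≥0∞} (hε : 0 < ε)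
    (hmeas : MeasurableSet A) :
    ∃ n > N, ∀ j ≤ N, m (T^[n - j] ⁻¹' A) < ε := by
  have hmin : min ε (m A) ≠ 0 := (lt_min hε (pos_iff_ne_zero.2 hmA)).ne'
  choose δ hδ H using fun k =>
    exists_pos_forall_measure_lt_of_absolutelyContinuous (hT k) hmin
  obtain ⟨n, hn⟩ := hA ((Finset.range (N + 1)).inf δ)
    ((Finset.lt_inf_iff ENNReal.zero_lt_top).2 fun k _ => hδ k)
  have key : ∀ j ≤ N, j ≤ n → m (T^[n - j] ⁻¹' A) < min ε (m A) := by
    intro j hj hjn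
    have h := H j _ (hn.trans_le (Finset.inf_le (Finset.mem_range.2 (Nat.lt_succ_of_le hj))))
    rwa [Measure.map_apply (T.symm.measurable.iterate j) (T.measurable.iterate n hmeas),
      preimage_symm_iterate_preimage_iterate T hjn] at h
  have hNn : N < n := by
    by_contra! hle
    have h := key n hle le_rfl
    simp at h
  exact ⟨n, hNn, fun j hj => (key j hj (hj.trans hNn.le)).trans_le (min_le_left _ _)⟩

theorem exists_weaklyWandering {m : Measure X} [IsFiniteMeasure m]
    {T : X ≃ᵐ X} (hT : ∀ k : ℕ, m.map (T.symm^[k]) ≪ m) {A : Set X} (hmeas : MeasurableSet A)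
    (hmA : m A ≠ 0) (hA : ∀ ε > 0, ∃ k : ℕ, m (T^[k] ⁻¹' A) < ε) :
    ∃ W, MeasurableSet W ∧ m W ≠ 0 ∧ WeaklyWandering T W := by
  obtain ⟨δ, hδ, hδA⟩ := ENNReal.exists_pos_sum_of_countable' hmA ℕ
  have hε : ∀ k : ℕ, 0 < δ k / (k + 1 : ℕ) := fun k =>
    ENNReal.div_pos (hδ k).ne' (ENNReal.natCast_ne_top _)
  choose next hnext hlt using fun (k N : ℕ) =>
    exists_lt_forall_measure_preimage_iterate_lt hT hmA hA N (hε k) hmeas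
  let n : ℕ → ℕ := fun k => Nat.rec 0 next k
  have hn : StrictMono n := strictMono_nat_of_lt_succ fun k => hnext k (n k)
  let bad : Set X := ⋃ k, ⋃ i ∈ Finset.range (k + 1), T^[n (k + 1) - n i] ⁻¹' A
  have hbad : m bad < m A := by
    refine lt_of_le_of_lt ((measure_iUnion_le _).trans (ENNReal.tsum_le_tsum fun k => ?_)) hδA
    calc m (⋃ i ∈ Finset.range (k + 1), T^[n (k + 1) - n i] ⁻¹' A)
        ≤ ∑ i ∈ Finset.range (k + 1), m (T^[n (k + 1) - n i] ⁻¹' A) :=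
          measure_biUnion_finset_le _ _
      _ ≤ ∑ _i ∈ Finset.range (k + 1), δ k / (k + 1 : ℕ) := by
          refine Finset.sum_le_sum fun i hi => (hlt k (n k) (n i) ?_).le
          exact hn.monotone (Nat.le_of_lt_succ (Finset.mem_range.1 hi))
      _ = δ k := by
          rw [Finset.sum_const, Finset.card_range, nsmul_eq_mul]
          exact ENNReal.mul_div_cancel (by simp) (ENNReal.natCast_ne_top _)
  have hdisj : ∀ i j : ℕ, i < j →
      Disjoint (Tpow T (Nat.cast (n i)) '' (A \ bad)) (Tpow T (Nat.cast (n j)) '' (A \ bad)) := by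
    intro i j hij
    rw [Set.disjoint_left]
    rintro _ ⟨x, hx, rfl⟩ ⟨y, hy, hxy⟩
    obtain ⟨k, rfl⟩ := Nat.exists_eq_succ_of_ne_zero (Nat.ne_zero_of_lt hij)
    obtain ⟨d, hd⟩ := Nat.exists_eq_add_of_le (hn hij).le
    rw [Tpow_natCast, Tpow_natCast, hd, Function.iterate_add_apply] at hxy
    have hyx : T^[d] y = x := T.injective.iterate _ hxy
    refine hy.2 (mem_iUnion.2 ⟨k, mem_biUnion (Finset.mem_coe.2 (Finset.mem_range.2 hij)) ?_⟩)
    have hsub : n (k + 1) - n i = d := by simp only [Nat.succ_eq_add_one] at hd; omega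
    rw [mem_preimage, hsub, hyx]
    exact hx.1
  refine ⟨A \ bad, ?_, ?_, fun k => Nat.cast (n k), fun _ _ h => Int.ofNat_lt.2 (hn h),
    fun i j hij => ?_⟩
  · refine hmeas.diff (.iUnion fun k => Finset.measurableSet_biUnion _ fun i _ => ?_)
    exact T.measurable.iterate _ hmeas
  · intro h0
    have h1 := measure_le_inter_add_sdiff m A bad
    rw [h0, add_zero] at h1
    exact (h1.trans (measure_mono inter_subset_right)).not_gt hbad
  · rcases hij.lt_or_gt with h | h
    · exact hdisj i j h
    · exact (hdisj j i h).symm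

/-! ### Limits of sequences of measures along an ultrafilter -/

/-- The limit of `ν n s` along a fixed nonprincipal ultrafilter on `ℕ`. -/
noncomputable def ultraLim (ν : ℕ → Measure X) (s : Set X) : ℝ≥0∞ :=
  ((hyperfilter ℕ).map fun n => ν n s).lim

section ultraLim

variable (ν : ℕ → Measure X)

lemma tendsto_ultraLim (s : Set X) :
    Tendsto (fun n => ν n s) (hyperfilter ℕ) (𝓝 (ultraLim ν s)) :=
  Ultrafilter.le_nhds_lim ((hyperfilter ℕ).map fun n => ν n s)

variable {ν} in
lemma ultraLim_eq {s : Set X} {c : ℝ≥0∞}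
    (h : Tendsto (fun n => ν n s) (hyperfilter ℕ) (𝓝 c)) : ultraLim ν s = c :=
  tendsto_nhds_unique (tendsto_ultraLim ν s) h

lemma ultraLim_empty : ultraLim ν ∅ = 0 := ultraLim_eq (by simp)

variable {ν} in
lemma ultraLim_mono {s t : Set X} (h : s ⊆ t) : ultraLim ν s ≤ ultraLim ν t :=
  le_of_tendsto_of_tendsto' (tendsto_ultraLim ν s) (tendsto_ultraLim ν t)
    fun _ => measure_mono h

lemma ultraLim_inter_add_diff (s : Set X) {t : Set X} (ht : MeasurableSet t) :
    ultraLim ν (s ∩ t) + ultraLim ν (s \ t) = ultraLim ν s := by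
  refine (ultraLim_eq ?_).symm
  simpa only [measure_inter_add_sdiff _ ht] using
    (tendsto_ultraLim ν (s ∩ t)).add (tendsto_ultraLim ν (s \ t))

lemma ultraLim_biUnion_finset_le {ι : Type*} (I : Finset ι) (s : ι → Set X) :
    ultraLim ν (⋃ i ∈ I, s i) ≤ ∑ i ∈ I, ultraLim ν (s i) :=
  le_of_tendsto_of_tendsto' (tendsto_ultraLim ν _)
    (tendsto_finsetSum I fun i _ => tendsto_ultraLim ν (s i))
    fun _ => measure_biUnion_finset_le I s

lemma exists_measurable_superset_ultraLim_eq (s : Set X) :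
    ∃ t, s ⊆ t ∧ MeasurableSet t ∧ ultraLim ν t = ultraLim ν s := by
  obtain ⟨t, hst, ht, h⟩ := exists_measurable_superset_forall_eq ν s
  exact ⟨t, hst, ht, by simp only [ultraLim, h]⟩

/-- The largest countably additive measure below `ultraLim ν`. -/
noncomputable def ultraMeasure : Measure X :=
  (OuterMeasure.ofFunction (ultraLim ν) (ultraLim_empty ν)).toMeasure fun _ hs =>
    OuterMeasure.ofFunction_caratheodory fun t => (ultraLim_inter_add_diff ν t hs).le

lemma ultraMeasure_apply {s : Set X} (hs : MeasurableSet s) :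
    ultraMeasure ν s = ⨅ (t : ℕ → Set X) (_ : s ⊆ iUnion t), ∑' n, ultraLim ν (t n) := by
  rw [ultraMeasure, toMeasure_apply _ _ hs, OuterMeasure.ofFunction_apply]

lemma ultraMeasure_le {s : Set X} (hs : MeasurableSet s) : ultraMeasure ν s ≤ ultraLim ν s := by
  rw [ultraMeasure, toMeasure_apply _ _ hs]
  exact OuterMeasure.ofFunction_le s

variable {ν}

lemma ultraMeasure_preimage_le {f : X → X} (hf : Measurable f)
    (hν : ∀ s, ultraLim ν (f ⁻¹' s) ≤ ultraLim ν s) {s : Set X} (hs : MeasurableSet s) :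
    ultraMeasure ν (f ⁻¹' s) ≤ ultraMeasure ν s := by
  rw [ultraMeasure_apply ν hs, ultraMeasure_apply ν (hf hs)]
  refine le_iInf₂ fun t ht => ?_
  refine (iInf₂_le (fun n => f ⁻¹' t n) ?_).trans (ENNReal.tsum_le_tsum fun n => hν (t n))
  rw [← preimage_iUnion]
  exact preimage_mono ht

lemma exists_measure_diff_lt_of_ultraMeasure_eq_zero (m : Measure X) [IsFiniteMeasure m]
    {A : Set X} (hA : MeasurableSet A) (h0 : ultraMeasure ν A = 0) {δ η : ℝ≥0∞}
    (hδ : 0 < δ) (hη : 0 < η) :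
    ∃ C, MeasurableSet C ∧ m (A \ C) < δ ∧ ultraLim ν C < η := by
  rw [← h0, ultraMeasure_apply ν hA] at hη
  obtain ⟨t, ht, hsum⟩ : ∃ t : ℕ → Set X, A ⊆ iUnion t ∧ ∑' n, ultraLim ν (t n) < η := by
    simpa only [iInf_lt_iff, exists_prop] using hη
  choose u htu hu hut using fun n => exists_measurable_superset_ultraLim_eq ν (t n)
  have hmeas : ∀ N : ℕ, MeasurableSet (⋃ i ∈ Finset.range N, u i) := fun N =>
    Finset.measurableSet_biUnion _ fun i _ => hu i
  have hlim := tendsto_measure_iInter_atTop (μ := m)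
    (s := fun N : ℕ => A \ ⋃ i ∈ Finset.range N, u i)
    (fun N => (hA.diff (hmeas N)).nullMeasurableSet)
    (fun M N hMN => sdiff_subset_sdiff_right
      (biUnion_subset_biUnion_left (Finset.coe_subset.2 (Finset.range_mono hMN))))
    ⟨0, measure_ne_top _ _⟩
  have hempty : ⋂ N : ℕ, A \ ⋃ i ∈ Finset.range N, u i = ∅ := by
    refine eq_empty_of_forall_notMem fun x hx => ?_
    rw [mem_iInter] at hx
    obtain ⟨i, hi⟩ := mem_iUnion.1 (ht (hx 0).1)
    exact (hx (i + 1)).2 (mem_biUnion (Finset.mem_coe.2 (Finset.self_mem_range_succ i))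
      (htu i hi))
  rw [hempty, measure_empty] at hlim
  obtain ⟨N, hN⟩ := (hlim.eventually_lt_const hδ).exists
  refine ⟨_, hmeas N, hN, lt_of_le_of_lt ?_ hsum⟩
  calc _ ≤ ∑ i ∈ Finset.range N, ultraLim ν (u i) := ultraLim_biUnion_finset_le ν _ _
    _ = ∑ i ∈ Finset.range N, ultraLim ν (t i) := by simp only [hut]
    _ ≤ ∑' i, ultraLim ν (t i) := ENNReal.sum_le_tsum _

/-- If `ultraLim ν` is positive on sets of positive `m`-measure, then so is the countably
additive measure below it. -/
theorem absolutelyContinuous_ultraMeasure (m : Measure X) [IsFiniteMeasure m]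
    (hν : ∀ B, MeasurableSet B → m B ≠ 0 → ultraLim ν B ≠ 0) : m ≪ ultraMeasure ν := by
  refine Measure.AbsolutelyContinuous.mk fun A hA h0 => ?_
  by_contra hmA
  obtain ⟨δ, hδ, hδA⟩ := ENNReal.exists_pos_sum_of_countable' hmA ℕ
  choose C hC hmC hlC using fun k : ℕ =>
    exists_measure_diff_lt_of_ultraMeasure_eq_zero m hA h0 (hδ k)
      (ENNReal.inv_pos.2 (ENNReal.natCast_ne_top k))
  refine hν (A \ ⋃ k, A \ C k) (hA.diff (.iUnion fun k => hA.diff (hC k))) ?_ ?_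
  · intro hB
    have h1 := measure_le_inter_add_sdiff m A (⋃ k, A \ C k)
    rw [hB, add_zero] at h1
    have h2 : m (⋃ k, A \ C k) < m A :=
      ((measure_iUnion_le _).trans (ENNReal.tsum_le_tsum fun k => (hmC k).le)).trans_lt hδA
    exact (h1.trans (measure_mono inter_subset_right)).not_gt h2
  · refine le_antisymm (ge_of_tendsto' ENNReal.tendsto_inv_nat_nhds_zero fun k => ?_) zero_le
    refine (ultraLim_mono fun x hx => ?_).trans (hlC k).le
    by_contra hxC
    exact hx.2 (mem_iUnion.2 ⟨k, hx.1, hxC⟩)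

end ultraLim

/-! ### Cesàro averages and the invariant measure -/

/-- The Cesàro averages of the images of `m` under the iterates of `T`. -/
noncomputable def cesaro (m : Measure X) (T : X ≃ᵐ X) (n : ℕ) : Measure X :=
  ((n + 1 : ℕ) : ℝ≥0∞)⁻¹ • ∑ k ∈ Finset.range (n + 1), m.map T^[k]

section cesaro

variable (m : Measure X) (T : X ≃ᵐ X)

lemma cesaro_apply (n : ℕ) (s : Set X) :
    cesaro m T n s = ((n + 1 : ℕ) : ℝ≥0∞)⁻¹ * ∑ k ∈ Finset.range (n + 1), m.map T^[k] s := by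
  simp [cesaro, Measure.finsetSum_apply]

lemma map_iterate_preimage (k : ℕ) (s : Set X) :
    m.map T^[k] (T ⁻¹' s) = m.map T^[k + 1] s := by
  rw [Function.iterate_succ', ← Measure.map_map T.measurable (T.measurable.iterate k),
    T.map_apply]

lemma map_iterate_le (k : ℕ) (s : Set X) : m.map T^[k] s ≤ m univ := by
  refine (measure_mono (subset_univ s)).trans_eq ?_
  rw [Measure.map_apply (T.measurable.iterate k) .univ, preimage_univ]

lemma sum_map_iterate_preimage_add (n : ℕ) (s : Set X) :
    ∑ k ∈ Finset.range n, m.map T^[k] (T ⁻¹' s) + m.map T^[0] s =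
      ∑ k ∈ Finset.range n, m.map T^[k] s + m.map T^[n] s := by
  simp only [map_iterate_preimage]
  rw [← Finset.sum_range_succ' (fun k => m.map T^[k] s), Finset.sum_range_succ]

lemma cesaro_preimage_le (n : ℕ) (s : Set X) :
    cesaro m T n (T ⁻¹' s) ≤ cesaro m T n s + ((n + 1 : ℕ) : ℝ≥0∞)⁻¹ * m univ := by
  rw [cesaro_apply, cesaro_apply, ← mul_add]
  gcongr
  exact (le_self_add.trans_eq (sum_map_iterate_preimage_add m T (n + 1) s)).trans
    (add_le_add_right (map_iterate_le m T _ s) _)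

lemma le_cesaro_preimage (n : ℕ) (s : Set X) :
    cesaro m T n s ≤ cesaro m T n (T ⁻¹' s) + ((n + 1 : ℕ) : ℝ≥0∞)⁻¹ * m univ := by
  rw [cesaro_apply, cesaro_apply, ← mul_add]
  gcongr
  exact (le_self_add.trans_eq (sum_map_iterate_preimage_add m T (n + 1) s).symm).trans
    (add_le_add_right (map_iterate_le m T _ s) _)

variable {m T} in
lemma cesaro_le {s : Set X} {c : ℝ≥0∞} (h : ∀ k : ℕ, m.map T^[k] s ≤ c) (n : ℕ) :
    cesaro m T n s ≤ c := by
  rw [cesaro_apply, mul_comm, ← div_eq_mul_inv]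
  refine ENNReal.div_le_of_le_mul' ((Finset.sum_le_card_nsmul _ _ c fun k _ => h k).trans_eq ?_)
  simp

variable {m T} in
lemma le_cesaro {s : Set X} {c : ℝ≥0∞} (h : ∀ k : ℕ, c ≤ m.map T^[k] s) (n : ℕ) :
    c ≤ cesaro m T n s := by
  rw [cesaro_apply, mul_comm, ← div_eq_mul_inv,
    ENNReal.le_div_iff_mul_le (by simp) (by simp)]
  refine le_trans (le_of_eq ?_) (Finset.card_nsmul_le_sum _ _ c fun k _ => h k)
  simp [mul_comm]

variable {m T} in
lemma ultraMeasure_cesaro_absolutelyContinuous (hT : ∀ k : ℕ, m.map T^[k] ≪ m) :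
    ultraMeasure (cesaro m T) ≪ m := by
  refine Measure.AbsolutelyContinuous.mk fun s hs h0 => ?_
  refine le_antisymm ((ultraMeasure_le _ hs).trans ?_) zero_le
  exact le_of_tendsto' (tendsto_ultraLim _ _) (cesaro_le fun k => (hT k h0).le)

variable [IsFiniteMeasure m]

lemma ultraLim_cesaro_preimage (s : Set X) :
    ultraLim (cesaro m T) (T ⁻¹' s) = ultraLim (cesaro m T) s := by
  have herr : Tendsto (fun n : ℕ => ((n + 1 : ℕ) : ℝ≥0∞)⁻¹ * m univ) (hyperfilter ℕ) (𝓝 0) := by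
    have h := ENNReal.Tendsto.mul_const (b := m univ)
      (ENNReal.tendsto_inv_nat_nhds_zero.comp (tendsto_add_atTop_nat 1))
      (Or.inr (measure_ne_top m univ))
    rw [zero_mul] at h
    exact h.mono_left Nat.hyperfilter_le_atTop
  apply le_antisymm
  · refine le_of_tendsto_of_tendsto' (tendsto_ultraLim _ _) ?_ fun n => cesaro_preimage_le m T n s
    simpa using (tendsto_ultraLim (cesaro m T) s).add herr
  · refine le_of_tendsto_of_tendsto' (tendsto_ultraLim _ _) ?_ fun n => le_cesaro_preimage m T n s
    simpa using (tendsto_ultraLim (cesaro m T) (T ⁻¹' s)).add herr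

lemma ultraMeasure_cesaro_preimage {s : Set X} (hs : MeasurableSet s) :
    ultraMeasure (cesaro m T) (T ⁻¹' s) = ultraMeasure (cesaro m T) s := by
  refine le_antisymm (ultraMeasure_preimage_le T.measurable
    (fun s => (ultraLim_cesaro_preimage m T s).le) hs) ?_
  have h := ultraMeasure_preimage_le (ν := cesaro m T) T.symm.measurable (fun s => ?_)
    (T.measurable hs)
  · rwa [← preimage_comp, T.self_comp_symm, preimage_id] at h
  · rw [← ultraLim_cesaro_preimage, ← preimage_comp, T.symm_comp_self, preimage_id]

instance : IsFiniteMeasure (ultraMeasure (cesaro m T)) where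
  measure_univ_lt_top := by
    refine (ultraMeasure_le _ .univ).trans_lt
      (lt_of_le_of_lt ?_ (measure_lt_top m univ))
    exact le_of_tendsto' (tendsto_ultraLim _ _) (cesaro_le fun k => map_iterate_le m T k univ)

variable {m T}

lemma absolutelyContinuous_ultraMeasure_cesaro
    (h : ∀ A, MeasurableSet A → m A ≠ 0 → ∃ ε > 0, ∀ k : ℕ, ε ≤ m (T^[k] ⁻¹' A)) :
    m ≪ ultraMeasure (cesaro m T) := by
  refine absolutelyContinuous_ultraMeasure m fun B hB hmB => ?_
  obtain ⟨ε, hε, hle⟩ := h B hB hmB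
  refine (hε.trans_le (ge_of_tendsto' (tendsto_ultraLim _ _) (le_cesaro fun k => ?_))).ne'
  rw [Measure.map_apply (T.measurable.iterate k) hB]
  exact hle k

end cesaro

/-! ### Weakly wandering sets are null for finite invariant measures -/

lemma measure_Tpow_image {ν : Measure X} {T : X ≃ᵐ X}
    (hν : ∀ A : Set X, MeasurableSet A → ν (T ⁻¹' A) = ν A) (n : ℤ) {W : Set X}
    (hW : MeasurableSet W) :
    MeasurableSet (Tpow T n '' W) ∧ ν (Tpow T n '' W) = ν W := by
  induction n using Int.induction_on with
  | zero => simp [Tpow, hW]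
  | succ k ih =>
    have h : Tpow T (k + 1) '' W = T '' (Tpow T k '' W) := by
      rw [← image_comp, Tpow, Tpow, add_comm, zpow_one_add]
      rfl
    rw [h]
    refine ⟨T.measurableSet_image.2 ih.1, ?_⟩
    rw [← hν _ (T.measurableSet_image.2 ih.1), preimage_image_eq _ T.injective, ih.2]
  | pred k ih =>
    have h : Tpow T (-k - 1) '' W = T ⁻¹' (Tpow T (-k) '' W) := by
      rw [← T.image_symm, ← image_comp, Tpow, Tpow, sub_eq_neg_add, zpow_add, zpow_neg_one]
      rfl
    rw [h]
    exact ⟨T.measurable ih.1, (hν _ ih.1).trans ih.2⟩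

lemma measure_eq_zero_of_weaklyWandering {ν : Measure X} [IsFiniteMeasure ν] {T : X ≃ᵐ X}
    (hν : ∀ A : Set X, MeasurableSet A → ν (T ⁻¹' A) = ν A) {W : Set X}
    (hW : MeasurableSet W) (hww : WeaklyWandering T W) : ν W = 0 := by
  obtain ⟨n, -, hdisj⟩ := hww
  have h := measure_iUnion (μ := ν) (f := fun i => Tpow T (n i) '' W) (fun i j => hdisj i j)
    fun i => (measure_Tpow_image hν (n i) hW).1
  simp only [(measure_Tpow_image hν _ hW).2] at h
  by_contra h0
  exact measure_ne_top ν _ (h.trans (ENNReal.tsum_const_eq_top_of_ne_zero h0))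

lemma map_iterate_absolutelyContinuous {m : Measure X} {T : X ≃ᵐ X} (h : m.map T ≪ m) (k : ℕ) :
    m.map T^[k] ≪ m := by
  induction k with
  | zero => simpa using Measure.AbsolutelyContinuous.refl m
  | succ k ih =>
    rw [Function.iterate_succ', ← Measure.map_map T.measurable (T.measurable.iterate k)]
    exact (ih.map T.measurable).trans h

end HajianKakutani

/-- **Hajian–Kakutani.** A nonsingular transformation `T` of a standard σ-finite measure
space admits an equivalent finite invariant measure if and only if `T` has no weakly
wandering set of positive measure. -/
theorem stmt_3 {X : Type*} [MeasurableSpace X] [StandardBorelSpace X]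
    (μ : Measure X) [SigmaFinite μ] (T : X ≃ᵐ X)
    (hns : ∀ N : Set X, MeasurableSet N → (μ (⇑T ⁻¹' N) = 0 ↔ μ N = 0)) :
    (∃ ν : Measure X, IsFiniteMeasure ν ∧ ν ≪ μ ∧ μ ≪ ν ∧
        ∀ A : Set X, MeasurableSet A → ν (⇑T ⁻¹' A) = ν A)
      ↔ ¬∃ W : Set X, MeasurableSet W ∧ 0 < μ W ∧ WeaklyWandering T W := by
  constructor
  · rintro ⟨ν, hfin, -, hμν, hν⟩ ⟨W, hW, hpos, hww⟩
    exact hpos.ne' (hμν (HajianKakutani.measure_eq_zero_of_weaklyWandering hν hW hww))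
  · intro hno
    have hμm := absolutelyContinuous_toFinite μ
    have hmμ := toFinite_absolutelyContinuous μ
    have hT : μ.toFinite.map T ≪ μ.toFinite := by
      refine Measure.AbsolutelyContinuous.mk fun N hN h0 => ?_
      rw [T.map_apply]
      exact hmμ ((hns N hN).2 (hμm h0))
    have hTsymm : μ.toFinite.map T.symm ≪ μ.toFinite := by
      refine Measure.AbsolutelyContinuous.mk fun N hN h0 => ?_
      rw [T.symm.map_apply]
      refine hmμ ((hns _ (T.symm.measurable hN)).1 ?_)
      rw [← preimage_comp, T.symm_comp_self, preimage_id]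
      exact hμm h0
    refine ⟨HajianKakutani.ultraMeasure (HajianKakutani.cesaro μ.toFinite T), inferInstance,
      (HajianKakutani.ultraMeasure_cesaro_absolutelyContinuous
        (HajianKakutani.map_iterate_absolutelyContinuous hT)).trans hmμ,
      hμm.trans (HajianKakutani.absolutelyContinuous_ultraMeasure_cesaro fun A hA hmA => ?_),
      fun A hA => HajianKakutani.ultraMeasure_cesaro_preimage _ T hA⟩
    by_contra! hsmall
    obtain ⟨W, hW, hmW, hww⟩ := HajianKakutani.exists_weaklyWandering
      (HajianKakutani.map_iterate_absolutelyContinuous hTsymm) hA hmA hsmall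
    exact hno ⟨W, hW, pos_iff_ne_zero.2 fun h0 => hmW (hmμ h0), hww⟩
end

section
/- (Ornstein's example) Let Aₙ = {0, 1, …, n}, let νₙ be the probability on Aₙ with νₙ(0) = 1/2 and νₙ(i) = 1/(2n) for 0 < i ≤ n, and let (X, μ) = ⊗_{n=1}^∞ (Aₙ, νₙ) be the infinite product probability space. Define T : X → X by (Tx)ᵢ = 0 if i < l(x), (Tx)ᵢ = xᵢ + 1 if i = l(x), and (Tx)ᵢ = xᵢ if i > l(x), where l(x) is the smallest index l such that x_l ≠ l. Then T is a nonsingular transformation of (X, μ) and there exists no σ-finite T-invariant measure equivalent to μ (i.e. T is of type III). -/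
open MeasureTheory Set Filter ENNReal

/-- The underlying space of Ornstein's example: the `n`-th coordinate (indexed from `0`)
ranges over `Aₙ = {0, 1, …, n+1}` (in the paper, coordinates are indexed from `1` and the
`n`-th one ranges over `{0, 1, …, n}`). -/
abbrev OrnSpace : Type := ∀ n : ℕ, Fin (n + 2)

/-- The measure `νₙ` on `Aₙ = {0, …, n+1}` (here the coordinate index `n` starts at `0`,
corresponding to the paper's index `n+1`): `νₙ(0) = 1/2` and `νₙ(i) = 1/(2(n+1))` for
`0 < i ≤ n+1`. -/
noncomputable def ornNu (n : ℕ) (a : Fin (n + 2)) : ℝ≥0∞ :=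
  if (a : ℕ) = 0 then 2⁻¹ else (2 * ((n : ℝ≥0∞) + 1))⁻¹

/-- The Ornstein odometer: `(Tx)ᵢ = 0` if `i < l(x)`, `(Tx)ᵢ = xᵢ + 1` if `i = l(x)` and
`(Tx)ᵢ = xᵢ` if `i > l(x)`, where `l(x)` is the least `l` whose coordinate `x_l` is not
maximal; on the (single, null) point all of whose coordinates are maximal we set `Tx = 0`. -/
noncomputable def ornstein (x : OrnSpace) : OrnSpace := by
  classical
  exact if h : ∃ n : ℕ, (x n : ℕ) ≠ n + 1 then
    (fun i =>
      if i < Nat.find h then 0 else if i = Nat.find h then x i + 1 else x i)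
  else fun _ => 0

namespace Ornstein

section Prefix

variable {α : ℕ → Type*}

/-- Replace the first `n` coordinates of `x` by those of `b`. -/
def overwrite (n : ℕ) (b x : ∀ i, α i) : ∀ i, α i := fun i => if i < n then b i else x i

/-- A set is a tail set from `n` on if membership does not depend on the first `n` coordinates. -/
def IsTail (n : ℕ) (B : Set (∀ i, α i)) : Prop :=
  ∀ x y : ∀ i, α i, (∀ i, n ≤ i → x i = y i) → (x ∈ B ↔ y ∈ B)

lemma isTail_overwrite_preimage (n : ℕ) (b : ∀ i, α i) (C : Set (∀ i, α i)) :
    IsTail n (overwrite n b ⁻¹' C) := by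
  intro x y h
  have : overwrite n b x = overwrite n b y := by
    funext i
    by_cases hi : i < n
    · simp [overwrite, hi]
    · simp [overwrite, hi, h i (not_lt.1 hi)]
  simp [this]

lemma overwrite_eq_self {n : ℕ} {b x : ∀ i, α i} (h : x ∈ PiNat.cylinder b n) :
    overwrite n b x = x := by
  funext i
  by_cases hi : i < n
  · simp [overwrite, hi, h i hi]
  · simp [overwrite, hi]

lemma cylinder_inter_overwrite_preimage (n : ℕ) (b : ∀ i, α i) (C : Set (∀ i, α i)) :
    PiNat.cylinder b n ∩ overwrite n b ⁻¹' C = PiNat.cylinder b n ∩ C := by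
  ext x
  simp only [mem_inter_iff, mem_preimage, and_congr_right_iff]
  intro h
  rw [overwrite_eq_self h]

lemma IsTail.overwrite_preimage {n : ℕ} {B : Set (∀ i, α i)} (hB : IsTail n B) (b : ∀ i, α i) :
    overwrite n b ⁻¹' B = B := by
  ext x
  refine hB _ _ fun i hi => ?_
  simp [overwrite, not_lt.2 hi]

lemma IsTail.inter {n : ℕ} {B C : Set (∀ i, α i)} (hB : IsTail n B) (hC : IsTail n C) :
    IsTail n (B ∩ C) := fun x y h => and_congr (hB x y h) (hC x y h)

lemma measurable_overwrite [∀ i, MeasurableSpace (α i)] (n : ℕ) (b : ∀ i, α i) :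
    Measurable (overwrite n b) := by
  refine measurable_pi_lambda _ fun i => ?_
  by_cases hi : i < n
  · simp [overwrite, hi]
  · simpa [overwrite, hi] using measurable_pi_apply i

lemma isPiSystem_cylinder : IsPiSystem {s : Set (∀ i, α i) | ∃ x n, s = PiNat.cylinder x n} := by
  rintro _ ⟨x, n, rfl⟩ _ ⟨y, m, rfl⟩ ⟨z, hz, hz'⟩
  refine ⟨z, max n m, ?_⟩
  rw [PiNat.mem_cylinder_iff_eq] at hz hz'
  rw [← hz, ← hz']
  ext w
  simp only [mem_inter_iff, PiNat.mem_cylinder_iff, lt_max_iff]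
  exact ⟨fun h i hi => hi.elim (h.1 i) (h.2 i), fun h => ⟨fun i hi => h i (.inl hi),
    fun i hi => h i (.inr hi)⟩⟩

lemma cylinder_update_succ [∀ i, DecidableEq (α i)] (a : ∀ i, α i) (n : ℕ) (k : α n) :
    PiNat.cylinder (Function.update a n k) (n + 1) = PiNat.cylinder a n ∩ {x | x n = k} := by
  ext x
  simp only [PiNat.mem_cylinder_iff, mem_inter_iff, mem_ofPred_eq]
  constructor
  · intro h
    refine ⟨fun i hi => ?_, by simpa using h n (by omega)⟩
    rw [h i (by omega), Function.update_of_ne hi.ne]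
  · rintro ⟨h, h'⟩ i hi
    rcases (Nat.lt_succ_iff_lt_or_eq.1 hi) with hi | rfl
    · rw [h i hi, Function.update_of_ne hi.ne]
    · simpa using h'

end Prefix

lemma measurableSet_cylinder (a : OrnSpace) (n : ℕ) : MeasurableSet (PiNat.cylinder a n) :=
  (PiNat.isOpen_cylinder _ a n).measurableSet

lemma generateFrom_cylinder :
    (inferInstance : MeasurableSpace OrnSpace) =
      MeasurableSpace.generateFrom {s | ∃ x n, s = PiNat.cylinder x n} := by
  rw [← (PiNat.isTopologicalBasis_cylinders fun n => Fin (n + 2)).borel_eq_generateFrom]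
  exact BorelSpace.measurable_eq

section Density

variable {μ : Measure OrnSpace}

/-- If `E` has density at most `c` in every long cylinder, then `E` has density at most `c` in
every open set containing it. -/
lemma measure_le_mul_of_isOpen {E U : Set OrnSpace} {N : ℕ} {c : ℝ≥0∞}
    (h : ∀ x n, N ≤ n → μ (E ∩ PiNat.cylinder x n) ≤ c * μ (PiNat.cylinder x n))
    (hU : IsOpen U) (hEU : E ⊆ U) : μ E ≤ c * μ U := by
  classical
  set V : ℕ → Set OrnSpace := fun n => {x | PiNat.cylinder x n ⊆ U} with hV
  have hVmono : Monotone V := fun m n hmn x hx => (PiNat.cylinder_anti x hmn).trans hx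
  have hVU : ∀ n, V n ⊆ U := fun n x hx => hx (PiNat.self_mem_cylinder x n)
  have hUV : U ⊆ ⋃ n, V (N + n) := by
    intro x hx
    obtain ⟨_, ⟨y, n, rfl⟩, hxt, htU⟩ :=
      (PiNat.isTopologicalBasis_cylinders fun n => Fin (n + 2)).exists_subset_of_mem_open hx hU
    refine mem_iUnion.2 ⟨n, hVmono (Nat.le_add_left n N) ?_⟩
    rw [PiNat.mem_cylinder_iff_eq] at hxt
    simpa [hV, hxt] using htU
  have hbound : ∀ n, N ≤ n → μ (E ∩ V n) ≤ c * μ U := by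
    intro n hn
    let r : OrnSpace → (∀ i : Fin n, Fin (i + 2)) := fun x i => x i
    have hr : ∀ x, r ⁻¹' {r x} = PiNat.cylinder x n := by
      intro x
      ext y
      simp only [mem_preimage, mem_singleton_iff, PiNat.mem_cylinder_iff, funext_iff, r]
      exact ⟨fun h i hi => h ⟨i, hi⟩, fun h i => h i i.2⟩
    have hrm : Measurable r := measurable_pi_lambda _ fun i => measurable_pi_apply _
    have hVr : r ⁻¹' ((r '' V n).toFinset : Set _) = V n := by
      ext x
      simp only [coe_toFinset, mem_preimage, mem_image]
      refine ⟨?_, fun hx => ⟨x, hx, rfl⟩⟩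
      rintro ⟨y, hy, hxy⟩
      have : PiNat.cylinder x n = PiNat.cylinder y n := by rw [← hr, ← hr, hxy]
      simpa [hV, this] using hy
    have hVm : MeasurableSet (V n) := by
      rw [← hVr]; exact hrm (Set.toFinite _).measurableSet
    have hm : ∀ v : (∀ i : Fin n, Fin (i + 2)), MeasurableSet (r ⁻¹' {v}) :=
      fun v => hrm (measurableSet_singleton v)
    calc μ (E ∩ V n) = μ.restrict E (V n) := by rw [Measure.restrict_apply hVm, inter_comm]
      _ = ∑ v ∈ (r '' V n).toFinset, μ.restrict E (r ⁻¹' {v}) := by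
        rw [sum_measure_preimage_singleton _ fun v _ => hm v, hVr]
      _ ≤ ∑ v ∈ (r '' V n).toFinset, c * μ (r ⁻¹' {v}) := by
        refine Finset.sum_le_sum fun v hv => ?_
        obtain ⟨x, -, rfl⟩ := mem_toFinset.1 hv
        rw [Measure.restrict_apply (hm _), hr, inter_comm]
        exact h x n hn
      _ = c * μ (V n) := by
        rw [← Finset.mul_sum, sum_measure_preimage_singleton _ fun v _ => hm v, hVr]
      _ ≤ c * μ U := by gcongr; exact hVU n
  calc μ E ≤ μ (⋃ n, E ∩ V (N + n)) := by
        rw [← inter_iUnion]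
        exact measure_mono fun x hx => ⟨hx, hUV (hEU hx)⟩
    _ = ⨆ n, μ (E ∩ V (N + n)) := by
        refine Monotone.measure_iUnion fun m n hmn => ?_
        exact inter_subset_inter_right _ (hVmono (by omega))
    _ ≤ c * μ U := iSup_le fun n => hbound _ (Nat.le_add_right N n)

/-- A non-null set has density larger than `3 / 4` in some arbitrarily long cylinder. -/
lemma exists_cylinder_density [IsFiniteMeasure μ] {E : Set OrnSpace} (hE : μ E ≠ 0) (N : ℕ) :
    ∃ x n, N ≤ n ∧ 3 / 4 * μ.real (PiNat.cylinder x n) < μ.real (E ∩ PiNat.cylinder x n) := by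
  by_contra! hcon
  have h : ∀ x n, N ≤ n →
      μ (E ∩ PiNat.cylinder x n) ≤ ENNReal.ofReal (3 / 4) * μ (PiNat.cylinder x n) := by
    intro x n hn
    rw [← ofReal_measureReal (s := E ∩ PiNat.cylinder x n), ← ofReal_measureReal (s := PiNat.cylinder x n),
      ← ENNReal.ofReal_mul (by norm_num)]
    exact ENNReal.ofReal_le_ofReal (hcon x n hn)
  have hpos : 0 < μ.real E := ENNReal.toReal_pos hE (measure_ne_top _ _)
  have hlt : μ E < ENNReal.ofReal (5 / 4 * μ.real E) := by
    rw [← ofReal_measureReal (s := E)]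
    exact (ENNReal.ofReal_lt_ofReal_iff (by positivity)).2 (by linarith)
  obtain ⟨U, hEU, hU, hlt⟩ := E.exists_isOpen_lt_of_lt _ hlt
  have h1 := measure_le_mul_of_isOpen h hU hEU
  have h2 : μ.real E ≤ 3 / 4 * μ.real U := by
    have := ENNReal.toReal_mono (by finiteness) h1
    rwa [ENNReal.toReal_mul, ENNReal.toReal_ofReal (by norm_num)] at this
  have h3 : μ.real U < 5 / 4 * μ.real E := (ENNReal.lt_ofReal_iff_toReal_lt (by finiteness)).1 hlt
  linarith

end Density

section Dynamics

/-- The point all of whose coordinates are maximal. -/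
def maxPt : OrnSpace := fun n => Fin.last (n + 1)

lemma exists_mem_cylinder_maxPt {x : OrnSpace} (hx : x ≠ maxPt) :
    ∃ (n : ℕ) (k : Fin (n + 2)), k ≠ Fin.last (n + 1) ∧
      x ∈ PiNat.cylinder (Function.update maxPt n k) (n + 1) := by
  classical
  have h : ∃ n, x n ≠ maxPt n := Function.ne_iff.1 hx
  refine ⟨Nat.find h, x (Nat.find h), Nat.find_spec h, ?_⟩
  rw [cylinder_update_succ]
  exact ⟨fun i hi => not_not.1 (Nat.find_min h hi), rfl⟩

lemma exists_mem_cylinder_zero {x : OrnSpace} (hx : x ≠ 0) :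
    ∃ (n : ℕ) (k : Fin (n + 2)), k ≠ 0 ∧ x ∈ PiNat.cylinder (Function.update 0 n k) (n + 1) := by
  classical
  have h : ∃ n, x n ≠ (0 : OrnSpace) n := Function.ne_iff.1 hx
  refine ⟨Nat.find h, x (Nat.find h), Nat.find_spec h, ?_⟩
  rw [cylinder_update_succ]
  exact ⟨fun i hi => not_not.1 (Nat.find_min h hi), rfl⟩

lemma ornstein_maxPt : ornstein maxPt = 0 := by
  unfold ornstein
  rw [dif_neg]
  · rfl
  · simp [maxPt]

lemma ornstein_eq_overwrite {n : ℕ} {k : Fin (n + 2)} (hk : k ≠ Fin.last (n + 1)) {x : OrnSpace}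
    (hx : x ∈ PiNat.cylinder (Function.update maxPt n k) (n + 1)) :
    ornstein x = overwrite (n + 1) (Function.update 0 n (k + 1)) x := by
  classical
  rw [cylinder_update_succ] at hx
  obtain ⟨hx, hxn⟩ := hx
  simp only [mem_ofPred_eq] at hxn
  have hne : (x n : ℕ) ≠ n + 1 := by
    rw [hxn]
    exact fun h => hk (Fin.ext (by simpa using h))
  have hex : ∃ n, (x n : ℕ) ≠ n + 1 := ⟨n, hne⟩
  have hfind : Nat.find hex = n := by
    rw [Nat.find_eq_iff]
    refine ⟨hne, fun m hm => ?_⟩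
    rw [hx m hm]
    simp [maxPt]
  unfold ornstein
  rw [dif_pos hex]
  funext i
  have hfind' : ∀ inst : DecidablePred fun n => (x n : ℕ) ≠ n + 1, @Nat.find _ inst hex = n := by
    intro inst
    convert hfind
  simp only [hfind', overwrite]
  rcases lt_trichotomy i n with hi | rfl | hi
  · simp [hi, hi.ne, Nat.lt_succ_of_lt hi]
  · simp [hxn]
  · simp [hi.ne', not_lt.2 hi.le, not_lt.2 (Nat.succ_le_of_lt hi)]

lemma cylinder_zero_unique {n m : ℕ} {j : Fin (n + 2)} {k : Fin (m + 2)} (hj : j ≠ 0) (hk : k ≠ 0)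
    {x : OrnSpace} (h : x ∈ PiNat.cylinder (Function.update 0 n j) (n + 1))
    (h' : x ∈ PiNat.cylinder (Function.update 0 m k) (m + 1)) : n = m := by
  rw [cylinder_update_succ] at h h'
  rcases lt_trichotomy n m with hlt | rfl | hlt
  · exact absurd (h.2.symm.trans (h'.1 n hlt)) hj
  · rfl
  · exact absurd (h'.2.symm.trans (h.1 m hlt)) hk

lemma add_one_ne_zero_of_ne_last {n : ℕ} {k : Fin (n + 2)} (hk : k ≠ Fin.last (n + 1)) :
    k + 1 ≠ 0 := by
  intro h
  apply hk
  rw [← Fin.last_add_one] at h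
  exact add_right_cancel h

lemma overwrite_mem_cylinder (n : ℕ) (b x : OrnSpace) : overwrite n b x ∈ PiNat.cylinder b n := by
  intro i hi
  simp [overwrite, hi]

lemma ornstein_mem_cylinder_iff {n : ℕ} {k : Fin (n + 2)} (hk : k ≠ Fin.last (n + 1))
    (x : OrnSpace) : ornstein x ∈ PiNat.cylinder (Function.update 0 n (k + 1)) (n + 1) ↔
      x ∈ PiNat.cylinder (Function.update maxPt n k) (n + 1) := by
  have hk0 := add_one_ne_zero_of_ne_last hk
  constructor
  · intro h
    rcases eq_or_ne x maxPt with rfl | hx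
    · rw [ornstein_maxPt] at h
      have := h n (Nat.lt_succ_self n)
      simp only [Function.update_self] at this
      exact absurd this.symm hk0
    · obtain ⟨m, l, hl, hxm⟩ := exists_mem_cylinder_maxPt hx
      have h' : ornstein x ∈ PiNat.cylinder (Function.update 0 m (l + 1)) (m + 1) := by
        rw [ornstein_eq_overwrite hl hxm]
        exact overwrite_mem_cylinder _ _ _
      obtain rfl := cylinder_zero_unique hk0 (add_one_ne_zero_of_ne_last hl) h h'
      rw [cylinder_update_succ] at h h'
      obtain rfl : k = l := add_right_cancel (h.2.symm.trans h'.2)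
      exact hxm
  · intro h
    rw [ornstein_eq_overwrite hk h]
    exact overwrite_mem_cylinder _ _ _

lemma cylinder_inter_ornstein_preimage {n : ℕ} {k : Fin (n + 2)} (hk : k ≠ Fin.last (n + 1))
    (C : Set OrnSpace) :
    PiNat.cylinder (Function.update maxPt n k) (n + 1) ∩ ornstein ⁻¹' C =
      PiNat.cylinder (Function.update maxPt n k) (n + 1) ∩
        overwrite (n + 1) (Function.update 0 n (k + 1)) ⁻¹' C := by
  ext x
  simp only [mem_inter_iff, mem_preimage, and_congr_right_iff]
  intro h
  rw [ornstein_eq_overwrite hk h]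

end Dynamics

section ProductMeasure

/-- `μ` assigns to cylinders the product weights given by `ornNu`. -/
def IsOrnsteinProduct (μ : Measure OrnSpace) : Prop :=
  ∀ (n : ℕ) (a : ∀ i : ℕ, Fin (i + 2)),
    μ {x : OrnSpace | ∀ i < n, x i = a i} = ∏ i ∈ Finset.range n, ornNu i (a i)

variable {μ : Measure OrnSpace}

lemma IsOrnsteinProduct.measure_cylinder (hμ : IsOrnsteinProduct μ) (a : OrnSpace) (n : ℕ) :
    μ (PiNat.cylinder a n) = ∏ i ∈ Finset.range n, ornNu i (a i) := hμ n a

lemma ornNu_ne_zero (n : ℕ) (a : Fin (n + 2)) : ornNu n a ≠ 0 := by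
  unfold ornNu
  split_ifs
  · simp
  · exact ENNReal.inv_ne_zero.2 (by finiteness)

lemma ornNu_le (n : ℕ) (a : Fin (n + 2)) : ornNu n a ≤ 2⁻¹ := by
  unfold ornNu
  split_ifs
  · exact le_rfl
  · rw [ENNReal.inv_le_inv]
    exact le_mul_of_one_le_right' (le_add_self)

lemma ornNu_ne_top (n : ℕ) (a : Fin (n + 2)) : ornNu n a ≠ ∞ :=
  ne_top_of_le_ne_top (by simp) (ornNu_le n a)

lemma ornNu_zero (n : ℕ) : ornNu n 0 = 2⁻¹ := by simp [ornNu]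

lemma add_one_mul_ornNu {n : ℕ} {k : Fin (n + 2)} (hk : k ≠ 0) :
    ((n : ℝ≥0∞) + 1) * ornNu n k = 2⁻¹ := by
  have : (k : ℕ) ≠ 0 := fun h => hk (Fin.ext h)
  rw [ornNu, if_neg this, ENNReal.mul_inv (by simp) (by simp), mul_left_comm,
    ENNReal.mul_inv_cancel (by simp) (by finiteness), mul_one]

lemma IsOrnsteinProduct.measure_cylinder_ne_zero (hμ : IsOrnsteinProduct μ) (a : OrnSpace)
    (n : ℕ) : μ (PiNat.cylinder a n) ≠ 0 := by
  rw [hμ.measure_cylinder]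
  exact Finset.prod_ne_zero_iff.2 fun i _ => ornNu_ne_zero i _

lemma IsOrnsteinProduct.measure_cylinder_update_succ (hμ : IsOrnsteinProduct μ) (a : OrnSpace)
    (n : ℕ) (k : Fin (n + 2)) :
    μ (PiNat.cylinder (Function.update a n k) (n + 1)) =
      μ (PiNat.cylinder a n) * ornNu n k := by
  rw [hμ.measure_cylinder, hμ.measure_cylinder, Finset.prod_range_succ, Function.update_self]
  congr 1
  refine Finset.prod_congr rfl fun i hi => ?_
  rw [Function.update_of_ne (Finset.mem_range.1 hi).ne]

lemma IsOrnsteinProduct.measure_singleton (hμ : IsOrnsteinProduct μ) (x : OrnSpace) :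
    μ {x} = 0 := by
  have h : ∀ n : ℕ, μ {x} ≤ 2⁻¹ ^ n := by
    intro n
    calc μ {x} ≤ μ (PiNat.cylinder x n) :=
          measure_mono (singleton_subset_iff.2 (PiNat.self_mem_cylinder x n))
      _ ≤ 2⁻¹ ^ n := by
        rw [hμ.measure_cylinder]
        simpa using Finset.prod_le_pow_card (Finset.range n) _ 2⁻¹ fun i _ => ornNu_le i (x i)
  refine le_antisymm (ge_of_tendsto' (ENNReal.tendsto_pow_atTop_nhds_zero_of_lt_one ?_) h) zero_le
  simp

lemma cylinder_inter_cylinder {n m : ℕ} {b c : OrnSpace}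
    (h : ∀ i, i < n → i < m → c i = b i) :
    PiNat.cylinder b n ∩ PiNat.cylinder c m = PiNat.cylinder (overwrite n b c) (max n m) := by
  ext x
  simp only [mem_inter_iff, PiNat.mem_cylinder_iff, overwrite, lt_max_iff]
  grind

lemma cylinder_inter_overwrite_preimage_cylinder {n m : ℕ} (a : OrnSpace) {b c : OrnSpace}
    (h : ∀ i, i < n → i < m → c i = b i) :
    PiNat.cylinder a n ∩ overwrite n b ⁻¹' PiNat.cylinder c m =
      PiNat.cylinder (overwrite n a c) (max n m) := by
  ext x
  simp only [mem_inter_iff, mem_preimage, PiNat.mem_cylinder_iff, overwrite, lt_max_iff]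
  grind

lemma IsOrnsteinProduct.measure_cylinder_overwrite (hμ : IsOrnsteinProduct μ) (n m : ℕ)
    (a c : OrnSpace) :
    μ (PiNat.cylinder (overwrite n a c) (max n m)) =
      μ (PiNat.cylinder a n) * ∏ i ∈ Finset.Ico n (max n m), ornNu i (c i) := by
  rw [hμ.measure_cylinder, hμ.measure_cylinder,
    ← Finset.prod_range_mul_prod_Ico _ (le_max_left n m)]
  congr 1
  · refine Finset.prod_congr rfl fun i hi => ?_
    simp [overwrite, Finset.mem_range.1 hi]
  · refine Finset.prod_congr rfl fun i hi => ?_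
    simp [overwrite, not_lt.2 (Finset.mem_Ico.1 hi).1]

/-- Under the product measure, replacing the prefix `b` by the prefix `a` rescales measures
by the ratio of the weights of the prefixes. -/
lemma IsOrnsteinProduct.measure_overwrite_preimage [IsFiniteMeasure μ]
    (hμ : IsOrnsteinProduct μ) (n : ℕ)
    (a b : OrnSpace) {C : Set OrnSpace} (hC : MeasurableSet C) :
    μ (PiNat.cylinder b n) * μ (PiNat.cylinder a n ∩ overwrite n b ⁻¹' C) =
      μ (PiNat.cylinder a n) * μ (PiNat.cylinder b n ∩ C) := by
  set m₁ : Measure OrnSpace :=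
    μ (PiNat.cylinder b n) • (μ.restrict (PiNat.cylinder a n)).map (overwrite n b) with hm₁
  set m₂ : Measure OrnSpace :=
    μ (PiNat.cylinder a n) • μ.restrict (PiNat.cylinder b n) with hm₂
  have h₁ : ∀ D, MeasurableSet D →
      m₁ D = μ (PiNat.cylinder b n) * μ (PiNat.cylinder a n ∩ overwrite n b ⁻¹' D) := by
    intro D hD
    rw [hm₁, Measure.smul_apply, smul_eq_mul, Measure.map_apply (measurable_overwrite n b) hD,
      Measure.restrict_apply (measurable_overwrite n b hD), inter_comm]
  have h₂ : ∀ D, MeasurableSet D →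
      m₂ D = μ (PiNat.cylinder a n) * μ (PiNat.cylinder b n ∩ D) := by
    intro D hD
    rw [hm₂, Measure.smul_apply, smul_eq_mul, Measure.restrict_apply hD, inter_comm]
  have hfin : IsFiniteMeasure m₁ := by
    refine ⟨?_⟩
    rw [h₁ _ MeasurableSet.univ]
    finiteness
  have hcyl : ∀ c m, m₁ (PiNat.cylinder c m) = m₂ (PiNat.cylinder c m) := by
    intro c m
    rw [h₁ _ (measurableSet_cylinder c m), h₂ _ (measurableSet_cylinder c m)]
    by_cases h : ∀ i, i < n → i < m → c i = b i
    · rw [cylinder_inter_cylinder h, cylinder_inter_overwrite_preimage_cylinder a h,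
        hμ.measure_cylinder_overwrite, hμ.measure_cylinder_overwrite, mul_left_comm]
    · push Not at h
      obtain ⟨i, hin, him, hne⟩ := h
      have e₁ : PiNat.cylinder a n ∩ overwrite n b ⁻¹' PiNat.cylinder c m = ∅ := by
        refine eq_empty_of_forall_notMem fun x hx => hne ?_
        simpa [overwrite, hin] using (hx.2 i him).symm
      have e₂ : PiNat.cylinder b n ∩ PiNat.cylinder c m = ∅ :=
        eq_empty_of_forall_notMem fun x hx => hne ((hx.2 i him).symm.trans (hx.1 i hin))
      rw [e₁, e₂, measure_empty, mul_zero, mul_zero]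
  have key : m₁ = m₂ := by
    refine ext_of_generate_finite _ generateFrom_cylinder isPiSystem_cylinder ?_ ?_
    · rintro _ ⟨c, m, rfl⟩
      exact hcyl c m
    · simpa using hcyl 0 0
  rw [← h₁ C hC, ← h₂ C hC, key]

lemma IsOrnsteinProduct.measure_inter_isTail [IsFiniteMeasure μ] (hμ : IsOrnsteinProduct μ)
    {n : ℕ} (a b : OrnSpace) {B : Set OrnSpace} (hB : MeasurableSet B) (hBt : IsTail n B) :
    μ (PiNat.cylinder b n) * μ (PiNat.cylinder a n ∩ B) =
      μ (PiNat.cylinder a n) * μ (PiNat.cylinder b n ∩ B) := by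
  simpa only [hBt.overwrite_preimage] using hμ.measure_overwrite_preimage n a b hB

end ProductMeasure

section Nonsingular

variable {μ : Measure OrnSpace}

lemma IsOrnsteinProduct.measure_eq_zero_iff_maxPt (hμ : IsOrnsteinProduct μ) (N : Set OrnSpace) :
    μ N = 0 ↔ ∀ (n : ℕ) (k : Fin (n + 2)), k ≠ Fin.last (n + 1) →
      μ (PiNat.cylinder (Function.update maxPt n k) (n + 1) ∩ N) = 0 := by
  refine ⟨fun h n k _ => measure_mono_null inter_subset_right h, fun h => ?_⟩
  have hsub : N ⊆ {maxPt} ∪ ⋃ (n : ℕ) (k : Fin (n + 2)) (_ : k ≠ Fin.last (n + 1)),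
      PiNat.cylinder (Function.update maxPt n k) (n + 1) ∩ N := by
    intro x hx
    rcases eq_or_ne x maxPt with rfl | hne
    · exact .inl rfl
    · obtain ⟨n, k, hk, hxk⟩ := exists_mem_cylinder_maxPt hne
      exact .inr (mem_iUnion.2 ⟨n, mem_iUnion.2 ⟨k, mem_iUnion.2 ⟨hk, hxk, hx⟩⟩⟩)
  refine measure_mono_null hsub (measure_union_null (hμ.measure_singleton _) ?_)
  simpa only [measure_iUnion_null_iff] using h

lemma IsOrnsteinProduct.measure_eq_zero_iff_zero (hμ : IsOrnsteinProduct μ) (N : Set OrnSpace) :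
    μ N = 0 ↔ ∀ (n : ℕ) (k : Fin (n + 2)), k ≠ 0 →
      μ (PiNat.cylinder (Function.update 0 n k) (n + 1) ∩ N) = 0 := by
  refine ⟨fun h n k _ => measure_mono_null inter_subset_right h, fun h => ?_⟩
  have hsub : N ⊆ {0} ∪ ⋃ (n : ℕ) (k : Fin (n + 2)) (_ : k ≠ 0),
      PiNat.cylinder (Function.update 0 n k) (n + 1) ∩ N := by
    intro x hx
    rcases eq_or_ne x 0 with rfl | hne
    · exact .inl rfl
    · obtain ⟨n, k, hk, hxk⟩ := exists_mem_cylinder_zero hne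
      exact .inr (mem_iUnion.2 ⟨n, mem_iUnion.2 ⟨k, mem_iUnion.2 ⟨hk, hxk, hx⟩⟩⟩)
  refine measure_mono_null hsub (measure_union_null (hμ.measure_singleton _) ?_)
  simpa only [measure_iUnion_null_iff] using h

lemma IsOrnsteinProduct.measure_ornstein_preimage_eq_zero_iff [IsFiniteMeasure μ]
    (hμ : IsOrnsteinProduct μ) {N : Set OrnSpace} (hN : MeasurableSet N) :
    μ (ornstein ⁻¹' N) = 0 ↔ μ N = 0 := by
  have key : ∀ (n : ℕ) (k : Fin (n + 2)), k ≠ Fin.last (n + 1) →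
      (μ (PiNat.cylinder (Function.update maxPt n k) (n + 1) ∩ ornstein ⁻¹' N) = 0 ↔
        μ (PiNat.cylinder (Function.update 0 n (k + 1)) (n + 1) ∩ N) = 0) := by
    intro n k hk
    rw [cylinder_inter_ornstein_preimage hk]
    have h := hμ.measure_overwrite_preimage (n + 1) (Function.update maxPt n k)
      (Function.update 0 n (k + 1)) hN
    constructor <;> intro h0
    · rw [h0, mul_zero] at h
      exact (mul_eq_zero.1 h.symm).resolve_left (hμ.measure_cylinder_ne_zero _ _)
    · rw [h0, mul_zero] at h
      exact (mul_eq_zero.1 h).resolve_left (hμ.measure_cylinder_ne_zero _ _)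
  rw [hμ.measure_eq_zero_iff_maxPt, hμ.measure_eq_zero_iff_zero]
  constructor
  · intro h n k hk
    have hk' : k - 1 ≠ Fin.last (n + 1) := by
      intro hl
      rw [sub_eq_iff_eq_add, Fin.last_add_one] at hl
      exact hk hl
    simpa using (key n (k - 1) hk').1 (h n _ hk')
  · exact fun h n k hk => (key n k hk).2 (h n _ (add_one_ne_zero_of_ne_last hk))

end Nonsingular

section TypeIII

variable {μ ν : Measure OrnSpace}

/-- An invariant measure gives the same mass to a tail set in all cylinders of the same length. -/
lemma measure_cylinder_inter_isTail_eq
    (hν : ∀ A : Set OrnSpace, MeasurableSet A → ν (ornstein ⁻¹' A) = ν A) (n : ℕ)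
    (a b : OrnSpace) {B : Set OrnSpace} (hB : MeasurableSet B) (hBt : IsTail n B) :
    ν (PiNat.cylinder a n ∩ B) = ν (PiNat.cylinder b n ∩ B) := by
  induction n generalizing a b B with
  | zero => simp
  | succ n ih =>
    suffices h : ∀ c, ν (PiNat.cylinder c (n + 1) ∩ B) =
        ν (PiNat.cylinder (Function.update 0 n 0) (n + 1) ∩ B) by rw [h a, h b]
    have hm : ∀ k : Fin (n + 2), MeasurableSet ({x : OrnSpace | x n = k} ∩ B) := fun k =>
      (measurableSet_eq_fun (measurable_pi_apply n) measurable_const).inter hB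
    have ht : ∀ k : Fin (n + 2), IsTail n ({x : OrnSpace | x n = k} ∩ B) := by
      refine fun k => IsTail.inter ?_ ?_
      · intro x y h
        simp [h n le_rfl]
      · exact fun x y h => hBt x y fun i hi => h i (Nat.le_of_succ_le hi)
    have hmove : ∀ (c d : OrnSpace) (k : Fin (n + 2)),
        ν (PiNat.cylinder (Function.update c n k) (n + 1) ∩ B) =
          ν (PiNat.cylinder (Function.update d n k) (n + 1) ∩ B) := by
      intro c d k
      rw [cylinder_update_succ, cylinder_update_succ, inter_assoc, inter_assoc]
      exact ih c d (hm k) (ht k)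
    have hstep : ∀ k : Fin (n + 2), k ≠ Fin.last (n + 1) →
        ν (PiNat.cylinder (Function.update 0 n (k + 1)) (n + 1) ∩ B) =
          ν (PiNat.cylinder (Function.update 0 n k) (n + 1) ∩ B) := by
      intro k hk
      rw [← hν _ ((measurableSet_cylinder _ _).inter hB), hmove 0 maxPt k, preimage_inter,
        show ornstein ⁻¹' PiNat.cylinder (Function.update 0 n (k + 1)) (n + 1) =
          PiNat.cylinder (Function.update maxPt n k) (n + 1) from
          ext fun x => ornstein_mem_cylinder_iff hk x,
        cylinder_inter_ornstein_preimage hk, hBt.overwrite_preimage]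
    have hall : ∀ k : Fin (n + 2), ν (PiNat.cylinder (Function.update 0 n k) (n + 1) ∩ B) =
        ν (PiNat.cylinder (Function.update 0 n 0) (n + 1) ∩ B) := by
      intro k
      induction k using Fin.induction with
      | zero => rfl
      | succ i hi =>
        rw [← hi, ← hstep i.castSucc (Fin.castSucc_lt_last i).ne, Fin.coeSucc_eq_succ]
    intro c
    rw [← hall (c n), ← hmove c 0 (c n), Function.update_eq_self]

/-- On some non-null set, the density of `ν` with respect to `μ` varies by at most a factor two. -/
lemma exists_measure_comparable [SigmaFinite μ] [SigmaFinite ν] [NeZero μ] (hνμ : ν ≪ μ)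
    (hμν : μ ≪ ν) :
    ∃ (E : Set OrnSpace) (c : ℝ≥0∞), MeasurableSet E ∧ μ E ≠ 0 ∧ c ≠ 0 ∧ c ≠ ∞ ∧
      ∀ A ⊆ E, MeasurableSet A → c * μ A ≤ ν A ∧ ν A ≤ 2 * c * μ A := by
  have hf : Measurable (ν.rnDeriv μ) := Measure.measurable_rnDeriv ν μ
  set E : ℤ → Set OrnSpace := fun k => ν.rnDeriv μ ⁻¹' Ico (2 ^ k) (2 ^ (k + 1)) with hE
  have hex : ∃ k, μ (E k) ≠ 0 := by
    by_contra! h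
    have h0 : ∀ᵐ x ∂μ, x ∉ ⋃ k, E k := measure_eq_zero_iff_ae_notMem.1 (measure_iUnion_null h)
    have hF : ∀ᵐ _ ∂μ, False := by
      filter_upwards [h0, hμν.ae_le (Measure.rnDeriv_pos hνμ), Measure.rnDeriv_lt_top ν μ]
        with x hx hpos hlt
      obtain ⟨k, hk⟩ := ENNReal.exists_mem_Ico_zpow hpos.ne' hlt.ne (y := 2) (by norm_num)
        (by norm_num)
      exact hx (mem_iUnion.2 ⟨k, hk⟩)
    rw [ae_iff] at hF
    simp [NeZero.ne μ] at hF
  obtain ⟨k, hk⟩ := hex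
  refine ⟨E k, 2 ^ k, hf measurableSet_Ico, hk, ?_, ?_, fun A hA hAm => ?_⟩
  · exact (ENNReal.zpow_pos (by norm_num) (by norm_num) k).ne'
  · exact (ENNReal.zpow_lt_top (by norm_num) (by norm_num) k).ne
  have hνA : ν A = ∫⁻ x in A, ν.rnDeriv μ x ∂μ := by
    rw [← withDensity_apply _ hAm, Measure.withDensity_rnDeriv_eq ν μ hνμ]
  have h2 : (2 : ℝ≥0∞) ^ (k + 1) = 2 * 2 ^ k := by
    rw [ENNReal.zpow_add (by norm_num) (by norm_num), zpow_one, mul_comm]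
  rw [hνA, ← h2, ← setLIntegral_const, ← setLIntegral_const]
  exact ⟨setLIntegral_mono hf fun x hx => (hA hx).1,
    setLIntegral_mono measurable_const fun x hx => (hA hx).2.le⟩

/-- A set that is dense in a cylinder is dense in its `0`-child and in some other child. -/
lemma IsOrnsteinProduct.exists_dense_children [IsFiniteMeasure μ] (hμ : IsOrnsteinProduct μ)
    {E : Set OrnSpace} {a : OrnSpace} {n : ℕ}
    (h : 3 / 4 * μ.real (PiNat.cylinder a n) < μ.real (E ∩ PiNat.cylinder a n)) :
    μ.real (PiNat.cylinder (Function.update a n 0) (n + 1)) <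
        2 * μ.real (PiNat.cylinder (Function.update a n 0) (n + 1) ∩ E) ∧
      ∃ k : Fin (n + 2), k ≠ 0 ∧
        μ.real (PiNat.cylinder (Function.update a n k) (n + 1)) <
          2 * μ.real (PiNat.cylinder (Function.update a n k) (n + 1) ∩ E) := by
  set w : Fin (n + 2) → ℝ := fun k => μ.real (PiNat.cylinder (Function.update a n k) (n + 1))
    with hw
  set e : Fin (n + 2) → ℝ :=
    fun k => μ.real (PiNat.cylinder (Function.update a n k) (n + 1) ∩ E) with he
  have hew : ∀ k, e k ≤ w k := fun k => measureReal_mono inter_subset_left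
  have hcyl : ∀ k, PiNat.cylinder (Function.update a n k) (n + 1) =
      (fun x : OrnSpace => x n) ⁻¹' {k} ∩ PiNat.cylinder a n := fun k => by
    rw [cylinder_update_succ, inter_comm]; rfl
  have hmeas : ∀ k : Fin (n + 2), MeasurableSet ((fun x : OrnSpace => x n) ⁻¹' {k}) := fun k =>
    (measurable_pi_apply n) (measurableSet_singleton k)
  have hsum : ∀ S : Set OrnSpace,
      ∑ k : Fin (n + 2), μ.real ((fun x : OrnSpace => x n) ⁻¹' {k} ∩ S) = μ.real S := by
    intro S
    have h1 := sum_measure_preimage_singleton (μ := μ.restrict S) Finset.univ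
      (f := fun x : OrnSpace => x n) fun k _ => hmeas k
    simp only [Measure.restrict_apply (hmeas _), Finset.coe_univ, preimage_univ,
      Measure.restrict_apply_univ] at h1
    simp only [Measure.real, ← h1]
    exact (ENNReal.toReal_sum fun k _ => measure_ne_top _ _).symm
  have hw0 : w 0 = μ.real (PiNat.cylinder a n) / 2 := by
    simp only [hw, Measure.real, hμ.measure_cylinder_update_succ, ornNu_zero, ENNReal.toReal_mul]
    simp [div_eq_mul_inv]
  have hwsum : w 0 + ∑ k : Fin (n + 1), w k.succ = μ.real (PiNat.cylinder a n) := by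
    rw [← Fin.sum_univ_succ, ← hsum]
    simp only [hw, hcyl]
  have hesum : e 0 + ∑ k : Fin (n + 1), e k.succ = μ.real (E ∩ PiNat.cylinder a n) := by
    rw [← Fin.sum_univ_succ, inter_comm, ← hsum]
    simp only [he, hcyl, inter_assoc]
  have hle : ∑ k : Fin (n + 1), e k.succ ≤ ∑ k : Fin (n + 1), w k.succ :=
    Finset.sum_le_sum fun k _ => hew _
  refine ⟨show w 0 < 2 * e 0 by linarith, ?_⟩
  by_contra! hcon
  have hle' : ∑ k : Fin (n + 1), 2 * e k.succ ≤ ∑ k : Fin (n + 1), w k.succ :=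
    Finset.sum_le_sum fun k _ => hcon k.succ (Fin.succ_ne_zero k)
  rw [← Finset.mul_sum] at hle'
  linarith [hew 0]

lemma IsOrnsteinProduct.not_exists_invariant [IsProbabilityMeasure μ]
    (hμ : IsOrnsteinProduct μ) [SigmaFinite ν] (hνμ : ν ≪ μ) (hμν : μ ≪ ν)
    (hν : ∀ A : Set OrnSpace, MeasurableSet A → ν (ornstein ⁻¹' A) = ν A) : False := by
  obtain ⟨E, c, hEm, hE0, hc0, hct, hEc⟩ := exists_measure_comparable hνμ hμν
  obtain ⟨a, n, hn, hdens⟩ := exists_cylinder_density hE0 2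
  obtain ⟨h0, k, hk, h1⟩ := hμ.exists_dense_children hdens
  set b₀ : OrnSpace := Function.update a n 0
  set b₁ : OrnSpace := Function.update a n k
  have hw₀ : μ (PiNat.cylinder b₀ (n + 1)) = (n + 1) * μ (PiNat.cylinder b₁ (n + 1)) := by
    rw [hμ.measure_cylinder_update_succ, hμ.measure_cylinder_update_succ, mul_left_comm,
      add_one_mul_ornNu hk, ornNu_zero]
  have hw₁ : μ (PiNat.cylinder b₁ (n + 1)) ≠ 0 := hμ.measure_cylinder_ne_zero _ _
  set B₀ := overwrite (n + 1) b₀ ⁻¹' E with hB₀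
  set B₁ := overwrite (n + 1) b₁ ⁻¹' E with hB₁
  have hB₀m : MeasurableSet B₀ := measurable_overwrite _ _ hEm
  have hB₁m : MeasurableSet B₁ := measurable_overwrite _ _ hEm
  have hB₀t : IsTail (n + 1) B₀ := isTail_overwrite_preimage _ _ _
  have hB₁t : IsTail (n + 1) B₁ := isTail_overwrite_preimage _ _ _
  have hratio : ∀ B, MeasurableSet B → IsTail (n + 1) B →
      μ (PiNat.cylinder b₀ (n + 1) ∩ B) = (n + 1) * μ (PiNat.cylinder b₁ (n + 1) ∩ B) := by
    intro B hB hBt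
    have h := hμ.measure_inter_isTail b₀ b₁ hB hBt
    rw [hw₀, mul_comm ((n : ℝ≥0∞) + 1), mul_assoc] at h
    exact (ENNReal.mul_right_inj hw₁ (measure_ne_top _ _)).1 h
  have hsub₀ : PiNat.cylinder b₀ (n + 1) ∩ (B₀ ∩ B₁) ⊆ E := by
    rw [← inter_assoc, hB₀, cylinder_inter_overwrite_preimage]
    exact inter_subset_left.trans inter_subset_right
  have hsub₁ : PiNat.cylinder b₁ (n + 1) ∩ (B₀ ∩ B₁) ⊆ E := by
    rw [inter_comm B₀, ← inter_assoc, hB₁, cylinder_inter_overwrite_preimage]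
    exact inter_subset_left.trans inter_subset_right
  have hreal : ∀ B, MeasurableSet B → IsTail (n + 1) B →
      μ.real (PiNat.cylinder b₀ (n + 1) ∩ B) =
        (n + 1) * μ.real (PiNat.cylinder b₁ (n + 1) ∩ B) := by
    intro B hB hBt
    simp only [Measure.real, hratio B hB hBt, ENNReal.toReal_mul]
    congr 1
  have hpos : 0 < μ.real (PiNat.cylinder b₁ (n + 1) ∩ (B₀ ∩ B₁)) := by
    rw [← cylinder_inter_overwrite_preimage] at h0 h1
    have hd₁ : μ.real (PiNat.cylinder b₀ (n + 1)) =
        (n + 1) * μ.real (PiNat.cylinder b₁ (n + 1)) := by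
      simpa using hreal univ MeasurableSet.univ fun _ _ _ => by simp
    have hd₂ := hreal B₀ hB₀m hB₀t
    have hn' : (0 : ℝ) < n + 1 := by positivity
    have h0' : μ.real (PiNat.cylinder b₁ (n + 1)) <
        2 * μ.real (PiNat.cylinder b₁ (n + 1) ∩ B₀) := by
      rw [hd₁, hd₂, mul_left_comm] at h0
      exact lt_of_mul_lt_mul_left h0 hn'.le
    have hadd := measureReal_union_add_inter (μ := μ) (s := PiNat.cylinder b₁ (n + 1) ∩ B₀)
      ((measurableSet_cylinder b₁ (n + 1)).inter hB₁m)
    rw [← inter_inter_distrib_left] at hadd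
    have hle : μ.real (PiNat.cylinder b₁ (n + 1) ∩ B₀ ∪ PiNat.cylinder b₁ (n + 1) ∩ B₁) ≤
        μ.real (PiNat.cylinder b₁ (n + 1)) :=
      measureReal_mono (union_subset inter_subset_left inter_subset_left)
    linarith
  have hBm := hB₀m.inter hB₁m
  have hBt := hB₀t.inter hB₁t
  have hchain : c * ((n + 1) * μ (PiNat.cylinder b₁ (n + 1) ∩ (B₀ ∩ B₁))) ≤
      2 * c * μ (PiNat.cylinder b₁ (n + 1) ∩ (B₀ ∩ B₁)) := by
    rw [← hratio _ hBm hBt]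
    refine (hEc _ hsub₀ ((measurableSet_cylinder _ _).inter hBm)).1.trans ?_
    rw [measure_cylinder_inter_isTail_eq hν (n + 1) b₀ b₁ hBm hBt]
    exact (hEc _ hsub₁ ((measurableSet_cylinder _ _).inter hBm)).2
  have hfin := ENNReal.toReal_mono (by finiteness) hchain
  simp only [ENNReal.toReal_mul, ← Measure.real_def] at hfin
  have hc : 0 < c.toReal := ENNReal.toReal_pos hc0 hct
  have hn1 : ((n : ℝ≥0∞) + 1).toReal = n + 1 := by norm_cast
  have hn2 : (2 : ℝ) ≤ n := by exact_mod_cast hn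
  rw [hn1, ENNReal.toReal_ofNat] at hfin
  nlinarith [mul_pos hc hpos]

end TypeIII

end Ornstein

/-- **Ornstein's example of a type III transformation.** If `μ` is the infinite product
of the measures `ornNu n` (i.e. the cylinders have the product measures), then the
Ornstein odometer `T` is `μ`-nonsingular and there is no σ-finite `T`-invariant measure
equivalent to `μ`; that is, `T` is of type III. -/
theorem stmt_4 (μ : Measure OrnSpace) [IsProbabilityMeasure μ]
    (hμ : ∀ (n : ℕ) (a : ∀ i : ℕ, Fin (i + 2)),
      μ {x : OrnSpace | ∀ i < n, x i = a i} = ∏ i ∈ Finset.range n, ornNu i (a i)) :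
    (∀ N : Set OrnSpace, MeasurableSet N → (μ (ornstein ⁻¹' N) = 0 ↔ μ N = 0)) ∧
    ¬∃ ν : Measure OrnSpace, SigmaFinite ν ∧ ν ≪ μ ∧ μ ≪ ν ∧
        ∀ A : Set OrnSpace, MeasurableSet A → ν (ornstein ⁻¹' A) = ν A := by
  have hμ' : Ornstein.IsOrnsteinProduct μ := hμ
  refine ⟨fun N hN => hμ'.measure_ornstein_preimage_eq_zero_iff hN, ?_⟩
  rintro ⟨ν, hσ, hνμ, hμν, hν⟩
  exact hμ'.not_exists_invariant hνμ hμν hν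
end

section
/- (Hurewicz pointwise ergodic theorem) Let T be a conservative nonsingular transformation of a standard probability space (X, ℬ, μ), let 𝓘 denote the sub-σ-algebra of T-invariant sets, and let f, g ∈ L¹(X, μ) with g > 0. Then (Σ_{i=0}^{n-1} f(Tⁱx) ωᵢ(x)) / (Σ_{i=0}^{n-1} g(Tⁱx) ωᵢ(x)) → 𝔼_μ[f | 𝓘](x) / 𝔼_μ[g | 𝓘](x) as n → ∞, for almost every x ∈ X. -/
open MeasureTheory Set Filter ENNReal

/-- `T` is *conservative* w.r.t. `μ`. -/
def Conservative' {X : Type*} [MeasurableSpace X] (μ : Measure X) (T : X → X) : Prop :=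
  ∀ A : Set X, MeasurableSet A → 0 < μ A → ∃ n : ℕ, 0 < n ∧ 0 < μ (A ∩ T^[n] ⁻¹' A)

/-- The sub-σ-algebra `𝓘` of `T`-invariant measurable sets. -/
def invAlg {X : Type*} [m : MeasurableSpace X] (T : X → X) : MeasurableSpace X where
  MeasurableSet' A := MeasurableSet A ∧ T ⁻¹' A = A
  measurableSet_empty := ⟨.empty, by simp⟩
  measurableSet_compl A hA := ⟨hA.1.compl, by rw [Set.preimage_compl, hA.2]⟩
  measurableSet_iUnion f hf :=
    ⟨.iUnion fun i => (hf i).1, by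
      rw [Set.preimage_iUnion]; exact Set.iUnion_congr fun i => (hf i).2⟩

/-- `ω i = d(μ∘Tⁱ)/dμ`, the Radon–Nikodym derivative of `A ↦ μ(Tⁱ(A))` with respect to `μ`. -/
noncomputable def omega' {X : Type*} [MeasurableSpace X] (μ : Measure X) (T : X ≃ᵐ X)
    (i : ℕ) : X → ℝ≥0∞ :=
  (μ.map ((⇑T.symm)^[i])).rnDeriv μ

namespace Hurewicz

variable {X : Type*} [MeasurableSpace X] {μ : Measure X} {T : X ≃ᵐ X}

/-- `T` and its inverse preserve null sets. -/
def Nonsingular (μ : Measure X) (T : X ≃ᵐ X) : Prop :=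
  ∀ N : Set X, MeasurableSet N → (μ (⇑T ⁻¹' N) = 0 ↔ μ N = 0)

/-- The weighted Birkhoff sum `∑_{i < n} h(Tⁱ x) ωᵢ(x)`. -/
noncomputable def weightedSum (μ : Measure X) (T : X ≃ᵐ X) (h : X → ℝ) (n : ℕ) (x : X) : ℝ :=
  ∑ i ∈ Finset.range n, h ((⇑T)^[i] x) * (omega' μ T i x).toReal

lemma Nonsingular.quasiMeasurePreserving (hns : Nonsingular μ T) :
    Measure.QuasiMeasurePreserving T μ μ :=
  ⟨T.measurable, .mk fun s hs h => by
    rw [Measure.map_apply T.measurable hs]; exact (hns s hs).2 h⟩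

lemma Nonsingular.symm (hns : Nonsingular μ T) : Nonsingular μ T.symm := fun N hN => by
  rw [← hns _ (T.symm.measurable hN), ← preimage_comp]
  simp

lemma Nonsingular.map_symm_ac (hns : Nonsingular μ T) (i : ℕ) :
    μ.map (⇑T.symm)^[i] ≪ μ :=
  (hns.symm.quasiMeasurePreserving.iterate i).absolutelyContinuous

lemma Nonsingular.ac_map_symm (hns : Nonsingular μ T) (i : ℕ) :
    μ ≪ μ.map (⇑T.symm)^[i] := by
  refine .mk fun s hs h => ?_
  rw [Measure.map_apply (T.symm.measurable.iterate i) hs] at h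
  have h' := (hns.quasiMeasurePreserving.iterate i).preimage_null h
  rwa [← preimage_comp, (Function.LeftInverse.iterate T.symm_apply_apply i).comp_eq_id,
    preimage_id] at h'

lemma measurable_omega (i : ℕ) : Measurable (omega' μ T i) := Measure.measurable_rnDeriv _ _

lemma lintegral_omega_mul [IsFiniteMeasure μ] (hns : Nonsingular μ T) (i : ℕ) {u : X → ℝ≥0∞}
    (hu : AEMeasurable u μ) :
    ∫⁻ x, omega' μ T i x * u x ∂μ = ∫⁻ x, u ((⇑T.symm)^[i] x) ∂μ := by
  unfold omega'
  rw [lintegral_rnDeriv_mul (hns.map_symm_ac i) hu, lintegral_map']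
  · exact hu.mono_ac (hns.map_symm_ac i)
  · exact (T.symm.measurable.iterate i).aemeasurable

lemma omega_zero [IsFiniteMeasure μ] : omega' μ T 0 =ᵐ[μ] 1 := by
  simpa [omega'] using! Measure.rnDeriv_self μ

lemma omega_succ [IsFiniteMeasure μ] (hns : Nonsingular μ T) (i : ℕ) :
    ∀ᵐ x ∂μ, omega' μ T (i + 1) x = omega' μ T 1 x * omega' μ T i (T x) := by
  refine ae_eq_of_forall_setLIntegral_eq_of_sigmaFinite (measurable_omega _)
    ((measurable_omega _).mul ((measurable_omega _).comp T.measurable)) fun s hs _ => ?_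
  have h1 : ∫⁻ x in s, omega' μ T (i + 1) x ∂μ
      = ∫⁻ x, omega' μ T (i + 1) x * s.indicator 1 x ∂μ := by
    rw [← lintegral_indicator hs]
    congr 1 with x
    by_cases hx : x ∈ s <;> simp [hx]
  have h2 : ∫⁻ x in s, omega' μ T 1 x * omega' μ T i (T x) ∂μ
      = ∫⁻ x, omega' μ T 1 x * (omega' μ T i (T x) * s.indicator 1 x) ∂μ := by
    rw [← lintegral_indicator hs]
    congr 1 with x
    by_cases hx : x ∈ s <;> simp [hx]
  have hm : Measurable (s.indicator (1 : X → ℝ≥0∞)) := measurable_one.indicator hs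
  rw [h1, h2, lintegral_omega_mul hns _ hm.aemeasurable, lintegral_omega_mul hns 1
    (u := fun x => omega' μ T i (T x) * s.indicator 1 x)
    (((measurable_omega i).comp T.measurable).mul hm).aemeasurable]
  simp only [Function.iterate_one, MeasurableEquiv.apply_symm_apply]
  rw [lintegral_omega_mul hns i (u := fun x => s.indicator 1 (T.symm x))
    (hm.comp T.symm.measurable).aemeasurable]
  simp only [Function.iterate_succ_apply']

lemma omega_lt_top [IsFiniteMeasure μ] : ∀ᵐ x ∂μ, ∀ i, omega' μ T i x < ∞ :=
  ae_all_iff.2 fun i => by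
    have : IsFiniteMeasure (μ.map (⇑T.symm)^[i]) := inferInstance
    exact Measure.rnDeriv_lt_top _ _

lemma omega_pos [IsFiniteMeasure μ] (hns : Nonsingular μ T) :
    ∀ᵐ x ∂μ, 0 < (omega' μ T 1 x).toReal := by
  filter_upwards [Measure.rnDeriv_pos' (hns.ac_map_symm 1), omega_lt_top (μ := μ) (T := T)]
    with x h1 h2
  exact ENNReal.toReal_pos h1.ne' (h2 1).ne

lemma weightedSum_succ [IsFiniteMeasure μ] (hns : Nonsingular μ T) (h : X → ℝ) :
    ∀ᵐ x ∂μ, ∀ n, weightedSum μ T h (n + 1) x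
      = h x + (omega' μ T 1 x).toReal * weightedSum μ T h n (T x) := by
  filter_upwards [omega_zero (μ := μ) (T := T), ae_all_iff.2 (omega_succ hns)] with x h0 hs n
  rw [weightedSum, weightedSum, Finset.sum_range_succ', Finset.mul_sum, add_comm]
  congr 1
  · simp [h0]
  · refine Finset.sum_congr rfl fun i _ => ?_
    rw [hs i, ENNReal.toReal_mul, Function.iterate_succ_apply]
    ring

lemma integrable_omega_mul_comp [IsFiniteMeasure μ] (hns : Nonsingular μ T) (i : ℕ) {u : X → ℝ}
    (hu : Integrable u μ) :
    Integrable (fun x => (omega' μ T i x).toReal * u ((⇑T)^[i] x)) μ := by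
  refine (integrable_rnDeriv_smul_iff (hns.map_symm_ac i)
    (f := fun x => u ((⇑T)^[i] x))).2 ?_
  have hT := T.symm.measurable.iterate i
  have h1 : (fun x => u ((⇑T)^[i] x)) ∘ (⇑T.symm)^[i] = u := by
    ext x; simp [Function.LeftInverse.iterate T.apply_symm_apply i x]
  refine (integrable_map_measure ?_ hT.aemeasurable).2 (by rwa [h1])
  exact (hu.1.comp_quasiMeasurePreserving
    (hns.quasiMeasurePreserving.iterate i)).mono_ac (hns.map_symm_ac i)

lemma integral_omega_mul_comp [IsFiniteMeasure μ] (hns : Nonsingular μ T) {u : X → ℝ}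
    (hu : Integrable u μ) :
    ∫ x, (omega' μ T 1 x).toReal * u (T x) ∂μ = ∫ x, u x ∂μ := by
  refine (integral_rnDeriv_smul (hns.map_symm_ac 1) (f := fun x => u (T x))).trans ?_
  rw [integral_map (T.symm.measurable.iterate 1).aemeasurable]
  · simp
  · exact (hu.1.comp_quasiMeasurePreserving
      hns.quasiMeasurePreserving).mono_ac (hns.map_symm_ac 1)

lemma integrable_weightedSum [IsFiniteMeasure μ] (hns : Nonsingular μ T) {h : X → ℝ}
    (hh : Integrable h μ) (n : ℕ) : Integrable (weightedSum μ T h n) μ := by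
  unfold weightedSum
  refine integrable_finsetSum _ fun i _ => ?_
  simpa only [mul_comm] using integrable_omega_mul_comp hns i hh

/-- Hopf's maximal ergodic inequality. -/
lemma integral_nonneg_of_exists_weightedSum_pos [IsFiniteMeasure μ] (hns : Nonsingular μ T)
    {h : X → ℝ} (hh : Integrable h μ)
    (hpos : ∀ᵐ x ∂μ, h x ≠ 0 → ∃ n, 0 < weightedSum μ T h n x) : 0 ≤ ∫ x, h x ∂μ := by
  set M : ℕ → X → ℝ := fun n x => partialSups (fun k => weightedSum μ T h k x) n with hM
  have hMint : ∀ n, Integrable (M n) μ := by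
    intro n
    induction n with
    | zero => simpa [hM] using! integrable_weightedSum hns hh 0
    | succ n ih =>
      have : M (n + 1) = M n ⊔ weightedSum μ T h (n + 1) := by
        ext x; simp [hM, partialSups_add_one]
      rw [this]
      exact ih.sup (integrable_weightedSum hns hh _)
  have hle : ∀ {k n} x, k ≤ n → weightedSum μ T h k x ≤ M n x := fun x hk =>
    le_partialSups_of_le (fun k => weightedSum μ T h k x) hk
  have hM0 : ∀ n x, 0 ≤ M n x := fun n x => by
    simpa [weightedSum] using hle (k := 0) x (Nat.zero_le n)
  set E : ℕ → Set X := fun n => {x | 0 < M n x} with hE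
  have hEm : ∀ n, NullMeasurableSet (E n) μ := fun n =>
    nullMeasurableSet_lt aemeasurable_const (hMint n).1.aemeasurable
  have key : ∀ n, 0 ≤ ∫ x, (E n).indicator h x ∂μ := by
    intro n
    have hP : Integrable (fun x => (omega' μ T 1 x).toReal * M n (T x)) μ := by
      simpa using integrable_omega_mul_comp hns 1 (hMint n)
    have h0 : ∫ x, (M n x - (omega' μ T 1 x).toReal * M n (T x)) ∂μ = 0 := by
      rw [integral_sub (hMint n) hP, integral_omega_mul_comp hns (hMint n), sub_self]
    rw [← h0]
    refine integral_mono_ae ((hMint n).sub hP) (hh.indicator₀ (hEm n)) ?_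
    filter_upwards [weightedSum_succ hns h] with x hx
    have hPx : 0 ≤ (omega' μ T 1 x).toReal * M n (T x) :=
      mul_nonneg ENNReal.toReal_nonneg (hM0 _ _)
    by_cases hxE : x ∈ E n
    · rw [indicator_of_mem hxE]
      have : M n x ≤ max 0 (h x + (omega' μ T 1 x).toReal * M n (T x)) := by
        refine partialSups_le _ _ _ fun k hk => ?_
        rcases k with _ | k
        · simp [weightedSum]
        · refine le_max_of_le_right ?_
          rw [hx k]
          gcongr
          exact hle _ (by omega)
      have hxE' : 0 < M n x := hxE
      rcases le_max_iff.1 this with h1 | h1 <;> linarith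
    · rw [indicator_of_notMem hxE]
      have : M n x ≤ 0 := not_lt.1 hxE
      linarith
  refine ge_of_tendsto' (tendsto_integral_of_dominated_convergence (fun x => |h x|)
    (fun n => (hh.indicator₀ (hEm n)).1) hh.abs ?_ ?_) key
  · intro n
    filter_upwards with x
    exact norm_indicator_le_norm_self _ _
  · filter_upwards [hpos] with x hx
    by_cases h0 : h x = 0
    · refine tendsto_const_nhds.congr fun n => ?_
      by_cases hxE : x ∈ E n <;> simp [hxE, h0]
    · obtain ⟨N, hN⟩ := hx h0
      refine tendsto_const_nhds.congr' ?_
      filter_upwards [eventually_ge_atTop N] with n hn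
      have : x ∈ E n := hN.trans_le (hle x hn)
      rw [indicator_of_mem this]

lemma conservative_symm (hns : Nonsingular μ T) (hc : Conservative' μ ⇑T) :
    Conservative T.symm μ := by
  refine ⟨hns.symm.quasiMeasurePreserving, fun s hs h0 => ?_⟩
  obtain ⟨n, hn, hpos⟩ := hc s hs (pos_iff_ne_zero.2 h0)
  obtain ⟨x, hx, hx'⟩ := nonempty_of_measure_ne_zero hpos.ne'
  refine ⟨_, hx', n, hn.ne', ?_⟩
  rwa [Function.LeftInverse.iterate T.symm_apply_apply n x]

/-- For a conservative transformation, the weighted sums of a positive function diverge. -/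
lemma tsum_weighted_eq_top [IsFiniteMeasure μ] (hns : Nonsingular μ T) (hc : Conservative' μ ⇑T)
    {g : X → ℝ≥0∞} (hg : AEMeasurable g μ) (hgpos : ∀ x, 0 < g x) :
    ∀ᵐ x ∂μ, ∑' i, omega' μ T i x * g ((⇑T)^[i] x) = ∞ := by
  have hgT : ∀ i, AEMeasurable (fun x => g ((⇑T)^[i] x)) μ := fun i =>
    hg.comp_quasiMeasurePreserving (hns.quasiMeasurePreserving.iterate i)
  have hG : AEMeasurable (fun x => ∑' i, omega' μ T i x * g ((⇑T)^[i] x)) μ :=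
    AEMeasurable.tsum fun i => (measurable_omega i).aemeasurable.mul (hgT i)
  suffices H : ∀ c : ℕ, μ {x | hG.mk _ x ≤ c} = 0 by
    have H' : ∀ᵐ x ∂μ, ∀ c : ℕ, ¬ hG.mk _ x ≤ c := ae_all_iff.2 fun c =>
      measure_eq_zero_iff_ae_notMem.1 (H c)
    filter_upwards [H', hG.ae_eq_mk] with x hx hx'
    rw [hx']
    by_contra hne
    obtain ⟨c, hc⟩ := ENNReal.exists_nat_gt hne
    exact hx c hc.le
  intro c
  set A := {x | hG.mk _ x ≤ c} with hA
  have hAm : MeasurableSet A := measurableSet_le hG.measurable_mk measurable_const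
  have hfin : ∫⁻ x, (∑' i, A.indicator 1 ((⇑T.symm)^[i] x)) * g x ∂μ ≠ ∞ := by
    have h1 : ∀ i, ∫⁻ x, A.indicator 1 ((⇑T.symm)^[i] x) * g x ∂μ
        = ∫⁻ x in A, omega' μ T i x * g ((⇑T)^[i] x) ∂μ := by
      intro i
      have := lintegral_omega_mul hns i (u := fun x => A.indicator 1 x * g ((⇑T)^[i] x))
        ((measurable_one.indicator hAm).aemeasurable.mul (hgT i))
      simp only [Function.LeftInverse.iterate T.apply_symm_apply i _] at this
      rw [← this, ← lintegral_indicator hAm]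
      congr 1 with x
      by_cases hx : x ∈ A <;> simp [hx]
    simp_rw [← ENNReal.tsum_mul_right]
    rw [lintegral_tsum]
    · simp_rw [h1]
      rw [← lintegral_tsum (f := fun i x => omega' μ T i x * g ((⇑T)^[i] x)) fun i =>
        ((measurable_omega i).aemeasurable.mul (hgT i)).restrict]
      refine ne_top_of_le_ne_top (b := ∫⁻ x in A, c ∂μ) ?_ ?_
      · simp [ENNReal.mul_eq_top]
      · refine lintegral_mono_ae ?_
        rw [ae_restrict_iff' hAm]
        filter_upwards [hG.ae_eq_mk] with x hx hxA
        rw [hx]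
        exact hxA
    · exact fun i => (((measurable_one.indicator hAm).comp
        (T.symm.measurable.iterate i)).aemeasurable).mul hg
  have hmeas : AEMeasurable (fun x => (∑' i, A.indicator 1 ((⇑T.symm)^[i] x)) * g x) μ :=
    (AEMeasurable.tsum fun i => ((measurable_one.indicator hAm).comp
        (T.symm.measurable.iterate i)).aemeasurable).mul hg
  rw [measure_eq_zero_iff_ae_notMem]
  filter_upwards [ae_lt_top' hmeas hfin,
    (conservative_symm hns hc).ae_mem_imp_frequently_image_mem hAm.nullMeasurableSet]
    with x hx hrec hxA
  have hne : ∑' i, A.indicator (1 : X → ℝ≥0∞) ((⇑T.symm)^[i] x) ≠ ∞ := by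
    intro htop
    rw [htop, ENNReal.top_mul (hgpos x).ne'] at hx
    exact lt_irrefl _ hx
  have hlim := ENNReal.tendsto_atTop_zero_of_tsum_ne_top hne
  have hev := hlim.eventually (gt_mem_nhds zero_lt_one)
  obtain ⟨n, hn, hn'⟩ := ((hrec hxA).and_eventually hev).exists
  simp [hn] at hn'

lemma tendsto_weightedSum_atTop [IsFiniteMeasure μ] (hns : Nonsingular μ T)
    (hc : Conservative' μ ⇑T) {g : X → ℝ} (hg : Integrable g μ) (hgpos : ∀ x, 0 < g x) :
    ∀ᵐ x ∂μ, Tendsto (fun n => weightedSum μ T g n x) atTop atTop := by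
  filter_upwards [tsum_weighted_eq_top hns hc (g := fun x => ENNReal.ofReal (g x))
    hg.1.aemeasurable.ennreal_ofReal (fun x => ENNReal.ofReal_pos.2 (hgpos x)),
    omega_lt_top (μ := μ) (T := T)] with x hx hlt
  rw [← ENNReal.tendsto_ofReal_nhds_top, ← hx]
  refine (ENNReal.tendsto_nat_tsum _).congr fun n => ?_
  rw [weightedSum, ENNReal.ofReal_sum_of_nonneg fun i _ =>
    mul_nonneg (hgpos _).le ENNReal.toReal_nonneg]
  refine Finset.sum_congr rfl fun i _ => ?_
  rw [ENNReal.ofReal_mul (hgpos _).le, ENNReal.ofReal_toReal (hlt i).ne, mul_comm]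

lemma weightedSum_mul_of_invariant {c : X → ℝ} (hcT : ∀ x, c (T x) = c x) (h : X → ℝ) (n : ℕ)
    (x : X) : weightedSum μ T (fun y => c y * h y) n x = c x * weightedSum μ T h n x := by
  have : ∀ i, c ((⇑T)^[i] x) = c x := fun i => by
    induction i with
    | zero => rfl
    | succ i ih => rw [Function.iterate_succ_apply', hcT, ih]
  simp only [weightedSum, Finset.mul_sum, this, mul_assoc]

lemma weightedSum_sub (h k : X → ℝ) (n : ℕ) (x : X) :
    weightedSum μ T (fun y => h y - k y) n x = weightedSum μ T h n x - weightedSum μ T k n x := by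
  simp only [weightedSum, sub_mul, Finset.sum_sub_distrib]

lemma eventually_weightedSum_le [IsFiniteMeasure μ] (hns : Nonsingular μ T)
    (hc : Conservative' μ ⇑T) {F g : X → ℝ} (hF : Integrable F μ) (hg : Integrable g μ)
    (hgpos : ∀ x, 0 < g x)
    (hF0 : ∀ A, MeasurableSet A → ⇑T ⁻¹' A = A → ∫ x in A, F x ∂μ = 0) {ε : ℝ} (hε : 0 < ε) :
    ∀ᵐ x ∂μ, ∀ᶠ n in atTop, weightedSum μ T F n x ≤ ε * weightedSum μ T g n x := by
  set S := weightedSum μ T F with hS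
  set G := weightedSum μ T g with hG
  have hGnn : ∀ n x, 0 ≤ G n x := fun n x => Finset.sum_nonneg fun i _ =>
    mul_nonneg (hgpos _).le ENNReal.toReal_nonneg
  set D : Set X := {x | ∃ δ : ℚ, ε / 2 < δ ∧ ∃ᶠ n in atTop, δ * G n x < S n x} with hD
  have hDm : NullMeasurableSet D μ := by
    have : D = ⋃ δ : ℚ, ⋃ (_ : ε / 2 < δ), ⋂ N : ℕ, ⋃ n : ℕ, ⋃ (_ : n ≥ N),
        {x | δ * G n x < S n x} := by
      ext x; simp [hD, frequently_atTop]
    rw [this]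
    exact .iUnion fun δ => .iUnion fun _ => .iInter fun N => .iUnion fun n => .iUnion fun _ =>
      nullMeasurableSet_lt
        ((integrable_weightedSum hns hg n).1.aemeasurable.const_mul _)
        (integrable_weightedSum hns hF n).1.aemeasurable
  have hqmp := hns.quasiMeasurePreserving
  have hdiv := tendsto_weightedSum_atTop hns hc hg hgpos
  have hDinv : ⇑T ⁻¹' D =ᵐ[μ] D := by
    rw [eventuallyEq_set]
    filter_upwards [weightedSum_succ hns F, weightedSum_succ hns g, omega_pos hns, hdiv,
      hqmp.ae hdiv] with x hxF hxg hw hd hdT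
    set w := (omega' μ T 1 x).toReal with hw_def
    constructor
    · rintro ⟨δ, hδ, hfr⟩
      obtain ⟨δ', h1, h2⟩ := exists_rat_btwn hδ
      refine ⟨δ', h1, ?_⟩
      have hlarge : ∀ᶠ n in atTop, (δ' * g x - F x) / (w * (δ - δ')) ≤ G n (T x) :=
        hdT.eventually_ge_atTop _
      have : ∃ᶠ n in atTop, δ' * G (n + 1) x < S (n + 1) x := by
        refine (hfr.and_eventually hlarge).mono fun n hn => ?_
        obtain ⟨hn1, hn2⟩ := hn
        rw [div_le_iff₀ (mul_pos hw (sub_pos.2 h2))] at hn2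
        have := mul_lt_mul_of_pos_left hn1 hw
        simp only [hS, hG, hxF, hxg] at *
        linarith
      exact (tendsto_add_atTop_nat 1).frequently this
    · rintro ⟨δ, hδ, hfr⟩
      obtain ⟨δ', h1, h2⟩ := exists_rat_btwn hδ
      refine ⟨δ', h1, ?_⟩
      have hfr' : ∃ᶠ n in atTop, δ * G (n + 1) x < S (n + 1) x := by
        rw [← map_add_atTop_eq_nat 1, frequently_map] at hfr
        exact hfr
      have hlarge : ∀ᶠ n in atTop, (F x - δ * g x) / (w * (δ - δ')) ≤ G n (T x) :=
        hdT.eventually_ge_atTop _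
      refine (hfr'.and_eventually hlarge).mono fun n hn => ?_
      obtain ⟨hn1, hn2⟩ := hn
      rw [div_le_iff₀ (mul_pos hw (sub_pos.2 h2))] at hn2
      refine lt_of_mul_lt_mul_left ?_ hw.le
      simp only [hS, hG, hxF, hxg] at *
      linarith
  obtain ⟨t, htm, htD, htT⟩ := hqmp.exists_preimage_eq_of_preimage_ae hDm hDinv
  have htnull : μ t = 0 := by
    set c : X → ℝ := t.indicator 1 with hc_def
    have hcT : ∀ x, c (T x) = c x := fun x => by
      have : T x ∈ t ↔ x ∈ t := by rw [← mem_preimage, htT]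
      by_cases hx : x ∈ t <;> simp [hc_def, hx, this]
    have hind : (fun y => c y * (F y - ε / 2 * g y))
        = t.indicator (fun y => F y - ε / 2 * g y) := by
      ext y
      by_cases hy : y ∈ t <;> simp [hc_def, hy]
    have hint : Integrable (fun y => F y - ε / 2 * g y) μ := hF.sub (hg.const_mul _)
    have hmax : 0 ≤ ∫ y, c y * (F y - ε / 2 * g y) ∂μ := by
      refine integral_nonneg_of_exists_weightedSum_pos hns ?_ ?_
      · rw [hind]; exact hint.indicator htm
      · filter_upwards [htD.mem_iff] with x hx hne
        have hxt : x ∈ t := by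
          by_contra hxt
          simp [hc_def, hxt] at hne
        obtain ⟨δ, hδ, hfr⟩ := hx.1 hxt
        obtain ⟨n, hn⟩ := hfr.exists
        refine ⟨n, ?_⟩
        rw [weightedSum_mul_of_invariant hcT, weightedSum_sub,
          weightedSum_mul_of_invariant (c := fun _ => ε / 2) (fun _ => rfl)]
        have := mul_le_mul_of_nonneg_right hδ.le (hGnn n x)
        simp only [hc_def, indicator_of_mem hxt, Pi.one_apply, one_mul]
        linarith
    rw [hind, integral_indicator htm, integral_sub hF.integrableOn (hg.const_mul _).integrableOn,
      hF0 t htm htT, integral_const_mul] at hmax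
    by_contra hne
    have : 0 < ∫ x in t, g x ∂μ := by
      rw [setIntegral_pos_iff_support_of_nonneg_ae (ae_of_all _ fun x => (hgpos x).le)
        hg.integrableOn]
      have : Function.support g = univ := by
        ext x; simp [(hgpos x).ne']
      rw [this, univ_inter]
      exact pos_iff_ne_zero.2 hne
    nlinarith
  filter_upwards [measure_eq_zero_iff_ae_notMem.1 htnull, htD.mem_iff] with x hx hx'
  have hxD : ¬ ∃ δ : ℚ, ε / 2 < δ ∧ ∃ᶠ n in atTop, δ * G n x < S n x := fun h => hx (hx'.2 h)
  obtain ⟨δ, h1, h2⟩ := exists_rat_btwn (half_lt_self hε)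
  have : ¬ ∃ᶠ n in atTop, δ * G n x < S n x := fun h => hxD ⟨δ, h1, h⟩
  rw [not_frequently] at this
  filter_upwards [this] with n hn
  exact (not_lt.1 hn).trans (mul_le_mul_of_nonneg_right h2.le (hGnn n x))

lemma tendsto_weightedSum_div_zero [IsFiniteMeasure μ] (hns : Nonsingular μ T)
    (hc : Conservative' μ ⇑T) {F g : X → ℝ} (hF : Integrable F μ) (hg : Integrable g μ)
    (hgpos : ∀ x, 0 < g x)
    (hF0 : ∀ A, MeasurableSet A → ⇑T ⁻¹' A = A → ∫ x in A, F x ∂μ = 0) :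
    ∀ᵐ x ∂μ, Tendsto (fun n => weightedSum μ T F n x / weightedSum μ T g n x) atTop (nhds 0) := by
  have h1 : ∀ᵐ x ∂μ, ∀ k : ℕ, ∀ᶠ n in atTop,
      weightedSum μ T F n x ≤ 1 / ((k : ℝ) + 1) * weightedSum μ T g n x :=
    ae_all_iff.2 fun k => eventually_weightedSum_le hns hc hF hg hgpos hF0 (by positivity)
  have h2 : ∀ᵐ x ∂μ, ∀ k : ℕ, ∀ᶠ n in atTop,
      weightedSum μ T (fun y => (-1) * F y) n x ≤ 1 / ((k : ℝ) + 1) * weightedSum μ T g n x :=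
    ae_all_iff.2 fun k => eventually_weightedSum_le hns hc (hF.const_mul _) hg hgpos
      (fun A hA hAT => by rw [integral_const_mul, hF0 A hA hAT, mul_zero]) (by positivity)
  filter_upwards [h1, h2, tendsto_weightedSum_atTop hns hc hg hgpos] with x h1 h2 hd
  rw [Metric.tendsto_nhds]
  intro ε hε
  obtain ⟨k, hk⟩ := exists_nat_one_div_lt hε
  filter_upwards [h1 k, h2 k, hd.eventually_gt_atTop 0] with n hn1 hn2 hn3
  rw [weightedSum_mul_of_invariant (c := fun _ => (-1 : ℝ)) (fun _ => rfl)] at hn2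
  rw [Real.dist_eq, sub_zero, abs_div, abs_of_pos hn3, div_lt_iff₀ hn3]
  refine (abs_le.2 ⟨?_, hn1⟩).trans_lt (mul_lt_mul_of_pos_right hk hn3)
  linarith

lemma condExp_pos {Y : Type*} {m m0 : MeasurableSpace Y} (hm : m ≤ m0) {μ : Measure Y}
    [IsFiniteMeasure μ] {g : Y → ℝ} (hg : Integrable g μ) (hgpos : ∀ x, 0 < g x) :
    ∀ᵐ x ∂μ, 0 < (μ[g|m]) x := by
  have hA : MeasurableSet[m] {x | (μ[g|m]) x ≤ 0} :=
    (stronglyMeasurable_condExp.measurable : Measurable[m] (μ[g|m])) measurableSet_Iic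
  have hle : ∫ x in {x | (μ[g|m]) x ≤ 0}, g x ∂μ ≤ 0 := by
    rw [← setIntegral_condExp hm hg hA]
    exact setIntegral_nonpos (hm _ hA) fun x hx => hx
  have hnull : μ {x | (μ[g|m]) x ≤ 0} = 0 := by
    by_contra hne
    refine hle.not_gt ?_
    rw [setIntegral_pos_iff_support_of_nonneg_ae (ae_of_all _ fun x => (hgpos x).le)
      hg.integrableOn]
    have : Function.support g = univ := by
      ext x; simp [(hgpos x).ne']
    rw [this, univ_inter]
    exact pos_iff_ne_zero.2 hne
  filter_upwards [measure_eq_zero_iff_ae_notMem.1 hnull] with x hx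
  exact not_le.1 hx

lemma invAlg_le (T : X → X) : invAlg T ≤ ‹MeasurableSpace X› := fun _ h => h.1

lemma apply_eq_of_measurable_invAlg {T : X → X} {c : X → ℝ} (hc : Measurable[invAlg T] c) (x : X) :
    c (T x) = c x := by
  have h := (hc (measurableSet_singleton (c x))).2
  have : x ∈ T ⁻¹' (c ⁻¹' {c x}) := by rw [h]; rfl
  exact this

theorem tendsto_ratio [IsFiniteMeasure μ] (hns : Nonsingular μ T)
    (hc : Conservative' μ ⇑T) {f g : X → ℝ} (hf : Integrable f μ) (hg : Integrable g μ)
    (hgpos : ∀ x, 0 < g x) :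
    ∀ᵐ x ∂μ, Tendsto (fun n => weightedSum μ T f n x / weightedSum μ T g n x) atTop
      (nhds ((μ[f|invAlg ⇑T]) x / (μ[g|invAlg ⇑T]) x)) := by
  have hm := invAlg_le (⇑T)
  set r : X → ℝ := fun x => (μ[f|invAlg ⇑T]) x / (μ[g|invAlg ⇑T]) x with hr
  have hrm : Measurable[invAlg ⇑T] r :=
    Measurable.div (m := invAlg ⇑T) stronglyMeasurable_condExp.measurable
      stronglyMeasurable_condExp.measurable
  have hEg := condExp_pos hm hg hgpos
  have key : ∀ N : ℕ, ∀ᵐ x ∂μ, |r x| ≤ N →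
      Tendsto (fun n => weightedSum μ T f n x / weightedSum μ T g n x) atTop (nhds (r x)) := by
    intro N
    set A : Set X := {x | |r x| ≤ N} with hA
    have hAm : MeasurableSet[invAlg ⇑T] A :=
      hrm (measurableSet_le (f := fun y : ℝ => |y|) (by fun_prop) measurable_const)
    set c : X → ℝ := A.indicator 1 with hc_def
    set rN : X → ℝ := A.indicator r with hrN
    have hcm : Measurable[invAlg ⇑T] c :=
      (measurable_const : Measurable[invAlg ⇑T] fun _ : X => (1 : ℝ)).indicator hAm
    have hrNm : Measurable[invAlg ⇑T] rN := hrm.indicator hAm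
    have hcb : ∀ x, ‖c x‖ ≤ 1 := fun x => by
      by_cases hx : x ∈ A <;> simp [hc_def, hx]
    have hrNb : ∀ x, ‖rN x‖ ≤ N := fun x => by
      by_cases hx : x ∈ A
      · rw [hrN, indicator_of_mem hx]
        exact hx
      · simp [hrN, hx]
    have hcf : Integrable (fun x => c x * f x) μ :=
      hf.bdd_mul (hcm.mono hm le_rfl).aestronglyMeasurable (ae_of_all _ hcb)
    have hrg : Integrable (fun x => rN x * g x) μ :=
      hg.bdd_mul (hrNm.mono hm le_rfl).aestronglyMeasurable (ae_of_all _ hrNb)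
    have hzero : μ[fun x => c x * f x - rN x * g x|invAlg ⇑T] =ᵐ[μ] 0 := by
      have e1 := condExp_stronglyMeasurable_mul_of_bound hm hcm.stronglyMeasurable hf 1
        (ae_of_all _ hcb)
      have e2 := condExp_stronglyMeasurable_mul_of_bound hm hrNm.stronglyMeasurable hg N
        (ae_of_all _ hrNb)
      filter_upwards [condExp_sub hcf hrg (invAlg ⇑T), e1, e2, hEg] with x h1 h2 h3 h4
      refine h1.trans ?_
      simp only [Pi.sub_apply]
      refine (congrArg₂ (· - ·) h2 h3).trans ?_
      by_cases hx : x ∈ A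
      · simp [hc_def, hrN, hx, hr, div_mul_cancel₀ _ h4.ne']
      · simp [hc_def, hrN, hx]
    have hF0 : ∀ B, MeasurableSet B → ⇑T ⁻¹' B = B →
        ∫ x in B, (c x * f x - rN x * g x) ∂μ = 0 := by
      intro B hB hBT
      rw [← setIntegral_condExp hm (f := fun x => c x * f x - rN x * g x) (hcf.sub hrg)
        (s := B) ⟨hB, hBT⟩]
      exact integral_eq_zero_of_ae (ae_restrict_of_ae hzero)
    filter_upwards [tendsto_weightedSum_div_zero hns hc (hcf.sub hrg) hg hgpos hF0,
      tendsto_weightedSum_atTop hns hc hg hgpos] with x hx hd hxA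
    have hxA' : x ∈ A := hxA
    have hlim := hx.add_const (r x)
    rw [zero_add] at hlim
    refine hlim.congr' ?_
    filter_upwards [hd.eventually_gt_atTop 0] with n hn
    have : weightedSum μ T (fun x => c x * f x - rN x * g x) n x
        = weightedSum μ T f n x - r x * weightedSum μ T g n x := by
      rw [weightedSum_sub, weightedSum_mul_of_invariant (apply_eq_of_measurable_invAlg hcm),
        weightedSum_mul_of_invariant (apply_eq_of_measurable_invAlg hrNm)]
      simp [hc_def, hrN, hxA']
    refine (congrArg (fun s => s / weightedSum μ T g n x + r x) this).trans ?_
    field_simp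
    ring
  filter_upwards [ae_all_iff.2 key] with x hx
  obtain ⟨N, hN⟩ := exists_nat_ge |r x|
  exact hx N hN

end Hurewicz

/-- **Hurewicz pointwise ergodic theorem.** If `T` is a conservative nonsingular
transformation of a standard probability space `(X, ℬ, μ)`, `f, g ∈ L¹(μ)` and `g > 0`,
then the Hurewicz ratios converge a.e. to `𝔼[f|𝓘]/𝔼[g|𝓘]`, where `𝓘` is the invariant
sub-σ-algebra. -/
theorem stmt_5 {X : Type*} [MeasurableSpace X] [StandardBorelSpace X]
    (μ : Measure X) [IsProbabilityMeasure μ] (T : X ≃ᵐ X)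
    (hns : ∀ N : Set X, MeasurableSet N → (μ (⇑T ⁻¹' N) = 0 ↔ μ N = 0))
    (hc : Conservative' μ ⇑T)
    (f g : X → ℝ) (hf : Integrable f μ) (hg : Integrable g μ) (hgpos : ∀ x, 0 < g x) :
    ∀ᵐ x ∂μ, Tendsto
      (fun n : ℕ =>
        (∑ i ∈ Finset.range n, f ((⇑T)^[i] x) * (omega' μ T i x).toReal) /
        (∑ i ∈ Finset.range n, g ((⇑T)^[i] x) * (omega' μ T i x).toReal))
      atTop (nhds ((μ[f|invAlg ⇑T]) x / (μ[g|invAlg ⇑T]) x)) := by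
  exact Hurewicz.tendsto_ratio hns hc hf hg hgpos
end

section
/- (Rokhlin's lemma) Let T be an aperiodic nonsingular transformation of a standard probability space (X, ℬ, μ). For each ε > 0 and each integer N > 1 there exists a measurable set A such that the sets A, TA, …, T^{N-1}A are pairwise disjoint and μ(A ∪ TA ∪ ⋯ ∪ T^{N-1}A) > 1 − ε. -/
open MeasureTheory Set Filter ENNReal

/-- A set that sweeps out almost all of `X` under forward iteration, and whose first preimages
have small total measure. -/
theorem exists_small_sweeping_set {X : Type*} [MeasurableSpace X] [StandardBorelSpace X]
    (μ : Measure X) [IsFiniteMeasure μ] (T : X ≃ᵐ X)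
    (hap : ∀ᵐ x ∂μ, ∀ n : ℕ, 0 < n → (⇑T)^[n] x ≠ x)
    (δ : ℝ≥0∞) (hδ : 0 < δ) (N : ℕ) :
    ∃ B : Set X, MeasurableSet B ∧ (∀ᵐ x ∂μ, ∃ n : ℕ, (⇑T.symm)^[n] x ∈ B) ∧
      ∑ j ∈ Finset.range N, μ ((⇑T)^[j] ⁻¹' B) < δ := by
  obtain ⟨g, hg⟩ := exists_measurableEmbedding_real X
  set f : X → ℝ := fun x => Real.arctan (g x) with hf
  have hfm : Measurable f := Real.measurable_arctan.comp hg.measurable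
  have hfi : Function.Injective f := Real.arctan_injective.comp hg.injective
  set s : X → ℝ := fun x => limsup (fun n : ℕ => f ((⇑T.symm)^[n] x)) atTop with hs
  have hsm : Measurable s :=
    Measurable.limsup fun n => hfm.comp (T.symm.measurable.iterate n)
  have hbdd (x : X) : IsBoundedUnder (· ≤ ·) atTop (fun n : ℕ => f ((⇑T.symm)^[n] x)) :=
    isBoundedUnder_of ⟨Real.pi / 2, fun n => (Real.arctan_lt_pi_div_two _).le⟩
  have hbdd' (x : X) : IsBoundedUnder (· ≥ ·) atTop (fun n : ℕ => f ((⇑T.symm)^[n] x)) :=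
    isBoundedUnder_of ⟨-(Real.pi / 2), fun n => (Real.neg_pi_div_two_lt_arctan _).le⟩
  have hinv (x : X) (m : ℕ) : s ((⇑T.symm)^[m] x) = s x := by
    have h := Filter.limsup_nat_add (fun n : ℕ => f ((⇑T.symm)^[n] x)) m
    simpa only [hs, Function.iterate_add_apply] using h
  set C : ℕ → Set X := fun k => {x | f x ≠ s x ∧ |f x - s x| < 1 / ((k : ℝ) + 1)} with hC
  have hCm (k : ℕ) : MeasurableSet (C k) :=
    (measurableSet_eq_fun hfm hsm).compl.inter
      (measurableSet_lt (hfm.sub hsm).abs measurable_const)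
  have hCanti : Antitone C := by
    intro k l hkl x hx
    exact ⟨hx.1, hx.2.trans_le (one_div_le_one_div_of_le (by positivity) (by gcongr))⟩
  have hCempty : ⋂ k, C k = ∅ := by
    refine eq_empty_of_forall_notMem fun x hx => ?_
    have hx := mem_iInter.1 hx
    obtain ⟨k, hk⟩ := exists_nat_one_div_lt (abs_pos.2 (sub_ne_zero.2 (hx 0).1))
    exact lt_asymm hk (hx k).2
  have htend : Tendsto (fun k => ∑ j ∈ Finset.range N, μ ((⇑T)^[j] ⁻¹' C k)) atTop
      (nhds 0) := by
    have hj : ∀ j ∈ Finset.range N, Tendsto (fun k => μ ((⇑T)^[j] ⁻¹' C k)) atTop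
        (nhds 0) := by
      intro j _
      have h := tendsto_measure_iInter_atTop (μ := μ) (s := fun k => (⇑T)^[j] ⁻¹' C k)
        (fun k => ((T.measurable.iterate j) (hCm k)).nullMeasurableSet)
        (fun k l hkl => preimage_mono (hCanti hkl)) ⟨0, measure_ne_top _ _⟩
      rwa [← preimage_iInter, hCempty, preimage_empty, measure_empty] at h
    simpa using tendsto_finsetSum (Finset.range N) hj
  obtain ⟨k, hk⟩ := (htend.eventually_lt_const hδ).exists
  refine ⟨C k, hCm k, ?_, hk⟩
  filter_upwards [hap] with x hx
  have hpos : (0 : ℝ) < 1 / ((k : ℝ) + 1) := by positivity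
  have hlo : ∃ᶠ n in atTop, s x - 1 / ((k : ℝ) + 1) < f ((⇑T.symm)^[n] x) :=
    frequently_lt_of_lt_limsup (hbdd' x).isCoboundedUnder_le (by simp only [hs]; linarith)
  have hhi : ∀ᶠ n in atTop, f ((⇑T.symm)^[n] x) < s x + 1 / ((k : ℝ) + 1) :=
    eventually_lt_of_limsup_lt (by simp only [hs]; linarith) (hbdd x)
  have huniq : ∀ m l : ℕ, m < l → f ((⇑T.symm)^[m] x) = s x → f ((⇑T.symm)^[l] x) ≠ s x := by
    intro m l hml hm hl
    have h := hfi (hm.trans hl.symm)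
    apply hx (l - m) (by omega)
    have hT := congrArg (⇑T)^[l] h
    rw [Function.LeftInverse.iterate T.apply_symm_apply l x] at hT
    rw [show l = (l - m) + m by omega, Function.iterate_add_apply,
      Function.LeftInverse.iterate T.apply_symm_apply m x] at hT
    exact hT
  have hne : ∀ᶠ n in atTop, f ((⇑T.symm)^[n] x) ≠ s x := by
    by_cases h : ∃ m, f ((⇑T.symm)^[m] x) = s x
    · obtain ⟨m, hm⟩ := h
      filter_upwards [eventually_gt_atTop m] with l hl using huniq m l hl hm
    · push Not at h
      exact Eventually.of_forall h
  obtain ⟨n, hn, hn', hn''⟩ := (hlo.and_eventually (hhi.and hne)).exists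
  refine ⟨n, ?_, ?_⟩
  · rwa [hinv]
  · rw [hinv, abs_lt]
    constructor <;> linarith

/-- The points whose backward orbit first meets `B` at a time divisible by `N`, and whose next
`N - 1` forward iterates avoid `B`. -/
def towerBase {X : Type*} [MeasurableSpace X] (T : X ≃ᵐ X) (B : Set X) (N : ℕ) : Set X :=
  {x | (∃ m : ℕ, (⇑T.symm)^[m * N] x ∈ B ∧ ∀ i < m * N, (⇑T.symm)^[i] x ∉ B) ∧
    ∀ i < N, 0 < i → (⇑T)^[i] x ∉ B}

theorem measurableSet_towerBase {X : Type*} [MeasurableSpace X] (T : X ≃ᵐ X) {B : Set X}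
    (hB : MeasurableSet B) (N : ℕ) : MeasurableSet (towerBase T B N) := by
  have hS (n : ℕ) : MeasurableSet {x | (⇑T.symm)^[n] x ∈ B} := (T.symm.measurable.iterate n) hB
  have hT (n : ℕ) : MeasurableSet {x | (⇑T)^[n] x ∈ B} := (T.measurable.iterate n) hB
  refine MeasurableSet.inter ?_ ?_
  · refine measurableSet_setOfPred.2 (Measurable.exists fun m => ?_)
    refine Measurable.and (measurableSet_setOfPred.1 (hS _)) ?_
    exact Measurable.forall fun i => Measurable.imp measurable_const
      (measurableSet_setOfPred.1 (hS i)).not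
  · exact measurableSet_setOfPred.2 (Measurable.forall fun i => Measurable.imp measurable_const
      (Measurable.imp measurable_const (measurableSet_setOfPred.1 (hT i)).not))

theorem iterate_symm_iterate_of_le {X : Type*} [MeasurableSpace X] (T : X ≃ᵐ X) {k i : ℕ}
    (h : k ≤ i) (x : X) : (⇑T.symm)^[k] ((⇑T)^[i] x) = (⇑T)^[i - k] x := by
  obtain ⟨d, rfl⟩ := Nat.exists_eq_add_of_le h
  rw [Function.iterate_add_apply, Function.LeftInverse.iterate T.symm_apply_apply k]
  simp

theorem iterate_symm_iterate_of_ge {X : Type*} [MeasurableSpace X] (T : X ≃ᵐ X) {k i : ℕ}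
    (h : i ≤ k) (x : X) : (⇑T.symm)^[k] ((⇑T)^[i] x) = (⇑T.symm)^[k - i] x := by
  obtain ⟨d, rfl⟩ := Nat.exists_eq_add_of_le h
  rw [add_comm i d, Function.iterate_add_apply,
    Function.LeftInverse.iterate T.symm_apply_apply i]
  simp

theorem exists_first_hit_of_mem_towerBase {X : Type*} [MeasurableSpace X] (T : X ≃ᵐ X)
    {B : Set X} {N i : ℕ} (hi : i < N) {x : X} (hx : x ∈ towerBase T B N) :
    ∃ m : ℕ, (⇑T.symm)^[m * N + i] ((⇑T)^[i] x) ∈ B ∧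
      ∀ k < m * N + i, (⇑T.symm)^[k] ((⇑T)^[i] x) ∉ B := by
  obtain ⟨⟨m, hm, hlt⟩, hfwd⟩ := hx
  refine ⟨m, ?_, fun k hk => ?_⟩
  · rwa [iterate_symm_iterate_of_ge T (by omega), Nat.add_sub_cancel]
  · rcases lt_or_ge k i with h | h
    · rw [iterate_symm_iterate_of_le T h.le]
      exact hfwd _ (by omega) (by omega)
    · rw [iterate_symm_iterate_of_ge T h]
      exact hlt _ (by omega)

theorem disjoint_iterate_image_towerBase {X : Type*} [MeasurableSpace X] (T : X ≃ᵐ X)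
    (B : Set X) {N i j : ℕ} (hi : i < N) (hj : j < N) (hij : i ≠ j) :
    Disjoint ((⇑T)^[i] '' towerBase T B N) ((⇑T)^[j] '' towerBase T B N) := by
  rw [Set.disjoint_left]
  rintro _ ⟨x, hx, rfl⟩ ⟨y, hy, hxy⟩
  obtain ⟨m, hm, hm'⟩ := exists_first_hit_of_mem_towerBase T hi hx
  obtain ⟨l, hl, hl'⟩ := exists_first_hit_of_mem_towerBase T hj hy
  rw [hxy] at hl hl'
  have h : m * N + i = l * N + j := by
    rcases lt_trichotomy (m * N + i) (l * N + j) with h | h | h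
    · exact absurd hm (hl' _ h)
    · exact h
    · exact absurd hl (hm' _ h)
  have h := congrArg (· % N) h
  simp only [Nat.mul_add_mod_self_right, Nat.mod_eq_of_lt hi, Nat.mod_eq_of_lt hj] at h
  exact hij h

theorem mem_iUnion_iterate_image_towerBase {X : Type*} [MeasurableSpace X] (T : X ≃ᵐ X)
    {B : Set X} {N : ℕ} (hN : 0 < N) {y : X} (hy : ∃ n : ℕ, (⇑T.symm)^[n] y ∈ B)
    (hfwd : ∀ j < N, (⇑T)^[j] y ∉ B) :
    y ∈ ⋃ i ∈ Finset.range N, (⇑T)^[i] '' towerBase T B N := by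
  classical
  obtain ⟨n, hn, hmin⟩ : ∃ n : ℕ, (⇑T.symm)^[n] y ∈ B ∧ ∀ i < n, (⇑T.symm)^[i] y ∉ B :=
    ⟨Nat.find hy, Nat.find_spec hy, fun i hi => Nat.find_min hy hi⟩
  have hdiv : n / N * N + n % N = n := Nat.div_add_mod' n N
  simp only [mem_iUnion, Finset.mem_range]
  refine ⟨n % N, Nat.mod_lt _ hN, (⇑T.symm)^[n % N] y, ⟨⟨n / N, ?_, fun i hi => ?_⟩, ?_⟩,
    Function.LeftInverse.iterate T.apply_symm_apply _ y⟩
  · rwa [← Function.iterate_add_apply, hdiv]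
  · rw [← Function.iterate_add_apply]
    exact hmin _ (by omega)
  · intro i hi hi0
    rcases le_or_gt i (n % N) with h | h
    · have hc : (⇑T)^[i] ((⇑T.symm)^[n % N] y) = (⇑T.symm)^[n % N - i] y :=
        iterate_symm_iterate_of_le T.symm h y
      rw [hc]
      exact hmin _ (by have := Nat.mod_le n N; omega)
    · have hc : (⇑T)^[i] ((⇑T.symm)^[n % N] y) = (⇑T)^[i - n % N] y :=
        iterate_symm_iterate_of_ge T.symm h.le y
      rw [hc]
      exact hfwd _ (by omega)

/-- **Rokhlin's lemma for nonsingular transformations.** Let `T` be an aperiodic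
nonsingular transformation of a standard probability space `(X, ℬ, μ)`. For every `ε > 0`
and every integer `N > 1` there is a measurable set `A` such that `A, TA, …, T^{N-1}A`
are pairwise disjoint and `μ(A ∪ TA ∪ ⋯ ∪ T^{N-1}A) > 1 - ε`. -/
theorem stmt_7 {X : Type*} [MeasurableSpace X] [StandardBorelSpace X]
    (μ : Measure X) [IsProbabilityMeasure μ] (T : X ≃ᵐ X)
    (hns : ∀ N : Set X, MeasurableSet N → (μ (⇑T ⁻¹' N) = 0 ↔ μ N = 0))
    (hap : ∀ᵐ x ∂μ, ∀ n : ℕ, 0 < n → (⇑T)^[n] x ≠ x)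
    (ε : ℝ) (hε : 0 < ε) (N : ℕ) (hN : 1 < N) :
    ∃ A : Set X, MeasurableSet A ∧
      (∀ i j : ℕ, i < N → j < N → i ≠ j →
        Disjoint ((⇑T)^[i] '' A) ((⇑T)^[j] '' A)) ∧
      1 - ENNReal.ofReal ε < μ (⋃ i ∈ Finset.range N, (⇑T)^[i] '' A) := by
  set δ : ℝ≥0∞ := min (ENNReal.ofReal ε) 1 with hδ
  have hδ0 : 0 < δ := lt_min (ENNReal.ofReal_pos.2 hε) one_pos
  obtain ⟨B, hB, hsweep, hsmall⟩ := exists_small_sweeping_set μ T hap δ hδ0 N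
  refine ⟨towerBase T B N, measurableSet_towerBase T hB N,
    fun i j hi hj hij => disjoint_iterate_image_towerBase T B hi hj hij, ?_⟩
  set U := ⋃ i ∈ Finset.range N, (⇑T)^[i] '' towerBase T B N
  have hcover : ∀ᵐ y ∂μ, y ∈ (univ : Set X) →
      y ∈ U ∪ ⋃ j ∈ Finset.range N, (⇑T)^[j] ⁻¹' B := by
    filter_upwards [hsweep] with y hy _
    by_cases h : ∃ j < N, (⇑T)^[j] y ∈ B
    · obtain ⟨j, hj, hjB⟩ := h
      exact Or.inr (mem_biUnion (Finset.mem_range.2 hj) hjB)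
    · push Not at h
      exact Or.inl (mem_iUnion_iterate_image_towerBase T (by omega) hy h)
  have hle : 1 ≤ μ U + ∑ j ∈ Finset.range N, μ ((⇑T)^[j] ⁻¹' B) :=
    calc 1 = μ univ := measure_univ.symm
      _ ≤ μ (U ∪ ⋃ j ∈ Finset.range N, (⇑T)^[j] ⁻¹' B) := measure_mono_ae hcover
      _ ≤ μ U + μ (⋃ j ∈ Finset.range N, (⇑T)^[j] ⁻¹' B) := measure_union_le _ _
      _ ≤ _ := by gcongr; exact measure_biUnion_finset_le _ _
  calc 1 - ENNReal.ofReal ε ≤ 1 - δ := tsub_le_tsub_left (min_le_left _ _) 1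
    _ < μ U := ?_
  refine ENNReal.sub_lt_of_lt_add (min_le_right _ _) (hle.trans_lt ?_)
  exact ENNReal.add_lt_add_left (measure_ne_top _ _) hsmall
end

section
/- (Ergodic decomposition theorem) Let T be a conservative nonsingular transformation of a standard probability space (X, ℬ, μ). Then there exist a standard probability space (Y, 𝒜, ν) and a family of probability measures μ_y on (X, ℬ), y ∈ Y, such that: (i) for each A ∈ ℬ the map y ↦ μ_y(A) is Borel and μ(A) = ∫ μ_y(A) dν(y); (ii) for y ≠ y′ the measures μ_y and μ_{y′} are mutually singular; (iii) for each y ∈ Y the transformation T is nonsingular, conservative and ergodic on (X, ℬ, μ_y); (iv) for each y ∈ Y, d(μ∘T)/dμ = d(μ_y∘T)/dμ_y μ_y-a.e.; (v) if (Y′, 𝒜′, ν′) with measures μ′_{y′} is another family satisfying (i)–(iv), then there exists a measure-preserving isomorphism θ : Y → Y′ such that μ_y = μ′_{θy} for ν-a.e. y. -/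
open MeasureTheory Set Filter ENNReal

/-- `T` is quasi-invariant (nonsingular) w.r.t. `μ`. -/
def QuasiInvariant' {X : Type*} [MeasurableSpace X] (μ : Measure X) (T : X → X) : Prop :=
  ∀ N : Set X, MeasurableSet N → (μ (T ⁻¹' N) = 0 ↔ μ N = 0)

/-- `T` is *ergodic* w.r.t. `μ`. -/
def Ergodic' {X : Type*} [MeasurableSpace X] (μ : Measure X) (T : X → X) : Prop :=
  ∀ A : Set X, MeasurableSet A → T ⁻¹' A = A → μ A = 0 ∨ μ Aᶜ = 0

/-- Conditions (i)–(iv) of the ergodic decomposition theorem for the family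
`(μ_y)_{y ∈ Y}` of probability measures on `X` over the base `(Y, 𝒜, ν)`:
(i) `y ↦ μ_y(A)` is Borel and `μ(A) = ∫ μ_y(A) dν(y)` for every measurable `A`;
(ii) the `μ_y` are pairwise mutually singular;
(iii) `T` is nonsingular, conservative and ergodic with respect to each `μ_y`;
(iv) `d(μ∘T)/dμ = d(μ_y∘T)/dμ_y` `μ_y`-a.e., for each `y`. -/
def IsErgodicDecomposition {X : Type*} [MeasurableSpace X] (μ : Measure X) (T : X ≃ᵐ X)
    {Y : Type} [MeasurableSpace Y] (ν : Measure Y) (μs : Y → Measure X) : Prop :=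
  (∀ y, IsProbabilityMeasure (μs y)) ∧
  (∀ A : Set X, MeasurableSet A → Measurable fun y => μs y A) ∧
  (∀ A : Set X, MeasurableSet A → μ A = ∫⁻ y, μs y A ∂ν) ∧
  (∀ y y' : Y, y ≠ y' → Measure.MutuallySingular (μs y) (μs y')) ∧
  (∀ y : Y, QuasiInvariant' (μs y) ⇑T ∧ Conservative' (μs y) ⇑T ∧ Ergodic' (μs y) ⇑T) ∧
  (∀ y : Y, (μ.map ⇑T.symm).rnDeriv μ =ᵐ[μs y] ((μs y).map ⇑T.symm).rnDeriv (μs y))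

namespace ErgodicDecomposition

open scoped Topology

theorem ennreal_limsup_add_le (u v : ℕ → ℝ≥0∞) :
    limsup (fun n => u n + v n) atTop ≤ limsup u atTop + limsup v atTop := by
  refine ENNReal.le_of_forall_pos_le_add fun ε hε h => ?_
  have hu : limsup u atTop ≠ ∞ := ne_top_of_le_ne_top h.ne le_self_add
  have hv : limsup v atTop ≠ ∞ := ne_top_of_le_ne_top h.ne le_add_self
  have hε' : (ε : ℝ≥0∞) / 2 ≠ 0 := by simp [hε.ne']
  have h1 := eventually_lt_of_limsup_lt (ENNReal.lt_add_right hu hε')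
  have h2 := eventually_lt_of_limsup_lt (ENNReal.lt_add_right hv hε')
  refine limsup_le_of_le (by isBoundedDefault) ?_
  filter_upwards [h1, h2] with n hn1 hn2
  calc u n + v n ≤ (limsup u atTop + ε / 2) + (limsup v atTop + ε / 2) :=
        add_le_add hn1.le hn2.le
    _ = limsup u atTop + limsup v atTop + (ε / 2 + ε / 2) := by ring
    _ = _ := by rw [ENNReal.add_halves]

section OrbitSums

variable {X : Type*}

/-- The product of `ω` along the first `n` points of the orbit of `x`; if `ω` is the
Radon-Nikodym derivative of `T`, this is the one of `T^[n]`. -/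
noncomputable def cocycleWeight (ω : X → ℝ≥0∞) (T : X → X) (n : ℕ) (x : X) : ℝ≥0∞ :=
  ∏ i ∈ Finset.range n, ω (T^[i] x)

/-- Weighted Birkhoff sums of `g` along the orbit of `x`. -/
noncomputable def orbitSum (ω : X → ℝ≥0∞) (T : X → X) (g : X → ℝ≥0∞) (n : ℕ) (x : X) : ℝ≥0∞ :=
  ∑ i ∈ Finset.range n, cocycleWeight ω T i x * g (T^[i] x)

/-- The upper limit of the weighted proportion of time spent in `A` by the orbit of `x`. -/
noncomputable def ratioLimsup (ω : X → ℝ≥0∞) (T : X → X) (A : Set X) (x : X) : ℝ≥0∞ :=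
  limsup (fun n => orbitSum ω T (A.indicator 1) n x / orbitSum ω T 1 n x) atTop

variable (ω : X → ℝ≥0∞) (T : X → X) (g : X → ℝ≥0∞) (A : Set X)

theorem cocycleWeight_succ (n : ℕ) (x : X) :
    cocycleWeight ω T (n + 1) x = ω x * cocycleWeight ω T n (T x) := by
  simp [cocycleWeight, Finset.prod_range_succ', mul_comm]

theorem orbitSum_succ (n : ℕ) (x : X) :
    orbitSum ω T g (n + 1) x = g x + ω x * orbitSum ω T g n (T x) := by
  simp only [orbitSum, Finset.sum_range_succ', Finset.mul_sum, cocycleWeight_succ, mul_assoc]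
  simp [cocycleWeight, add_comm]

theorem orbitSum_indicator_le (n : ℕ) (x : X) :
    orbitSum ω T (A.indicator 1) n x ≤ orbitSum ω T 1 n x :=
  Finset.sum_le_sum fun i _ => by
    gcongr
    exact Set.indicator_le_self _ _ _

theorem orbitSum_indicator_add_compl (n : ℕ) (x : X) :
    orbitSum ω T (A.indicator 1) n x + orbitSum ω T (Aᶜ.indicator 1) n x =
      orbitSum ω T 1 n x := by
  simp only [orbitSum, ← Finset.sum_add_distrib, ← mul_add]
  refine Finset.sum_congr rfl fun i _ => ?_
  rw [Set.indicator_self_add_compl_apply]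

theorem ratioLimsup_le_one (x : X) : ratioLimsup ω T A x ≤ 1 := by
  refine limsup_le_of_le (by isBoundedDefault) (Eventually.of_forall fun n => ?_)
  exact ENNReal.div_le_of_le_mul (by rw [one_mul]; exact orbitSum_indicator_le ω T A n x)

variable {ω T A}

theorem one_le_orbitSum_succ (n : ℕ) (x : X) : 1 ≤ orbitSum ω T 1 (n + 1) x := by
  rw [orbitSum_succ]; exact le_self_add

theorem cocycleWeight_ne_top {x : X} (h : ∀ i, ω (T^[i] x) ≠ ∞) (n : ℕ) :
    cocycleWeight ω T n x ≠ ∞ :=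
  ENNReal.prod_ne_top fun i _ => h i

theorem orbitSum_one_ne_top {x : X} (h : ∀ i, ω (T^[i] x) ≠ ∞) (n : ℕ) :
    orbitSum ω T 1 n x ≠ ∞ :=
  ENNReal.sum_ne_top.2 fun i _ => by simpa using cocycleWeight_ne_top h i

theorem one_le_ratioLimsup_add_compl {x : X} (h : ∀ i, ω (T^[i] x) ≠ ∞) :
    1 ≤ ratioLimsup ω T A x + ratioLimsup ω T Aᶜ x := by
  refine le_trans ?_ (ennreal_limsup_add_le _ _)
  refine le_limsup_of_frequently_le (Eventually.frequently ?_) (by isBoundedDefault)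
  filter_upwards [eventually_ge_atTop 1] with n hn
  obtain ⟨k, rfl⟩ := Nat.exists_eq_add_of_le' hn
  rw [← ENNReal.add_div, orbitSum_indicator_add_compl, ENNReal.div_self]
  · exact (one_pos.trans_le (one_le_orbitSum_succ k x)).ne'
  · exact orbitSum_one_ne_top h _

theorem tendsto_orbitSum_one {x : X} (h : ∑' n, cocycleWeight ω T n x = ∞) :
    Tendsto (fun n => orbitSum ω T 1 n x) atTop (𝓝 ∞) := by
  rw [← h]
  simpa [orbitSum] using ENNReal.tendsto_nat_tsum (fun n => cocycleWeight ω T n x)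

/-- The two ratios compared in the invariance of `ratioLimsup` differ by at most
`(1 + w * t)⁻¹`. -/
theorem ratio_step_bounds {a w s t : ℝ≥0∞} (ha : a ≤ 1) (hw0 : w ≠ 0) (hw : w ≠ ∞)
    (hst : s ≤ t) (ht0 : t ≠ 0) (ht : t ≠ ∞) :
    (a + w * s) / (1 + w * t) ≤ s / t + (1 + w * t)⁻¹ ∧
      s / t ≤ (a + w * s) / (1 + w * t) + (1 + w * t)⁻¹ := by
  have hD0 : 1 + w * t ≠ 0 := by simp
  have hD : 1 + w * t ≠ ∞ := by finiteness
  have hwt : s / t = (w * s) / (w * t) := (ENNReal.mul_div_mul_left s t hw0 hw).symm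
  constructor
  · rw [ENNReal.add_div, add_comm, hwt]
    gcongr
    · exact le_add_self
    · rw [← one_div]; gcongr
  · rw [← one_div, ← ENNReal.add_div, ENNReal.le_div_iff_mul_le (.inl hD0) (.inl hD), mul_add,
      mul_one, mul_left_comm, ENNReal.div_mul_cancel ht0 ht, add_comm]
    have : s / t ≤ 1 := ENNReal.div_le_of_le_mul (by simpa using hst)
    calc w * s + s / t ≤ w * s + 1 := by gcongr
      _ ≤ a + w * s + 1 := by gcongr; exact le_add_self

theorem ratioLimsup_apply_map {x : X} (h : ∀ i, ω (T^[i] x) ≠ ∞) (h0 : ω x ≠ 0)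
    (hs : ∑' n, cocycleWeight ω T n x = ∞) :
    ratioLimsup ω T A (T x) = ratioLimsup ω T A x := by
  have hlim : limsup (fun n => (orbitSum ω T 1 (n + 1) x)⁻¹) atTop = 0 := by
    refine Tendsto.limsup_eq ?_
    have := tendsto_inv_iff.2 ((tendsto_add_atTop_iff_nat 1).2 (tendsto_orbitSum_one hs))
    simpa using this
  have hshift : limsup (fun n => orbitSum ω T (A.indicator 1) (n + 1) x /
      orbitSum ω T 1 (n + 1) x) atTop = ratioLimsup ω T A x :=
    limsup_nat_add (fun n => orbitSum ω T (A.indicator 1) n x / orbitSum ω T 1 n x) 1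
  have key : ∀ᶠ n in atTop,
      orbitSum ω T (A.indicator 1) (n + 1) x / orbitSum ω T 1 (n + 1) x ≤
        orbitSum ω T (A.indicator 1) n (T x) / orbitSum ω T 1 n (T x) +
          (orbitSum ω T 1 (n + 1) x)⁻¹ ∧
      orbitSum ω T (A.indicator 1) n (T x) / orbitSum ω T 1 n (T x) ≤
        orbitSum ω T (A.indicator 1) (n + 1) x / orbitSum ω T 1 (n + 1) x +
          (orbitSum ω T 1 (n + 1) x)⁻¹ := by
    filter_upwards [eventually_ge_atTop 1] with n hn
    obtain ⟨k, rfl⟩ := Nat.exists_eq_add_of_le' hn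
    simp only [orbitSum_succ _ _ _ (k + 1) x, Pi.one_apply]
    refine ratio_step_bounds ?_ h0 (h 0) (orbitSum_indicator_le _ _ _ _ _)
      (one_pos.trans_le (one_le_orbitSum_succ k _)).ne' (orbitSum_one_ne_top (fun i => h (i + 1)) _)
    exact Set.indicator_le_self A 1 x
  apply le_antisymm
  · calc ratioLimsup ω T A (T x) ≤ _ := limsup_le_limsup (key.mono fun n hn => hn.2)
      _ ≤ _ := ennreal_limsup_add_le _ _
      _ = _ := by rw [hlim, hshift, add_zero]
  · calc ratioLimsup ω T A x = _ := hshift.symm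
      _ ≤ _ := limsup_le_limsup (key.mono fun n hn => hn.1)
      _ ≤ _ := ennreal_limsup_add_le _ _
      _ = _ := by rw [hlim, add_zero]; rfl

/-- The `n`-th partial maximum of the weighted orbit sums of `p - q`, if `q` is invariant. -/
noncomputable def partialMax (ω : X → ℝ≥0∞) (T : X → X) (p q : X → ℝ≥0∞) : ℕ → X → ℝ≥0∞
  | 0, _ => 0
  | n + 1, x => p x + ω x * partialMax ω T p q n (T x) - q x

theorem partialMax_le_succ (ω : X → ℝ≥0∞) (T : X → X) (p q : X → ℝ≥0∞) (n : ℕ) (x : X) :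
    partialMax ω T p q n x ≤ partialMax ω T p q (n + 1) x := by
  induction n generalizing x with
  | zero => exact zero_le
  | succ n ih =>
    change p x + ω x * partialMax ω T p q n (T x) - q x ≤
      p x + ω x * partialMax ω T p q (n + 1) (T x) - q x
    gcongr
    exact ih (T x)

theorem orbitSum_le_partialMax_add (p q : X → ℝ≥0∞) (n : ℕ) {x : X}
    (hx : ∀ i, q (T^[i] x) = q x) :
    orbitSum ω T p n x ≤ partialMax ω T p q n x + q x * orbitSum ω T 1 n x := by
  induction n generalizing x with
  | zero => simp [orbitSum]
  | succ n ih =>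
    have hTx : q (T x) = q x := hx 1
    have ih' := ih (x := T x) fun i => by rw [hTx]; exact hx (i + 1)
    rw [hTx] at ih'
    rw [orbitSum_succ, orbitSum_succ, partialMax]
    calc p x + ω x * orbitSum ω T p n (T x)
        ≤ p x + ω x * (partialMax ω T p q n (T x) + q x * orbitSum ω T 1 n (T x)) := by gcongr
      _ = (p x + ω x * partialMax ω T p q n (T x)) + q x * (ω x * orbitSum ω T 1 n (T x)) := by
          ring
      _ ≤ (p x + ω x * partialMax ω T p q n (T x) - q x + q x) +
            q x * (ω x * orbitSum ω T 1 n (T x)) := add_le_add le_tsub_add le_rfl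
      _ = _ := by simp only [Pi.one_apply]; ring

variable [MeasurableSpace X]

theorem measurable_cocycleWeight (hω : Measurable ω) (hT : Measurable T) (n : ℕ) :
    Measurable (cocycleWeight ω T n) :=
  Finset.measurable_prod _ fun i _ => hω.comp (hT.iterate i)

theorem measurable_orbitSum (hω : Measurable ω) (hT : Measurable T) {g : X → ℝ≥0∞}
    (hg : Measurable g) (n : ℕ) : Measurable (orbitSum ω T g n) :=
  Finset.measurable_sum _ fun i _ =>
    (measurable_cocycleWeight hω hT i).mul (hg.comp (hT.iterate i))

theorem measurable_ratioLimsup (hω : Measurable ω) (hT : Measurable T) (hA : MeasurableSet A) :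
    Measurable (ratioLimsup ω T A) :=
  Measurable.limsup fun n =>
    (measurable_orbitSum hω hT (measurable_one.indicator hA) n).div
      (measurable_orbitSum hω hT measurable_one n)

theorem measurable_partialMax (hω : Measurable ω) (hT : Measurable T)
    {p q : X → ℝ≥0∞} (hp : Measurable p) (hq : Measurable q) (n : ℕ) :
    Measurable (partialMax ω T p q n) := by
  induction n with
  | zero => exact measurable_const
  | succ n ih => exact (hp.add (hω.mul (ih.comp hT))).sub hq

end OrbitSums

variable {X : Type*} [MeasurableSpace X] {T : X ≃ᵐ X} {ω : X → ℝ≥0∞} {m : Measure X} {A B : Set X}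

/-- `ω` is the Radon-Nikodym derivative of `T` with respect to `m`, is a.e. positive, and the
cocycle it generates is a.e. recurrent. -/
structure HasRecurrentCocycle (T : X ≃ᵐ X) (ω : X → ℝ≥0∞) (m : Measure X) : Prop where
  map_symm : m.map T.symm = m.withDensity ω
  ne_zero : ∀ᵐ x ∂m, ω x ≠ 0
  tsum_eq_top : ∀ᵐ x ∂m, ∑' n, cocycleWeight ω T n x = ∞

theorem lintegral_mul_comp (h : m.map T.symm = m.withDensity ω) (hω : Measurable ω)
    {g : X → ℝ≥0∞} (hg : Measurable g) : ∫⁻ x, ω x * g (T x) ∂m = ∫⁻ x, g x ∂m := by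
  have := lintegral_withDensity_eq_lintegral_mul m hω (hg.comp T.measurable)
  rw [← h, lintegral_map (hg.comp T.measurable) T.symm.measurable] at this
  simpa using this.symm

theorem measure_preimage_symm (h : m.map T.symm = m.withDensity ω) (hA : MeasurableSet A) :
    m (T.symm ⁻¹' A) = ∫⁻ x in A, ω x ∂m := by
  rw [← withDensity_apply _ hA, ← h, Measure.map_apply T.symm.measurable hA]

theorem lintegral_cocycleWeight_mul (h : m.map T.symm = m.withDensity ω) (hω : Measurable ω)
    {g : X → ℝ≥0∞} (hg : Measurable g) (n : ℕ) :
    ∫⁻ x, cocycleWeight ω T n x * g (T^[n] x) ∂m = ∫⁻ x, g x ∂m := by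
  induction n with
  | zero => simp [cocycleWeight]
  | succ n ih =>
    simp only [cocycleWeight_succ, Function.iterate_succ_apply, mul_assoc]
    rw [lintegral_mul_comp (g := fun x => cocycleWeight ω T n x * g (T^[n] x)) h hω, ih]
    exact (measurable_cocycleWeight hω T.measurable n).mul (hg.comp (T.measurable.iterate n))

theorem symm_iterate_iterate (T : X ≃ᵐ X) (n : ℕ) (x : X) : T.symm^[n] (T^[n] x) = x :=
  Function.LeftInverse.iterate T.symm_apply_apply n x

theorem iterate_symm_iterate (T : X ≃ᵐ X) (n : ℕ) (x : X) : T^[n] (T.symm^[n] x) = x :=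
  Function.LeftInverse.iterate T.apply_symm_apply n x

theorem setLIntegral_cocycleWeight (h : m.map T.symm = m.withDensity ω) (hω : Measurable ω)
    (hA : MeasurableSet A) (n : ℕ) :
    ∫⁻ x in A, cocycleWeight ω T n x ∂m = m (T.symm^[n] ⁻¹' A) := by
  have hA' : MeasurableSet (T.symm^[n] ⁻¹' A) := T.symm.measurable.iterate n hA
  rw [← lintegral_indicator_one hA',
    ← lintegral_cocycleWeight_mul h hω (measurable_one.indicator hA') n,
    ← lintegral_indicator hA]
  congr 1 with x
  by_cases hx : x ∈ A <;> simp [Set.indicator, hx, symm_iterate_iterate]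

theorem setLIntegral_tsum_cocycleWeight (h : m.map T.symm = m.withDensity ω) (hω : Measurable ω)
    (hA : MeasurableSet A) :
    ∫⁻ x in A, ∑' n, cocycleWeight ω T n x ∂m = ∑' n, m (T.symm^[n] ⁻¹' A) := by
  rw [lintegral_tsum fun n => (measurable_cocycleWeight hω T.measurable n).aemeasurable]
  exact tsum_congr fun n => setLIntegral_cocycleWeight h hω hA n

theorem map_symm_absolutelyContinuous (hns : QuasiInvariant' m T) : m.map T.symm ≪ m := by
  refine Measure.AbsolutelyContinuous.mk fun s hs h0 => ?_
  rw [Measure.map_apply T.symm.measurable hs, ← hns _ (T.symm.measurable hs), ← preimage_comp]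
  simpa using h0

theorem conservative_symm (hns : QuasiInvariant' m T) (hcons : Conservative' m T) :
    Conservative T.symm m where
  measurable := T.symm.measurable
  absolutelyContinuous := map_symm_absolutelyContinuous hns
  exists_mem_iterate_mem' s hs h0 := by
    obtain ⟨n, hn, hpos⟩ := hcons s hs (pos_iff_ne_zero.2 h0)
    obtain ⟨x, hx, hx'⟩ := nonempty_of_measure_ne_zero hpos.ne'
    exact ⟨T^[n] x, hx', n, hn.ne', by rwa [symm_iterate_iterate]⟩

theorem tsum_cocycleWeight_eq_top [IsFiniteMeasure m] (hns : QuasiInvariant' m T)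
    (hcons : Conservative' m T) (h : m.map T.symm = m.withDensity ω) (hω : Measurable ω) :
    ∀ᵐ x ∂m, ∑' n, cocycleWeight ω T n x = ∞ := by
  have hS : Measurable fun x => ∑' n, cocycleWeight ω T n x :=
    Measurable.tsum fun n => measurable_cocycleWeight hω T.measurable n
  have hbdd : ∀ C : ℕ, ∀ᵐ x ∂m, ¬ ∑' n, cocycleWeight ω T n x ≤ C := by
    intro C
    set A := {x | ∑' n, cocycleWeight ω T n x ≤ C}
    have hA : MeasurableSet A := measurableSet_le hS measurable_const
    have hfin : ∑' n, m (T.symm^[n] ⁻¹' A) ≠ ∞ := by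
      rw [← setLIntegral_tsum_cocycleWeight h hω hA]
      refine ne_top_of_le_ne_top (b := ∫⁻ _ in A, (C : ℝ≥0∞) ∂m) ?_
        (setLIntegral_mono measurable_const fun x hx => hx)
      rw [setLIntegral_const]
      finiteness
    have h1 : ∀ᵐ x ∂m, ¬ ∃ᶠ n in atTop, T.symm^[n] x ∈ A := by
      rw [ae_iff]
      simp only [not_not]
      exact measure_setOfPred_frequently_eq_zero hfin
    filter_upwards [h1,
      (conservative_symm hns hcons).ae_mem_imp_frequently_image_mem hA.nullMeasurableSet]
      with x hx1 hx2 hxA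
    exact hx1 (hx2 hxA)
  filter_upwards [ae_all_iff.2 hbdd] with x hx
  by_contra hne
  obtain ⟨C, hC⟩ := ENNReal.exists_nat_gt hne
  exact hx C hC.le

namespace HasRecurrentCocycle

theorem of_conservative [IsFiniteMeasure m] (hns : QuasiInvariant' m T)
    (hcons : Conservative' m T) (h : m.map T.symm = m.withDensity ω) (hω : Measurable ω) :
    HasRecurrentCocycle T ω m := by
  refine ⟨h, ?_, tsum_cocycleWeight_eq_top hns hcons h hω⟩
  set A := {x | ω x = 0}
  have hA : MeasurableSet A := hω (measurableSet_singleton 0)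
  have h0 : m (T.symm ⁻¹' A) = 0 := by
    rw [measure_preimage_symm h hA, setLIntegral_congr_fun hA (g := 0) fun x hx => hx]
    simp
  rw [← hns _ (T.symm.measurable hA), ← preimage_comp] at h0
  simpa [ae_iff] using h0

theorem preimage_eq_zero_iff (hm : HasRecurrentCocycle T ω m) (hω : Measurable ω)
    (hA : MeasurableSet A) : m (T ⁻¹' A) = 0 ↔ m A = 0 := by
  have h1 := measure_preimage_symm hm.map_symm (T.measurable hA)
  rw [← preimage_comp] at h1
  simp only [MeasurableEquiv.self_comp_symm, preimage_id_eq, id_eq] at h1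
  rw [h1, setLIntegral_eq_zero_iff (T.measurable hA) hω, measure_eq_zero_iff_ae_notMem]
  refine eventually_congr ?_
  filter_upwards [hm.ne_zero] with x hx
  simp [hx]

theorem quasiMeasurePreserving (hm : HasRecurrentCocycle T ω m) (hω : Measurable ω) :
    Measure.QuasiMeasurePreserving T m m :=
  ⟨T.measurable, Measure.AbsolutelyContinuous.mk fun s hs h0 => by
    rwa [Measure.map_apply T.measurable hs, hm.preimage_eq_zero_iff hω hs]⟩

theorem quasiMeasurePreserving_symm (hm : HasRecurrentCocycle T ω m) :
    Measure.QuasiMeasurePreserving T.symm m m :=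
  ⟨T.symm.measurable, by
    rw [hm.map_symm]
    exact withDensity_absolutelyContinuous _ _⟩

theorem lintegral_eq (hm : HasRecurrentCocycle T ω m) : ∫⁻ x, ω x ∂m = m univ := by
  simpa using (measure_preimage_symm hm.map_symm MeasurableSet.univ).symm

theorem ae_orbit_ne_top [IsFiniteMeasure m] (hm : HasRecurrentCocycle T ω m) (hω : Measurable ω) :
    ∀ᵐ x ∂m, ∀ i, ω (T^[i] x) ≠ ∞ := by
  have h : ∀ᵐ x ∂m, ω x ≠ ∞ :=
    (ae_lt_top hω (by rw [hm.lintegral_eq]; finiteness)).mono fun x hx => hx.ne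
  exact ae_all_iff.2 fun i => ((hm.quasiMeasurePreserving hω).iterate i).ae h

theorem conservative' [IsFiniteMeasure m] (hm : HasRecurrentCocycle T ω m) (hω : Measurable ω) :
    Conservative' m T := by
  intro A hA hpos
  by_contra! hcon
  set W := A \ ⋃ n : ℕ, T^[n + 1] ⁻¹' A
  have hWm : MeasurableSet W :=
    hA.diff (MeasurableSet.iUnion fun n => T.measurable.iterate _ hA)
  have hW : m W ≠ 0 := by
    have : m (A ∩ ⋃ n : ℕ, T^[n + 1] ⁻¹' A) = 0 := by
      rw [inter_iUnion, measure_iUnion_null_iff]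
      exact fun n => le_zero_iff.1 (hcon (n + 1) n.succ_pos)
    rw [show m W = m A from measure_sdiff_null' this]
    exact hpos.ne'
  have hdisj : Pairwise (Function.onFun Disjoint fun n => T.symm^[n] ⁻¹' W) := by
    refine (Std.Symm.pairwise_on _).2 fun i j hij => ?_
    rw [Set.disjoint_left]
    intro x hi hj
    obtain ⟨k, rfl⟩ := Nat.exists_eq_add_of_lt hij
    refine hj.2 (mem_iUnion.2 ⟨k, ?_⟩)
    have : T^[k + 1] (T.symm^[i + k + 1] x) = T.symm^[i] x := by
      rw [add_assoc, add_comm i, Function.iterate_add_apply T.symm, iterate_symm_iterate]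
    rw [mem_preimage, this]
    exact hi.1
  have h1 : ∑' n, m (T.symm^[n] ⁻¹' W) ≠ ∞ := by
    rw [← measure_iUnion hdisj fun n => T.symm.measurable.iterate n hWm]
    finiteness
  rw [← setLIntegral_tsum_cocycleWeight hm.map_symm hω hWm,
    lintegral_congr_ae (ae_restrict_of_ae hm.tsum_eq_top), setLIntegral_const,
    ENNReal.top_mul hW] at h1
  exact h1 rfl

theorem restrict (hm : HasRecurrentCocycle T ω m) (hB : MeasurableSet B)
    (hinv : T ⁻¹' B =ᵐ[m] B) : HasRecurrentCocycle T ω (m.restrict B) := by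
  refine ⟨?_, ae_restrict_of_ae hm.ne_zero, ae_restrict_of_ae hm.tsum_eq_top⟩
  have hsymm : T.symm ⁻¹' B =ᵐ[m] B := by
    have := hm.quasiMeasurePreserving_symm.preimage_ae_eq hinv
    rw [← preimage_comp] at this
    simpa using this.symm
  rw [← restrict_withDensity hB, ← hm.map_symm, Measure.restrict_map T.symm.measurable hB,
    Measure.restrict_congr_set hsymm]

/-- The ratio limits are invariant. -/
theorem ratioLimsup_comp_ae_eq [IsFiniteMeasure m] (hm : HasRecurrentCocycle T ω m)
    (hω : Measurable ω) : ratioLimsup ω T A ∘ T =ᵐ[m] ratioLimsup ω T A := by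
  filter_upwards [hm.ae_orbit_ne_top hω, hm.ne_zero, hm.tsum_eq_top] with x h1 h2 h3
  exact ratioLimsup_apply_map h1 h2 h3

theorem lintegral_partialMax_succ_add_le (hm : HasRecurrentCocycle T ω m) (hω : Measurable ω)
    {p q : X → ℝ≥0∞} (hp : Measurable p) (hq : Measurable q) (n : ℕ) :
    ∫⁻ x, partialMax ω T p q (n + 1) x ∂m + ∫⁻ x in {x | partialMax ω T p q (n + 1) x ≠ 0}, q x ∂m ≤
      ∫⁻ x, p x ∂m + ∫⁻ x, partialMax ω T p q n x ∂m := by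
  have hM := measurable_partialMax hω T.measurable hp hq
  have hE : MeasurableSet {x | partialMax ω T p q (n + 1) x ≠ 0} :=
    (hM (n + 1) (measurableSet_singleton 0)).compl
  rw [← lintegral_mul_comp hm.map_symm hω (hM n), ← lintegral_add_left hp,
    ← lintegral_indicator hE, ← lintegral_add_left (hM (n + 1))]
  refine lintegral_mono fun x => ?_
  by_cases hx : partialMax ω T p q (n + 1) x = 0
  · simp [hx]
  · rw [Set.indicator_of_mem (by exact hx)]
    rw [partialMax] at hx ⊢
    exact (tsub_add_cancel_of_le (not_le.1 fun h => hx (tsub_eq_zero_of_le h)).le).le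

/-- The maximal inequality. -/
theorem setLIntegral_partialMax_ne_zero_le (hm : HasRecurrentCocycle T ω m) (hω : Measurable ω)
    {p q : X → ℝ≥0∞} (hp : Measurable p) (hq : Measurable q) (hfin : ∫⁻ x, p x ∂m ≠ ∞) (n : ℕ) :
    ∫⁻ x in {x | partialMax ω T p q n x ≠ 0}, q x ∂m ≤ ∫⁻ x, p x ∂m := by
  have key := hm.lintegral_partialMax_succ_add_le hω hp hq
  have hM : ∀ n, ∫⁻ x, partialMax ω T p q n x ∂m ≠ ∞ := by
    intro n
    induction n with
    | zero => simp [partialMax]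
    | succ n ih => exact ne_top_of_le_ne_top (by finiteness) (le_self_add.trans (key n))
  cases n with
  | zero => simp [partialMax]
  | succ n =>
    refine (ENNReal.add_le_add_iff_left (hM n)).1 ?_
    calc _ ≤ ∫⁻ x, partialMax ω T p q (n + 1) x ∂m + _ := by
          gcongr with x
          exact partialMax_le_succ _ _ _ _ n x
      _ ≤ _ := key n
      _ = _ := add_comm _ _

theorem lintegral_le_of_exists_lt_orbitSum (hm : HasRecurrentCocycle T ω m) (hω : Measurable ω)
    {p q : X → ℝ≥0∞} (hp : Measurable p) (hq : Measurable q) (hfin : ∫⁻ x, p x ∂m ≠ ∞)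
    (hinv : q ∘ T =ᵐ[m] q)
    (hlt : ∀ᵐ x ∂m, q x ≠ 0 → ∃ n, q x * orbitSum ω T 1 n x < orbitSum ω T p n x) :
    ∫⁻ x, q x ∂m ≤ ∫⁻ x, p x ∂m := by
  set E : ℕ → Set X := fun n => {x | partialMax ω T p q n x ≠ 0}
  have hE : ∀ n, MeasurableSet (E n) := fun n =>
    (measurable_partialMax hω T.measurable hp hq n (measurableSet_singleton 0)).compl
  have hmono : Monotone E := monotone_nat_of_le_succ fun n x hx h0 =>
    hx (le_zero_iff.1 (h0 ▸ partialMax_le_succ ω T p q n x))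
  have horbit : ∀ᵐ x ∂m, ∀ i, q (T^[i] x) = q x := by
    have h : ∀ᵐ x ∂m, ∀ i, q (T (T^[i] x)) = q (T^[i] x) :=
      ae_all_iff.2 fun i => ((hm.quasiMeasurePreserving hω).iterate i).ae hinv
    filter_upwards [h] with x hx i
    induction i with
    | zero => rfl
    | succ i ih => rw [Function.iterate_succ_apply', hx, ih]
  calc ∫⁻ x, q x ∂m = ∫⁻ x in ⋃ n, E n, q x ∂m := by
        rw [← lintegral_indicator (MeasurableSet.iUnion hE)]
        refine lintegral_congr_ae ?_
        filter_upwards [horbit, hlt] with x hx hx'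
        by_cases h0 : q x = 0
        · simp [Set.indicator, h0]
        · obtain ⟨n, hn⟩ := hx' h0
          rw [Set.indicator_of_mem]
          refine mem_iUnion.2 ⟨n, fun hz => ?_⟩
          have := orbitSum_le_partialMax_add (ω := ω) p q n hx
          rw [hz, zero_add] at this
          exact this.not_gt hn
    _ = ⨆ n, ∫⁻ x in E n, q x ∂m :=
        setLIntegral_iUnion_of_directed _ (directed_of_isDirected_le hmono)
    _ ≤ _ := iSup_le fun n => hm.setLIntegral_partialMax_ne_zero_le hω hp hq hfin n

theorem lintegral_ratioLimsup_le [IsFiniteMeasure m] (hm : HasRecurrentCocycle T ω m)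
    (hω : Measurable ω) (hA : MeasurableSet A) : ∫⁻ x, ratioLimsup ω T A x ∂m ≤ m A := by
  refine ENNReal.le_of_forall_lt_one_mul_le fun a ha => ?_
  have hΦ := measurable_ratioLimsup hω T.measurable hA
  rw [← lintegral_const_mul a hΦ, ← lintegral_indicator_one hA]
  refine hm.lintegral_le_of_exists_lt_orbitSum hω (measurable_one.indicator hA)
    (hΦ.const_mul a) (by rw [lintegral_indicator_one hA]; finiteness) ?_ ?_
  · filter_upwards [hm.ratioLimsup_comp_ae_eq hω (A := A)] with x hx
    exact congrArg (a * ·) hx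
  · refine Eventually.of_forall fun x hx => ?_
    have hx0 : ratioLimsup ω T A x ≠ 0 := fun h => hx (by simp [h])
    have hxt : ratioLimsup ω T A x ≠ ∞ :=
      ne_top_of_le_ne_top one_ne_top (ratioLimsup_le_one _ _ _ _)
    have hlt : a * ratioLimsup ω T A x < ratioLimsup ω T A x := by
      simpa using ENNReal.mul_lt_mul_left hx0 hxt ha
    obtain ⟨n, hn⟩ := (frequently_lt_of_lt_limsup (by isBoundedDefault) hlt).exists
    exact ⟨n, ENNReal.mul_lt_of_lt_div hn⟩

/-- An integrated form of the Hurewicz ergodic theorem. -/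
theorem lintegral_ratioLimsup [IsFiniteMeasure m] (hm : HasRecurrentCocycle T ω m)
    (hω : Measurable ω) (hA : MeasurableSet A) : ∫⁻ x, ratioLimsup ω T A x ∂m = m A := by
  refine le_antisymm (hm.lintegral_ratioLimsup_le hω hA) ?_
  refine (ENNReal.add_le_add_iff_right (measure_ne_top m Aᶜ)).1 ?_
  calc m A + m Aᶜ = ∫⁻ _, 1 ∂m := by rw [measure_add_measure_compl hA, lintegral_one]
    _ ≤ ∫⁻ x, ratioLimsup ω T A x + ratioLimsup ω T Aᶜ x ∂m :=
        lintegral_mono_ae <| (hm.ae_orbit_ne_top hω).mono fun x hx =>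
          one_le_ratioLimsup_add_compl hx
    _ = ∫⁻ x, ratioLimsup ω T A x ∂m + ∫⁻ x, ratioLimsup ω T Aᶜ x ∂m :=
        lintegral_add_left (measurable_ratioLimsup hω T.measurable hA) _
    _ ≤ _ := by gcongr; exact hm.lintegral_ratioLimsup_le hω hA.compl

theorem setLIntegral_ratioLimsup [IsFiniteMeasure m] (hm : HasRecurrentCocycle T ω m)
    (hω : Measurable ω) (hA : MeasurableSet A) (hB : MeasurableSet B)
    (hinv : T ⁻¹' B =ᵐ[m] B) : ∫⁻ x in B, ratioLimsup ω T A x ∂m = m (A ∩ B) := by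
  rw [(hm.restrict hB hinv).lintegral_ratioLimsup hω hA, Measure.restrict_apply hA]

/-- For an ergodic measure the ratio limits are a.e. equal to the measure. -/
theorem ratioLimsup_ae_eq_const [IsProbabilityMeasure m] (hm : HasRecurrentCocycle T ω m)
    (hω : Measurable ω) (herg : Ergodic' m T) (hA : MeasurableSet A) :
    ∀ᵐ x ∂m, ratioLimsup ω T A x = m A := by
  have hqe : QuasiErgodic T m :=
    { hm.quasiMeasurePreserving hω with
      aeconst_set := fun s hs hinv => by
        rw [eventuallyConst_set']
        rcases herg s hs hinv with h | h
        · exact .inl (ae_eq_empty.2 h)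
        · exact .inr (ae_eq_univ.2 h) }
  obtain ⟨c, hc⟩ := hqe.ae_eq_const_of_ae_eq_comp₀
    (measurable_ratioLimsup hω T.measurable hA).nullMeasurable (hm.ratioLimsup_comp_ae_eq hω)
  have h := hm.lintegral_ratioLimsup hω hA
  rw [lintegral_congr_ae hc] at h
  simp only [Function.const_apply, lintegral_const, measure_univ, mul_one] at h
  rw [← h]
  exact hc

/-- If the ratio limits along a generating `π`-system are a.e. equal to the measure, then the
measure is ergodic. -/
theorem ergodic' [IsProbabilityMeasure m] (hm : HasRecurrentCocycle T ω m) (hω : Measurable ω)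
    {ι : Type*} {S : ι → Set X} (hgen : ‹MeasurableSpace X› = .generateFrom (range S))
    (hpi : IsPiSystem (range S)) (hS : ∀ i, ∀ᵐ x ∂m, ratioLimsup ω T (S i) x = m (S i)) :
    Ergodic' m T := by
  intro B hB hinv
  have heq : m.restrict B = m B • m := by
    refine ext_of_generate_finite (range S) hgen hpi ?_ (by simp)
    rintro _ ⟨i, rfl⟩
    have hSi : MeasurableSet (S i) := by
      rw [hgen]; exact MeasurableSpace.measurableSet_generateFrom ⟨i, rfl⟩
    rw [Measure.restrict_apply hSi, ← hm.setLIntegral_ratioLimsup hω hSi hB (by rw [hinv]; rfl),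
      setLIntegral_congr_fun_ae hB ((hS i).mono fun x hx _ => hx), setLIntegral_const]
    simp [mul_comm]
  have h := congrArg (fun ρ : Measure X => ρ Bᶜ) heq
  simpa [hB.compl] using h

end HasRecurrentCocycle

theorem exists_countable_generating_piSystem (X : Type*) [hX : MeasurableSpace X]
    [StandardBorelSpace X] :
    ∃ S : ℚ → Set X, hX = .generateFrom (range S) ∧ IsPiSystem (range S) := by
  obtain ⟨e, he⟩ := exists_measurableEmbedding_real X
  have hrange : range (fun q : ℚ => e ⁻¹' Iic (q : ℝ)) = preimage e '' ⋃ q : ℚ, {Iic (q : ℝ)} := by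
    ext s; simp
  refine ⟨fun q => e ⁻¹' Iic (q : ℝ), ?_, ?_⟩
  · rw [hrange, ← MeasurableSpace.comap_generateFrom, ← Real.borel_eq_generateFrom_Iic_rat,
      ← he.comap_eq, BorelSpace.measurable_eq (α := ℝ)]
  · rw [hrange]
    exact Real.isPiSystem_Iic_rat.comap e

section Separating

variable {ι : Type*} {S : ι → Set X}

theorem measurableSet_of_generating (hgen : ‹MeasurableSpace X› = .generateFrom (range S)) (i : ι) :
    MeasurableSet (S i) := by
  rw [hgen]; exact MeasurableSpace.measurableSet_generateFrom ⟨i, rfl⟩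

theorem ext_of_generating (hgen : ‹MeasurableSpace X› = .generateFrom (range S))
    (hpi : IsPiSystem (range S)) {m₁ m₂ : Measure X} [IsProbabilityMeasure m₁]
    [IsProbabilityMeasure m₂] (h : ∀ i, m₁ (S i) = m₂ (S i)) : m₁ = m₂ :=
  ext_of_generate_finite (range S) hgen hpi (by rintro _ ⟨i, rfl⟩; exact h i) (by simp)

end Separating

theorem map_symm_eq_withDensity [IsFiniteMeasure m] (hns : QuasiInvariant' m T)
    (hω : ω =ᵐ[m] (m.map T.symm).rnDeriv m) : m.map T.symm = m.withDensity ω := by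
  rw [withDensity_congr_ae hω,
    Measure.withDensity_rnDeriv_eq _ _ (map_symm_absolutelyContinuous hns)]

/-- The ratio limits of a family of sets. -/
noncomputable def ratioMap {ι : Type} (ω : X → ℝ≥0∞) (T : X ≃ᵐ X) (S : ι → Set X) (x : X) :
    ι → ℝ≥0∞ :=
  fun i => ratioLimsup ω T (S i) x

variable {ι : Type} {S : ι → Set X}

theorem measurable_ratioMap (hω : Measurable ω) (hS : ∀ i, MeasurableSet (S i)) :
    Measurable (ratioMap ω T S) :=
  measurable_pi_lambda _ fun i => measurable_ratioLimsup hω T.measurable (hS i)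

theorem ratioMap_comp_ae_eq [Countable ι] [IsFiniteMeasure m] (hm : HasRecurrentCocycle T ω m)
    (hω : Measurable ω) : ratioMap ω T S ∘ T =ᵐ[m] ratioMap ω T S := by
  filter_upwards [ae_all_iff.2 fun i => hm.ratioLimsup_comp_ae_eq hω (A := S i)] with x hx
  exact funext hx

section Uniqueness

variable {μ : Measure X} {Y : Type} [MeasurableSpace Y] {ν : Measure Y} {μs : Y → Measure X}

theorem measurable_decomposition_coords (h : IsErgodicDecomposition μ T ν μs)
    (hS : ∀ i, MeasurableSet (S i)) : Measurable fun y i => μs y (S i) :=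
  measurable_pi_lambda _ fun i => h.2.1 _ (hS i)

theorem measurableEmbedding_decomposition_coords [Countable ι] [StandardBorelSpace Y]
    (h : IsErgodicDecomposition μ T ν μs)
    (hgen : ‹MeasurableSpace X› = .generateFrom (range S)) (hpi : IsPiSystem (range S)) :
    MeasurableEmbedding fun y i => μs y (S i) := by
  refine (measurable_decomposition_coords h
    (measurableSet_of_generating hgen)).measurableEmbedding fun y y' hyy' => ?_
  have := h.1 y
  have := h.1 y'
  by_contra hne
  have hsing := h.2.2.2.1 y y' hne
  rw [ext_of_generating hgen hpi (m₁ := μs y) (m₂ := μs y') fun i => congrFun hyy' i,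
    Measure.MutuallySingular.self_iff] at hsing
  exact IsProbabilityMeasure.ne_zero _ hsing

theorem map_decomposition_coords [Countable ι] [IsFiniteMeasure ν]
    (h : IsErgodicDecomposition μ T ν μs) (hS : ∀ i, MeasurableSet (S i)) :
    ν.map (fun y i => μs y (S i)) = μ.map (ratioMap ((μ.map T.symm).rnDeriv μ) T S) := by
  set ω := (μ.map T.symm).rnDeriv μ
  have hω : Measurable ω := Measure.measurable_rnDeriv _ _
  have hf := measurable_decomposition_coords h hS
  have hΦ : Measurable (ratioMap ω T S) := measurable_ratioMap hω hS
  obtain ⟨hprob, -, hint, -, herg, hder⟩ := h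
  have hconst : ∀ y, ∀ᵐ x ∂(μs y), ratioMap ω T S x = fun i => μs y (S i) := by
    intro y
    have := hprob y
    obtain ⟨hns, hcons, he⟩ := herg y
    have hm := HasRecurrentCocycle.of_conservative hns hcons
      (map_symm_eq_withDensity hns (hder y)) hω
    filter_upwards [ae_all_iff.2 fun i => hm.ratioLimsup_ae_eq_const hω he (hS i)] with x hx
    exact funext hx
  ext E hE
  rw [Measure.map_apply hf hE, Measure.map_apply hΦ hE, hint _ (hΦ hE),
    ← lintegral_indicator_one (hf hE)]
  refine lintegral_congr fun y => ?_
  have := hprob y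
  by_cases hy : (fun i => μs y (S i)) ∈ E
  · rw [Set.indicator_of_mem (by exact hy), Pi.one_apply, eq_comm, prob_compl_eq_zero_iff (hΦ hE)
      |>.symm, ← mem_ae_iff]
    filter_upwards [hconst y] with x hx
    simpa [hx] using hy
  · rw [Set.indicator_of_notMem (by exact hy), eq_comm, measure_eq_zero_iff_ae_notMem]
    filter_upwards [hconst y] with x hx
    simpa [hx] using hy

theorem exists_isomorphism_of_isErgodicDecomposition [StandardBorelSpace X] [StandardBorelSpace Y]
    [IsProbabilityMeasure ν] (h : IsErgodicDecomposition μ T ν μs)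
    {Y' : Type} [MeasurableSpace Y'] [StandardBorelSpace Y'] {ν' : Measure Y'}
    [IsProbabilityMeasure ν'] {μs' : Y' → Measure X} (h' : IsErgodicDecomposition μ T ν' μs') :
    ∃ (θ : Y → Y') (θ' : Y' → Y), Measurable θ ∧ Measurable θ' ∧ ν.map θ = ν' ∧
      (∀ᵐ y ∂ν, θ' (θ y) = y) ∧ (∀ᵐ y' ∂ν', θ (θ' y') = y') ∧ (∀ᵐ y ∂ν, μs y = μs' (θ y)) := by
  obtain ⟨S, hgen, hpi⟩ := exists_countable_generating_piSystem X
  have hS := measurableSet_of_generating hgen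
  have he := measurableEmbedding_decomposition_coords h hgen hpi
  have he' := measurableEmbedding_decomposition_coords h' hgen hpi
  have hmap := (map_decomposition_coords h hS).trans (map_decomposition_coords h' hS).symm
  set f : Y → ℚ → ℝ≥0∞ := fun y i => μs y (S i) with hf
  set f' : Y' → ℚ → ℝ≥0∞ := fun y i => μs' y (S i) with hf'
  obtain ⟨g, hg, hgf⟩ := he.exists_measurable_extend measurable_id fun _ => ν.nonempty_of_neZero
  obtain ⟨g', hg', hgf'⟩ :=
    he'.exists_measurable_extend measurable_id fun _ => ν'.nonempty_of_neZero
  have hrange : ∀ᵐ y ∂ν, f y ∈ range f' := by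
    refine (ae_map_iff he.measurable.aemeasurable he'.measurableSet_range).1 ?_
    rw [hmap, ae_map_iff he'.measurable.aemeasurable he'.measurableSet_range]
    exact Eventually.of_forall fun y => mem_range_self y
  have hrange' : ∀ᵐ y ∂ν', f' y ∈ range f := by
    refine (ae_map_iff he'.measurable.aemeasurable he.measurableSet_range).1 ?_
    rw [← hmap, ae_map_iff he.measurable.aemeasurable he.measurableSet_range]
    exact Eventually.of_forall fun y => mem_range_self y
  have hg1 : ∀ y, g (f y) = y := congrFun hgf
  have hg1' : ∀ y, g' (f' y) = y := congrFun hgf'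
  refine ⟨g' ∘ f, g ∘ f', hg'.comp he.measurable, hg.comp he'.measurable, ?_, ?_, ?_, ?_⟩
  · rw [← Measure.map_map hg' he.measurable, hmap, Measure.map_map hg' he'.measurable, hgf',
      Measure.map_id]
  · filter_upwards [hrange] with y ⟨y', hy⟩
    simp only [Function.comp_apply, ← hy, hg1']
    rw [hy, hg1]
  · filter_upwards [hrange'] with y ⟨y', hy⟩
    simp only [Function.comp_apply, ← hy, hg1]
    rw [hy, hg1']
  · filter_upwards [hrange] with y ⟨y', hy⟩
    have := h.1 y
    have := h'.1 y'
    rw [Function.comp_apply, ← hy, hg1']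
    exact ext_of_generating hgen hpi fun i => (congrFun hy i).symm

end Uniqueness

section Existence

open ProbabilityTheory

variable [StandardBorelSpace X] [Nonempty X] [Countable ι] {μ : Measure X} [IsProbabilityMeasure μ]

theorem setLIntegral_condDistrib_id {Ω : Type*} [MeasurableSpace Ω] {Φ : X → Ω}
    (hΦ : Measurable Φ) {E : Set Ω} (hE : MeasurableSet E) (hA : MeasurableSet A)
    {g : X → ℝ≥0∞} (hg : Measurable g) :
    ∫⁻ s in E, ∫⁻ x in A, g x ∂(condDistrib id Φ μ s) ∂(μ.map Φ) =
      ∫⁻ x in Φ ⁻¹' E ∩ A, g x ∂μ := by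
  have h := Measure.setLIntegral_compProd (μ := μ.map Φ) (κ := condDistrib id Φ μ)
    (hg.comp measurable_snd) hE hA
  rw [compProd_map_condDistrib measurable_id.aemeasurable,
    setLIntegral_map (hE.prod hA) (hg.comp measurable_snd) (hΦ.prodMk measurable_id)] at h
  exact h.symm

theorem setLIntegral_condDistrib_id_apply {Ω : Type*} [MeasurableSpace Ω] {Φ : X → Ω}
    (hΦ : Measurable Φ) {E : Set Ω} (hE : MeasurableSet E) (hA : MeasurableSet A) :
    ∫⁻ s in E, condDistrib id Φ μ s A ∂(μ.map Φ) = μ (Φ ⁻¹' E ∩ A) := by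
  simpa using setLIntegral_condDistrib_id hΦ hE hA (measurable_const (a := (1 : ℝ≥0∞)))

theorem ae_ae_condDistrib_id {Ω : Type*} [MeasurableSpace Ω] {Φ : X → Ω} (hΦ : Measurable Φ)
    {p : Ω → X → Prop} (hp : MeasurableSet {z : Ω × X | p z.1 z.2}) (h : ∀ᵐ x ∂μ, p (Φ x) x) :
    ∀ᵐ s ∂(μ.map Φ), ∀ᵐ x ∂(condDistrib id Φ μ s), p s x := by
  refine Measure.ae_ae_of_ae_compProd (p := fun z => p z.1 z.2) ?_
  rw [compProd_map_condDistrib measurable_id.aemeasurable]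
  exact (ae_map_iff (hΦ.prodMk measurable_id).aemeasurable hp).2 h

theorem ae_condDistrib_ratioMap_apply (hm : HasRecurrentCocycle T ω μ) (hω : Measurable ω)
    (hS : ∀ i, MeasurableSet (S i)) :
    ∀ᵐ s ∂(μ.map (ratioMap ω T S)),
      ∀ i, condDistrib id (ratioMap ω T S) μ s (S i) = s i := by
  have hΦ : Measurable (ratioMap ω T S) := measurable_ratioMap hω hS
  have hinv := ratioMap_comp_ae_eq (S := S) hm hω
  refine ae_all_iff.2 fun i => ae_eq_of_forall_setLIntegral_eq_of_sigmaFinite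
    (Kernel.measurable_coe _ (hS i)) (measurable_pi_apply i) fun E hE _ => ?_
  rw [setLIntegral_condDistrib_id_apply hΦ hE (hS i), inter_comm,
    setLIntegral_map hE (measurable_pi_apply i) hΦ,
    ← hm.setLIntegral_ratioLimsup hω (hS i) (hΦ hE)]
  · rfl
  · filter_upwards [hinv] with x hx
    exact congrArg (· ∈ E) hx

theorem ae_condDistrib_map_symm (hm : HasRecurrentCocycle T ω μ) (hω : Measurable ω)
    (hgen : ‹MeasurableSpace X› = .generateFrom (range S)) (hpi : IsPiSystem (range S)) :
    ∀ᵐ s ∂(μ.map (ratioMap ω T S)),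
      (condDistrib id (ratioMap ω T S) μ s).map T.symm =
        (condDistrib id (ratioMap ω T S) μ s).withDensity ω := by
  have hS := measurableSet_of_generating hgen
  have hΦ : Measurable (ratioMap ω T S) := measurable_ratioMap hω hS
  have hinv := ratioMap_comp_ae_eq (S := S) hm hω
  have key : ∀ A : Set X, MeasurableSet A → ∀ᵐ s ∂(μ.map (ratioMap ω T S)),
      condDistrib id (ratioMap ω T S) μ s (T.symm ⁻¹' A) =
        ∫⁻ x in A, ω x ∂(condDistrib id (ratioMap ω T S) μ s) := by
    intro A hA
    refine ae_eq_of_forall_setLIntegral_eq_of_sigmaFinite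
      (Kernel.measurable_coe _ (T.symm.measurable hA)) (hω.setLIntegral_kernel hA) fun E hE _ => ?_
    rw [setLIntegral_condDistrib_id_apply hΦ hE (T.symm.measurable hA),
      setLIntegral_condDistrib_id hΦ hE hA hω,
      ← measure_preimage_symm hm.map_symm ((hΦ hE).inter hA), preimage_inter]
    refine measure_congr (EventuallyEq.inter ?_ EventuallyEq.rfl)
    filter_upwards [hm.quasiMeasurePreserving_symm.ae hinv] with x hx
    have hx' : ratioMap ω T S x = ratioMap ω T S (T.symm x) := by simpa using hx
    exact congrArg (· ∈ E) hx'
  filter_upwards [ae_all_iff.2 fun i => key (S i) (hS i), key univ MeasurableSet.univ] with s hs hu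
  refine ext_of_generate_finite (range S) hgen hpi ?_ ?_
  · rintro _ ⟨i, rfl⟩
    rw [Measure.map_apply T.symm.measurable (hS i), withDensity_apply _ (hS i), hs i]
  · rw [Measure.map_apply T.symm.measurable MeasurableSet.univ,
      withDensity_apply _ MeasurableSet.univ, hu]

theorem ae_condDistrib_hasRecurrentCocycle (hm : HasRecurrentCocycle T ω μ) (hω : Measurable ω)
    (hgen : ‹MeasurableSpace X› = .generateFrom (range S)) (hpi : IsPiSystem (range S)) :
    ∀ᵐ s ∂(μ.map (ratioMap ω T S)),
      HasRecurrentCocycle T ω (condDistrib id (ratioMap ω T S) μ s) := by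
  have hΦ : Measurable (ratioMap ω T S) := measurable_ratioMap hω (measurableSet_of_generating hgen)
  have hsum : Measurable fun x => ∑' n, cocycleWeight ω T n x :=
    Measurable.tsum fun n => measurable_cocycleWeight hω T.measurable n
  filter_upwards [ae_condDistrib_map_symm hm hω hgen hpi,
    ae_ae_condDistrib_id hΦ (p := fun _ x => ω x ≠ 0)
      ((hω.comp measurable_snd) (measurableSet_singleton 0)).compl hm.ne_zero,
    ae_ae_condDistrib_id hΦ (p := fun _ x => ∑' n, cocycleWeight ω T n x = ∞)
      ((hsum.comp measurable_snd) (measurableSet_singleton ∞)) hm.tsum_eq_top] with s h1 h2 h3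
  exact ⟨h1, h2, h3⟩

theorem exists_isErgodicDecomposition (hns : QuasiInvariant' μ T) (hcons : Conservative' μ T) :
    ∃ (Y : Type) (_ : MeasurableSpace Y) (ν : Measure Y) (μs : Y → Measure X),
      StandardBorelSpace Y ∧ IsProbabilityMeasure ν ∧ IsErgodicDecomposition μ T ν μs := by
  obtain ⟨S, hgen, hpi⟩ := exists_countable_generating_piSystem X
  have hS := measurableSet_of_generating hgen
  set ω := (μ.map T.symm).rnDeriv μ
  have hω : Measurable ω := Measure.measurable_rnDeriv _ _
  have hm : HasRecurrentCocycle T ω μ :=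
    .of_conservative hns hcons (map_symm_eq_withDensity hns EventuallyEq.rfl) hω
  have hΦ : Measurable (ratioMap ω T S) := measurable_ratioMap hω hS
  set κ := condDistrib id (ratioMap ω T S) μ
  set ρ := μ.map (ratioMap ω T S)
  have : IsProbabilityMeasure ρ := Measure.isProbabilityMeasure_map hΦ.aemeasurable
  have hgood : ∀ᵐ s ∂ρ, HasRecurrentCocycle T ω (κ s) ∧ (∀ i, κ s (S i) = s i) ∧
      ∀ᵐ x ∂(κ s), ratioMap ω T S x = s := by
    filter_upwards [ae_condDistrib_hasRecurrentCocycle hm hω hgen hpi,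
      ae_condDistrib_ratioMap_apply hm hω hS,
      ae_ae_condDistrib_id hΦ (μ := μ) (p := fun s x => ratioMap ω T S x = s)
        (measurableSet_eq_fun (hΦ.comp measurable_snd) measurable_fst)
        (Eventually.of_forall fun _ => rfl)] with s h1 h2 h3
    exact ⟨h1, h2, h3⟩
  obtain ⟨N, hN, hNm, hN0⟩ := exists_measurable_superset_of_null (ae_iff.1 hgood)
  set G := Nᶜ
  have hG : MeasurableSet G := hNm.compl
  have hGsub : ∀ s ∈ G, HasRecurrentCocycle T ω (κ s) ∧ (∀ i, κ s (S i) = s i) ∧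
      ∀ᵐ x ∂(κ s), ratioMap ω T S x = s := fun s hs => not_not.1 fun h => hs (hN h)
  have hG1 : ∀ᵐ s ∂ρ, s ∈ G := measure_eq_zero_iff_ae_notMem.1 hN0
  have hGres : ρ.restrict G = ρ := Measure.restrict_eq_self_of_ae_mem hG1
  refine ⟨G, inferInstance, ρ.comap Subtype.val, fun s => κ s, hG.standardBorel, ⟨?_⟩,
    fun s => inferInstance, fun A hA => (κ.measurable_coe hA).comp measurable_subtype_coe,
    fun A hA => ?_, fun s s' hss' => ?_, fun s => ?_, fun s => ?_⟩
  · rw [(MeasurableEmbedding.subtype_coe hG).comap_apply, image_univ, Subtype.range_coe,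
      ← prob_compl_eq_zero_iff hG]
    exact hG1
  · rw [lintegral_subtype_comap hG fun s => κ s A, hGres, ← setLIntegral_univ,
      setLIntegral_condDistrib_id_apply hΦ MeasurableSet.univ hA]
    simp
  · refine Measure.MutuallySingular.mk (s := {x | ratioMap ω T S x ≠ s})
      (t := {x | ratioMap ω T S x ≠ s'}) (hGsub s s.2).2.2 (hGsub s' s'.2).2.2 fun x _ => ?_
    by_contra hx
    simp only [mem_union, mem_ofPred_eq, not_or, not_not] at hx
    exact hss' (Subtype.ext (hx.1.symm.trans hx.2))
  · obtain ⟨h1, h2, h3⟩ := hGsub s s.2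
    refine ⟨fun N hN => h1.preimage_eq_zero_iff hω hN, h1.conservative' hω,
      h1.ergodic' hω hgen hpi fun i => ?_⟩
    filter_upwards [h3] with x hx
    rw [h2 i, ← hx]
    rfl
  · rw [(hGsub s s.2).1.map_symm]
    exact (Measure.rnDeriv_withDensity _ hω).symm

end Existence

end ErgodicDecomposition

/-- **Ergodic decomposition theorem.** A conservative nonsingular transformation `T` of a
standard probability space `(X, ℬ, μ)` admits an ergodic decomposition
`(Y, 𝒜, ν), (μ_y)_{y ∈ Y}` satisfying (i)–(iv), and the decomposition is unique up to a
measure-preserving isomorphism (mod 0) of the base spaces. -/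
theorem stmt_9 {X : Type*} [MeasurableSpace X] [StandardBorelSpace X]
    (μ : Measure X) [IsProbabilityMeasure μ] (T : X ≃ᵐ X)
    (hns : QuasiInvariant' μ ⇑T) (hcons : Conservative' μ ⇑T) :
    ∃ (Y : Type) (mY : MeasurableSpace Y) (ν : @Measure Y mY) (μs : Y → Measure X),
      @StandardBorelSpace Y mY ∧ @IsProbabilityMeasure Y mY ν ∧
      @IsErgodicDecomposition X _ μ T Y mY ν μs ∧
      ∀ (Y' : Type) [MeasurableSpace Y'] [StandardBorelSpace Y']
        (ν' : Measure Y') [IsProbabilityMeasure ν'] (μs' : Y' → Measure X),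
        IsErgodicDecomposition μ T ν' μs' →
          ∃ (θ : Y → Y') (θ' : Y' → Y),
            @Measurable Y Y' mY _ θ ∧ Measurable θ' ∧
            @Measure.map Y Y' mY _ θ ν = ν' ∧
            (∀ᵐ y ∂ν, θ' (θ y) = y) ∧ (∀ᵐ y' ∂ν', θ (θ' y') = y') ∧
            (∀ᵐ y ∂ν, μs y = μs' (θ y)) := by
  have : Nonempty X := μ.nonempty_of_neZero
  obtain ⟨Y, mY, ν, μs, hY, hν, h⟩ := ErgodicDecomposition.exists_isErgodicDecomposition hns hcons
  exact ⟨Y, mY, ν, μs, hY, hν, h, fun Y' _ _ ν' _ μs' h' =>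
    ErgodicDecomposition.exists_isomorphism_of_isErgodicDecomposition h h'⟩
end

section
/- (Shelah–Weiss) Let T be an aperiodic Borel bijection of a standard Borel space X and let 𝓜(T) denote the set of all non-atomic T-nonsingular ergodic probability measures on X. Then a Borel set B ⊆ X satisfies μ(B) = 0 for every μ ∈ 𝓜(T) if and only if B can be covered by countably many Borel T-wandering sets. -/
open MeasureTheory Set Filter ENNReal

/-- `W` is a *wandering* set for `T`. -/
def Wandering' {X : Type*} (T : X → X) (W : Set X) : Prop :=
  ∀ i j : ℕ, i ≠ j → T^[i] ⁻¹' W ∩ T^[j] ⁻¹' W = ∅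

namespace ShelahWeiss

open TopologicalSpace Function Topology

variable {X : Type*} [MeasurableSpace X]

/-- `B` belongs to the σ-ideal generated by the Borel wandering sets of `T`. -/
def CountablyWandering (T : X → X) (B : Set X) : Prop :=
  ∃ W : ℕ → Set X, (∀ n, MeasurableSet (W n) ∧ Wandering' T (W n)) ∧ B ⊆ ⋃ n, W n

lemma CountablyWandering.mono {T : X → X} {A B : Set X} (hB : CountablyWandering T B)
    (h : A ⊆ B) : CountablyWandering T A := by
  obtain ⟨W, hW, hBW⟩ := hB
  exact ⟨W, hW, h.trans hBW⟩

lemma CountablyWandering.of_wandering {T : X → X} {W : Set X} (hm : MeasurableSet W)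
    (hW : Wandering' T W) : CountablyWandering T W :=
  ⟨fun _ ↦ W, fun _ ↦ ⟨hm, hW⟩, (iUnion_const W).ge⟩

lemma CountablyWandering.iUnion {ι : Type*} [Countable ι] [Nonempty ι] {T : X → X} {B : ι → Set X}
    (hB : ∀ i, CountablyWandering T (B i)) : CountablyWandering T (⋃ i, B i) := by
  choose W hW hBW using hB
  obtain ⟨f, hf⟩ := exists_surjective_nat (ι × ℕ)
  refine ⟨fun n ↦ W (f n).1 (f n).2, fun n ↦ hW _ _, iUnion_subset fun i x hx ↦ ?_⟩
  obtain ⟨m, hm⟩ := mem_iUnion.1 (hBW i hx)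
  obtain ⟨n, hn⟩ := hf (i, m)
  exact mem_iUnion.2 ⟨n, by simpa [hn] using hm⟩

lemma CountablyWandering.union {T : X → X} {A B : Set X} (hA : CountablyWandering T A)
    (hB : CountablyWandering T B) : CountablyWandering T (A ∪ B) := by
  rw [union_eq_iUnion]
  exact .iUnion (Bool.forall_bool.2 ⟨hB, hA⟩)

lemma countablyWandering_empty (T : X → X) : CountablyWandering T ∅ :=
  .of_wandering .empty fun i j _ ↦ by simp

/-- A Borel set outside the σ-ideal is recurrent: it meets one of its translates in a set that is
again outside the σ-ideal. -/
lemma exists_inter_preimage_not_countablyWandering (T : X ≃ᵐ X) {U : Set X}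
    (hU : MeasurableSet U) (h : ¬ CountablyWandering T U) :
    ∃ n, 0 < n ∧ ¬ CountablyWandering T (U ∩ T.symm^[n] ⁻¹' U) := by
  by_contra! hc
  have hm (n : ℕ) : MeasurableSet (T.symm^[n] ⁻¹' U) := T.symm.measurable.iterate n hU
  set W := U \ ⋃ n : ℕ, T.symm^[n + 1] ⁻¹' U
  have key : ∀ i j : ℕ, i < j → T^[i] ⁻¹' W ∩ T^[j] ⁻¹' W = ∅ := by
    rintro i j hij
    refine eq_empty_of_forall_notMem fun x ⟨hi, hj⟩ ↦ hj.2 (mem_iUnion.2 ⟨j - i - 1, ?_⟩)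
    have e : j = (j - i) + i := by omega
    have : j - i - 1 + 1 = j - i := by omega
    rw [this, mem_preimage, e, iterate_add_apply, Nat.add_sub_cancel,
      LeftInverse.iterate T.symm_apply_apply (j - i)]
    exact hi.1
  have hW : CountablyWandering T W := by
    refine .of_wandering (hU.diff (.iUnion fun n ↦ hm _)) fun i j hij ↦ ?_
    rcases hij.lt_or_gt with h | h
    · exact key i j h
    · rw [inter_comm]; exact key j i h
  refine h ((hW.union (.iUnion fun n : ℕ ↦ hc (n + 1) n.succ_pos)).mono fun x hx ↦ ?_)
  by_cases hx' : x ∈ ⋃ n : ℕ, T.symm^[n + 1] ⁻¹' U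
  · right
    obtain ⟨n, hn⟩ := mem_iUnion.1 hx'
    exact mem_iUnion.2 ⟨n, hx, hn⟩
  · exact Or.inl ⟨hx, hx'⟩

/-- A family of neighbourhoods of the points of a set outside the σ-ideal has a member outside the
σ-ideal. -/
lemma exists_nhds_not_countablyWandering [TopologicalSpace X] [SecondCountableTopology X]
    {T : X → X} {U : Set X} (h : ¬ CountablyWandering T U) {V : X → Set X}
    (hV : ∀ x ∈ U, V x ∈ 𝓝 x) : ∃ x ∈ U, ¬ CountablyWandering T (V x) := by
  by_contra! hc
  obtain ⟨t, htU, htc, ht⟩ := TopologicalSpace.countable_cover_nhdsWithin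
    (f := V) (s := U) fun x hx ↦ mem_nhdsWithin_of_mem_nhds (hV x hx)
  rcases t.eq_empty_or_nonempty with rfl | hne
  · exact h ((countablyWandering_empty T).mono (by simpa using ht))
  have := htc.to_subtype
  have := hne.to_subtype
  refine h ((CountablyWandering.iUnion fun x : t ↦ hc x (htU x.2)).mono (ht.trans ?_))
  rw [biUnion_eq_iUnion]

/-- A Borel automorphism is a homeomorphism for a suitable Polish topology, in which moreover a
given Borel set is open. -/
lemma exists_polishSpace_continuous [StandardBorelSpace X] (T : X ≃ᵐ X) {B : Set X}
    (hB : MeasurableSet B) :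
    ∃ _ : TopologicalSpace X, PolishSpace X ∧ BorelSpace X ∧ Continuous T ∧
      Continuous T.symm ∧ IsOpen B := by
  have step (t : {t : TopologicalSpace X // PolishSpace X ∧ BorelSpace X}) :
      ∃ t' : {t : TopologicalSpace X // PolishSpace X ∧ BorelSpace X}, t'.1 ≤ t.1 ∧
        Continuous[t'.1, t.1] T ∧ Continuous[t'.1, t.1] T.symm := by
    obtain ⟨_, hp, hb⟩ := t
    obtain ⟨t', hle, hc, hp'⟩ := (T.measurable.prodMk T.symm.measurable).exists_continuous
    refine ⟨⟨t', hp', ⟨?_⟩⟩, hle, ?_, ?_⟩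
    · rw [hb.measurable_eq, borel_eq_borel_of_le hp' hp hle]
    · exact @Continuous.fst X X X t' (_) (_) _ hc
    · exact @Continuous.snd X X X t' (_) (_) _ hc
  choose next hle hT hTs using step
  obtain ⟨t₀, hb₀, hp₀, -, ho₀⟩ := hB.isClopenable'
  let t : ℕ → {t : TopologicalSpace X // PolishSpace X ∧ BorelSpace X} :=
    fun n ↦ Nat.rec ⟨t₀, hp₀, hb₀⟩ (fun _ s ↦ next s) n
  have hanti : ∀ n, (t n).1 ≤ t₀ := fun n ↦ by
    induction n with
    | zero => exact le_rfl
    | succ n ih => exact (hle (t n)).trans ih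
  have hp : @PolishSpace X (⨅ n, (t n).1) := .iInf ⟨0, hanti⟩ fun n ↦ (t n).2.1
  have hinf : (⨅ n, (t n).1) ≤ t₀ := iInf_le (fun n ↦ (t n).1) 0
  refine ⟨⨅ n, (t n).1, hp, ?_, ?_, ?_, hinf _ ho₀⟩
  · exact @BorelSpace.mk X (⨅ n, (t n).1) _ (hb₀.measurable_eq.trans
      (borel_eq_borel_of_le hp hp₀ hinf).symm)
  · exact continuous_iInf_rng.2 fun n ↦ continuous_iInf_dom (i := n + 1) (hT (t n))
  · exact continuous_iInf_rng.2 fun n ↦ continuous_iInf_dom (i := n + 1) (hTs (t n))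

lemma exists_shrink [MetricSpace X] [SecondCountableTopology X] [BorelSpace X] (T : X ≃ᵐ X)
    (hap : ∀ x : X, ∀ n : ℕ, 0 < n → T^[n] x ≠ x) (hT : Continuous T) (hTs : Continuous T.symm)
    {U : Set X} (hU : IsOpen U) (h : ¬ CountablyWandering T U) (N : ℕ) {ε : ℝ≥0∞} (hε : 0 < ε) :
    ∃ (n : ℕ) (V : Set X), IsOpen V ∧ ¬ CountablyWandering T V ∧ closure V ⊆ U ∧
      closure V ⊆ T.symm^[n] ⁻¹' U ∧ Disjoint V (T^[n] ⁻¹' V) ∧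
      ∀ m ≤ N + n, Metric.ediam (T^[m] ⁻¹' V) ≤ ε := by
  obtain ⟨n, hn, hpos⟩ := exists_inter_preimage_not_countablyWandering T hU.measurableSet h
  have key (x : X) (hx : x ∈ U ∩ T.symm^[n] ⁻¹' U) : ∃ V : Set X, x ∈ V ∧ IsOpen V ∧
      closure V ⊆ U ∩ T.symm^[n] ⁻¹' U ∧ Disjoint V (T^[n] ⁻¹' V) ∧
      ∀ m ≤ N + n, Metric.ediam (T^[m] ⁻¹' V) ≤ ε := by
    obtain ⟨C, hC, hCc, hCU⟩ := exists_mem_nhds_isClosed_subset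
      ((hU.inter (hU.preimage (hTs.iterate n))).mem_nhds hx)
    obtain ⟨P, Q, hP, hQ, hxP, hxQ, hPQ⟩ := t2_separation (hap x n hn).symm
    have hB (m : ℕ) : T.symm^[m] ⁻¹' Metric.eball (T.symm^[m] x) (ε / 2) ∈ 𝓝 x :=
      (hTs.iterate m).continuousAt.preimage_mem_nhds
        (Metric.eball_mem_nhds _ (by simpa using hε.ne'))
    have hnhds : (C ∩ (P ∩ T^[n] ⁻¹' Q)) ∩ (⋂ m ∈ Iic (N + n),
        T.symm^[m] ⁻¹' Metric.eball (T.symm^[m] x) (ε / 2)) ∈ 𝓝 x :=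
      inter_mem (inter_mem hC (inter_mem (hP.mem_nhds hxP)
        ((hQ.preimage (hT.iterate n)).mem_nhds hxQ)))
        ((biInter_mem (finite_Iic _)).2 fun m _ ↦ hB m)
    obtain ⟨V, hV, hVo, hxV⟩ := mem_nhds_iff.1 hnhds
    refine ⟨V, hxV, hVo, (closure_minimal (fun y hy ↦ (hV hy).1.1) hCc).trans hCU, ?_,
      fun m hm ↦ ?_⟩
    · rw [Set.disjoint_left]
      exact fun y hy hy' ↦ Set.disjoint_left.1 hPQ (hV hy').1.2.1 (hV hy).1.2.2
    · have hsub : T^[m] ⁻¹' V ⊆ Metric.eball (T.symm^[m] x) (ε / 2) := fun y hy ↦ by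
        have := mem_iInter₂.1 (hV hy).2 m hm
        rwa [mem_preimage, LeftInverse.iterate T.symm_apply_apply m] at this
      calc Metric.ediam (T^[m] ⁻¹' V) ≤ Metric.ediam (Metric.eball (T.symm^[m] x) (ε / 2)) :=
            Metric.ediam_mono hsub
        _ ≤ 2 * (ε / 2) := Metric.ediam_eball_le
        _ = ε := ENNReal.mul_div_cancel (by simp) (by simp)
  choose! V hxV hVo hVU hVd hVm using key
  obtain ⟨x, hx, hxpos⟩ := exists_nhds_not_countablyWandering hpos (V := V)
    fun x hx ↦ (hVo x hx).mem_nhds (hxV x hx)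
  exact ⟨n, V x, hVo x hx, hxpos, (hVU x hx).trans inter_subset_left,
    (hVU x hx).trans inter_subset_right, hVd x hx, hVm x hx⟩

lemma exists_shrinking_sequence [MetricSpace X] [SecondCountableTopology X] [BorelSpace X]
    (T : X ≃ᵐ X) (hap : ∀ x : X, ∀ n : ℕ, 0 < n → T^[n] x ≠ x) (hT : Continuous T)
    (hTs : Continuous T.symm) {B : Set X} (hB : IsOpen B) (h : ¬ CountablyWandering T B) :
    ∃ (U : ℕ → Set X) (n : ℕ → ℕ), U 0 = B ∧ ∀ k, (U k).Nonempty ∧ closure (U (k + 1)) ⊆ U k ∧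
      closure (U (k + 1)) ⊆ T.symm^[n k] ⁻¹' U k ∧ Disjoint (U (k + 1)) (T^[n k] ⁻¹' U (k + 1)) ∧
      ∀ m ≤ ∑ i ∈ Finset.range (k + 1), n i, Metric.ediam (T^[m] ⁻¹' U (k + 1)) ≤ (k : ℝ≥0∞)⁻¹ := by
  have step (k N : ℕ) (U : {U : Set X // IsOpen U ∧ ¬ CountablyWandering T U}) :=
    exists_shrink T hap hT hTs U.2.1 U.2.2 N (ε := (k : ℝ≥0∞)⁻¹) (by simp)
  choose n V hVo hVpos hVU hVn hVd hVm using step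
  let s : ℕ → {U : Set X // IsOpen U ∧ ¬ CountablyWandering T U} × ℕ := fun k ↦
    Nat.rec (⟨B, hB, h⟩, 0)
      (fun k p ↦ (⟨V k p.2 p.1, hVo k p.2 p.1, hVpos k p.2 p.1⟩, p.2 + n k p.2 p.1)) k
  have hs (k : ℕ) : (s k).2 = ∑ i ∈ Finset.range k, n i (s i).2 (s i).1 := by
    induction k with
    | zero => rfl
    | succ k ih => rw [Finset.sum_range_succ, ← ih]
  refine ⟨fun k ↦ (s k).1, fun k ↦ n k (s k).2 (s k).1, rfl, fun k ↦ ⟨?_, hVU k (s k).2 (s k).1,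
    hVn k (s k).2 (s k).1, hVd k (s k).2 (s k).1, fun m hm ↦ hVm k (s k).2 (s k).1 m ?_⟩⟩
  · by_contra hne
    exact (s k).1.2.2 ((countablyWandering_empty T).mono (Set.not_nonempty_iff_eq_empty.1 hne).le)
  · rwa [Finset.sum_range_succ, ← hs] at hm

/-- The total translation along a finite binary word, stored with its last letter first. -/
def shift (n : ℕ → ℕ) : List Bool → ℕ
  | [] => 0
  | a :: l => shift n l + bif a then n l.length else 0

lemma shift_le (n : ℕ → ℕ) (l : List Bool) : shift n l ≤ ∑ i ∈ Finset.range l.length, n i := by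
  induction l with
  | nil => simp [shift]
  | cons a l ih =>
    rw [List.length_cons, Finset.sum_range_succ, shift]
    cases a <;> simp <;> omega

/-- The translations along two branches that agree from some point on differ by a constant. -/
lemma exists_shift_res_eq (n : ℕ → ℕ) {α β : ℕ → Bool} {K : ℕ} (h : ∀ k ≥ K, α k = β k) :
    ∃ a b : ℕ, ∀ k ≥ K, ∃ c, shift n (PiNat.res α k) = c + a ∧ shift n (PiNat.res β k) = c + b := by
  refine ⟨shift n (PiNat.res α K), shift n (PiNat.res β K), fun k hk ↦ ?_⟩
  induction k, hk using Nat.le_induction with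
  | base => exact ⟨0, by simp⟩
  | succ k hk ih =>
    obtain ⟨c, h₁, h₂⟩ := ih
    refine ⟨c + bif α k then n k else 0, ?_, ?_⟩ <;>
      simp only [PiNat.res_succ, shift, PiNat.res_length, h₁, h₂, h k hk] <;> omega

/-- **Glimm–Effros embedding.** Outside the σ-ideal generated by wandering sets there is a copy of
the Cantor space on which tail equivalent points lie in the same orbit. -/
lemma exists_cantor_embedding [StandardBorelSpace X] (T : X ≃ᵐ X)
    (hap : ∀ x : X, ∀ n : ℕ, 0 < n → T^[n] x ≠ x) {B : Set X} (hB : MeasurableSet B)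
    (h : ¬ CountablyWandering T B) :
    ∃ φ : (ℕ → Bool) → X, Measurable φ ∧ Injective φ ∧ (∀ α, φ α ∈ B) ∧
      ∀ α β : ℕ → Bool, (∃ K, ∀ k ≥ K, α k = β k) → ∃ a b : ℕ, T^[a] (φ α) = T^[b] (φ β) := by
  obtain ⟨t, hp, hb, hT, hTs, hBo⟩ := exists_polishSpace_continuous T hB
  let _ := TopologicalSpace.upgradeIsCompletelyMetrizable X
  obtain ⟨U, n, hU0, hU⟩ := exists_shrinking_sequence T hap hT hTs hBo h
  choose hne hcl hcln hdisj hdiam using hU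
  let A : List Bool → Set X := fun l ↦ T^[shift n l] ⁻¹' U l.length
  have hA_anti : CantorScheme.ClosureAntitone A := fun l a x hx ↦ by
    have hx' : T^[shift n (a :: l)] x ∈ closure (U (l.length + 1)) :=
      (hT.iterate _).closure_preimage_subset _ hx
    cases a with
    | false => exact hcl _ hx'
    | true =>
      have := hcln _ hx'
      simp only [shift, cond_true] at this
      rw [Nat.add_comm, iterate_add_apply, mem_preimage,
        LeftInverse.iterate T.symm_apply_apply] at this
      exact this
  have hA_disj : CantorScheme.Disjoint A := by
    have key (l : List Bool) : Disjoint (A (false :: l)) (A (true :: l)) := by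
      rw [Set.disjoint_left]
      intro x hx hx'
      refine Set.disjoint_left.1 (hdisj l.length) hx ?_
      rw [mem_preimage, shift, ← iterate_add_apply]
      have : T^[shift n l + n l.length] x ∈ U (l.length + 1) := hx'
      simpa [Nat.add_comm] using this
    intro l a b hab
    cases a <;> cases b
    · exact absurd rfl hab
    · exact key l
    · exact (key l).symm
    · exact absurd rfl hab
  have hA_diam : CantorScheme.VanishingDiam A := fun α ↦ by
    rw [← tendsto_add_atTop_iff_nat 1]
    refine tendsto_of_tendsto_of_tendsto_of_le_of_le tendsto_const_nhds
      ENNReal.tendsto_inv_nat_nhds_zero (fun _ ↦ zero_le) fun k ↦ ?_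
    have hs := shift_le n (PiNat.res α (k + 1))
    have := hdiam k _ (by simpa only [PiNat.res_length] using hs)
    simpa only [A, PiNat.res_length] using this
  have hA_ne (l : List Bool) : (A l).Nonempty := by
    obtain ⟨x, hx⟩ := hne l.length
    exact ⟨T.symm^[shift n l] x, by
      rwa [mem_preimage, LeftInverse.iterate T.apply_symm_apply]⟩
  have hA_univ := hA_anti.map_of_vanishingDiam hA_diam hA_ne
  have hdom (α : ℕ → Bool) : α ∈ (CantorScheme.inducedMap A).1 := hA_univ ▸ mem_univ α
  let φ : (ℕ → Bool) → X := fun α ↦ (CantorScheme.inducedMap A).2 ⟨α, hdom α⟩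
  have hφ (α : ℕ → Bool) (k : ℕ) : φ α ∈ A (PiNat.res α k) := CantorScheme.map_mem ⟨α, hdom α⟩ k
  refine ⟨φ, ?_, ?_, fun α ↦ by simpa [A, shift, hU0] using hφ α 0, ?_⟩
  · exact (hA_diam.map_continuous.comp (continuous_id.subtype_mk hdom)).measurable
  · exact fun α β hαβ ↦ congrArg Subtype.val (hA_disj.map_injective hαβ)
  · rintro α β ⟨K, hK⟩
    obtain ⟨a, b, hab⟩ := exists_shift_res_eq n hK
    refine ⟨a, b, ?_⟩
    set z := T.symm^[b] (T^[a] (φ α)) with hz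
    have hTz : T^[b] z = T^[a] (φ α) := LeftInverse.iterate T.apply_symm_apply b _
    have hzA (k : ℕ) (hk : K ≤ k) : z ∈ A (PiNat.res β k) := by
      obtain ⟨c, h₁, h₂⟩ := hab k hk
      have := hφ α k
      simp only [A, mem_preimage, PiNat.res_length, h₁, h₂, iterate_add_apply, hTz] at this ⊢
      exact this
    have hzβ : z = φ β := by
      refine edist_le_zero.1 (ge_of_tendsto (hA_diam β) ?_)
      filter_upwards [eventually_ge_atTop K] with k hk
      exact Metric.edist_le_ediam_of_mem (hzA k hk) (hφ β k)
    rw [← hTz, hzβ]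

/-- **Coin tossing.** A non-atomic probability measure on the Cantor space satisfying a zero-one law
for tail events. -/
lemma exists_measure_cantor_zero_one :
    ∃ ν : Measure (ℕ → Bool), IsProbabilityMeasure ν ∧ (∀ α, ν {α} = 0) ∧
      ∀ E : Set (ℕ → Bool), MeasurableSet E →
        (∀ α β : ℕ → Bool, (∃ K, ∀ k ≥ K, α k = β k) → α ∈ E → β ∈ E) → ν E = 0 ∨ ν E = 1 := by
  let P : Measure Bool := (PMF.uniformOfFintype Bool).toMeasure
  have hP (b : Bool) : P {b} = 2⁻¹ := by
    simp [P]
  refine ⟨Measure.infinitePi fun _ ↦ P, inferInstance, fun α ↦ ?_, fun E hE hEtail ↦ ?_⟩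
  · have hle (n : ℕ) : Measure.infinitePi (fun _ : ℕ ↦ P) {α} ≤ 2⁻¹ ^ n := by
      calc _ ≤ Measure.infinitePi (fun _ : ℕ ↦ P)
            (Set.pi (Finset.range n) fun i ↦ {α i}) := measure_mono (by simp)
        _ = 2⁻¹ ^ n := by
          rw [Measure.infinitePi_pi _ fun _ _ ↦ measurableSet_singleton _]
          simp [hP]
    exact le_bot_iff.1 (ge_of_tendsto'
      (ENNReal.tendsto_pow_atTop_nhds_zero_of_lt_one (by simp)) hle)
  · have hind := ProbabilityTheory.iIndepFun_infinitePi (P := fun _ : ℕ ↦ P)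
      (X := fun _ ω ↦ ω) fun _ ↦ measurable_id
    rw [ProbabilityTheory.iIndepFun_iff_iIndep] at hind
    refine ProbabilityTheory.measure_zero_or_one_of_measurableSet_limsup_atTop
      (fun n ↦ (measurable_pi_apply n).comap_le) hind ?_
    rw [limsup_eq_iInf_iSup_of_nat, MeasurableSpace.measurableSet_iInf]
    intro K
    let g : (ℕ → Bool) → ℕ → Bool := fun α k ↦ if K ≤ k then α k else false
    have hEg : E = g ⁻¹' E := by
      ext α
      exact ⟨hEtail α (g α) ⟨K, fun k hk ↦ (if_pos hk).symm⟩,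
        hEtail (g α) α ⟨K, fun k hk ↦ if_pos hk⟩⟩
    rw [hEg]
    have hg : Measurable[⨆ i ≥ K, MeasurableSpace.comap (fun ω : ℕ → Bool ↦ ω i) ⊤] g := by
      refine @measurable_pi_lambda _ _ _ (_) _ g fun k ↦ ?_
      by_cases hk : K ≤ k
      · simp only [g, hk, if_true]
        exact (comap_measurable _).mono (le_iSup₂_of_le k hk le_rfl) le_rfl
      · simp only [g, hk, if_false]
        exact measurable_const
    exact hg hE

lemma measurable_zpow (T : X ≃ᵐ X) (n : ℤ) : Measurable ⇑((T : Equiv.Perm X) ^ n) := by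
  cases n with
  | ofNat n =>
    rw [Int.ofNat_eq_natCast, zpow_natCast, ← Equiv.Perm.iterate_eq_pow]
    exact T.measurable.iterate n
  | negSucc n =>
    rw [zpow_negSucc, ← inv_pow, ← Equiv.Perm.iterate_eq_pow]
    exact T.symm.measurable.iterate (n + 1)

lemma preimage_zpow_eq (T : X ≃ᵐ X) {A : Set X} (hA : T ⁻¹' A = A) (n : ℤ) :
    ⇑((T : Equiv.Perm X) ^ n) ⁻¹' A = A := by
  induction n using Int.induction_on with
  | zero => simp
  | succ n ih => rw [zpow_add_one, Equiv.Perm.coe_mul, preimage_comp, ih]; exact hA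
  | pred n ih =>
    rw [zpow_sub_one, Equiv.Perm.coe_mul, preimage_comp, ih]
    conv_lhs => rw [← hA]
    ext x
    exact iff_of_eq (congrArg (· ∈ A) (T.apply_symm_apply x))

/-- A probability measure giving every invariant Borel set measure zero or one generates a
nonsingular ergodic probability measure, by summing its translates. -/
lemma exists_quasiInvariant_ergodic (T : X ≃ᵐ X) (m : Measure X) [IsProbabilityMeasure m]
    [MeasurableSingletonClass X] (hm : ∀ x, m {x} = 0)
    (herg : ∀ A : Set X, MeasurableSet A → T ⁻¹' A = A → m A = 0 ∨ m Aᶜ = 0) :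
    ∃ μ : Measure X, IsProbabilityMeasure μ ∧ (∀ x, μ {x} = 0) ∧ QuasiInvariant' μ T ∧
      Ergodic' μ T ∧ m ≪ μ := by
  let e : ℤ → Equiv.Perm X := fun n ↦ (T : Equiv.Perm X) ^ n
  have he (n : ℤ) : Measurable (e n) := measurable_zpow T n
  let μ₀ : Measure X := .sum fun n ↦ m.map (e n)
  have hμ₀ {N : Set X} (hN : MeasurableSet N) : μ₀ N = 0 ↔ ∀ n, m (e n ⁻¹' N) = 0 := by
    rw [Measure.sum_apply_eq_zero]
    exact forall_congr' fun n ↦ by rw [Measure.map_apply (he n) hN]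
  have hac : m ≪ μ₀ := Measure.AbsolutelyContinuous.mk fun N hN h ↦ by
    simpa [e] using (hμ₀ hN).1 h 0
  have : NeZero μ₀ := ⟨fun h ↦ IsProbabilityMeasure.ne_zero m
    (Measure.absolutelyContinuous_zero_iff.1 (h ▸ hac))⟩
  refine ⟨μ₀.toFinite, inferInstance, fun x ↦ ?_, fun N hN ↦ ?_, fun A hA hTA ↦ ?_,
    hac.trans (absolutelyContinuous_toFinite μ₀)⟩
  · rw [toFinite_apply_eq_zero_iff, hμ₀ (measurableSet_singleton x)]
    intro n
    refine measure_mono_null (fun y hy ↦ ?_) (hm ((e n).symm x))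
    exact (Equiv.eq_symm_apply _).2 hy
  · rw [toFinite_apply_eq_zero_iff, toFinite_apply_eq_zero_iff, hμ₀ hN, hμ₀ (T.measurable hN)]
    have hpre (n : ℤ) : e n ⁻¹' (T ⁻¹' N) = e (n + 1) ⁻¹' N := by
      simp only [e, add_comm n 1, zpow_one_add]
      rfl
    simp only [hpre]
    exact ⟨fun h n ↦ by simpa using h (n - 1), fun h n ↦ h (n + 1)⟩
  · have hTA' : T ⁻¹' Aᶜ = Aᶜ := by rw [preimage_compl, hTA]
    rw [toFinite_apply_eq_zero_iff, toFinite_apply_eq_zero_iff, hμ₀ hA, hμ₀ hA.compl]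
    simp only [e, preimage_zpow_eq T hTA, preimage_zpow_eq T hTA', forall_const]
    exact herg A hA hTA

lemma measure_wandering_eq_zero [StandardBorelSpace X] (T : X ≃ᵐ X) {μ : Measure X}
    (hna : ∀ x, μ {x} = 0) (herg : Ergodic' μ T) {W : Set X} (hWm : MeasurableSet W)
    (hW : Wandering' T W) : μ W = 0 := by
  have hdisj (n : ℤ) {x : X} (hx : x ∈ W) (hnx : ((T : Equiv.Perm X) ^ n) x ∈ W) : n = 0 := by
    have key (n : ℕ) {y : X} (hy : y ∈ W) (hny : ((T : Equiv.Perm X) ^ n) y ∈ W) : n = 0 := by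
      by_contra hn
      rw [← Equiv.Perm.iterate_eq_pow] at hny
      exact (hW n 0 hn).subset ⟨hny, hy⟩
    obtain ⟨k, rfl | rfl⟩ := n.eq_nat_or_neg
    · exact_mod_cast key k hx hnx
    · have := key k hnx (by simpa using hx)
      simp [this]
  have hsplit (A : Set X) (hA : MeasurableSet A) :
      A ∈ ae (μ.restrict W) ∨ Aᶜ ∈ ae (μ.restrict W) := by
    let S : Set X := ⋃ n : ℤ, ⇑((T : Equiv.Perm X) ^ n) ⁻¹' (A ∩ W)
    have hS : MeasurableSet S := .iUnion fun n ↦ measurable_zpow T n (hA.inter hWm)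
    have hTS : T ⁻¹' S = S := by
      ext x
      simp only [S, mem_preimage, mem_iUnion]
      have hx (n : ℤ) : ((T : Equiv.Perm X) ^ n) (T x) = ((T : Equiv.Perm X) ^ (n + 1)) x := by
        rw [zpow_add_one]; rfl
      simp only [hx]
      exact ⟨fun ⟨n, h⟩ ↦ ⟨n + 1, h⟩, fun ⟨n, h⟩ ↦ ⟨n - 1, by simpa using h⟩⟩
    have hAS : A ∩ W ⊆ S := fun x hx ↦ mem_iUnion.2 ⟨0, by simpa using hx⟩
    have hcS : Aᶜ ∩ W ⊆ Sᶜ := fun x hx hxS ↦ by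
      obtain ⟨n, hn⟩ := mem_iUnion.1 hxS
      obtain rfl := hdisj n hx.2 hn.2
      exact hx.1 (by simpa using hn.1)
    rw [mem_ae_iff, mem_ae_iff, compl_compl, Measure.restrict_apply hA,
      Measure.restrict_apply hA.compl]
    exact (herg S hS hTS).symm.imp (measure_mono_null hcS) (measure_mono_null hAS)
  obtain ⟨t, -, ht, htW⟩ := exists_subset_subsingleton_mem_of_forall_separating MeasurableSet
    (l := ae (μ.restrict W)) univ_mem hsplit
  have ht0 : μ t = 0 := by
    rcases ht.eq_empty_or_singleton with rfl | ⟨x, rfl⟩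
    · exact measure_empty
    · exact hna x
  rw [mem_ae_iff, Measure.restrict_apply ht.measurableSet.compl] at htW
  exact measure_mono_null (fun x hx ↦ (em (x ∈ t)).imp id fun h ↦ ⟨h, hx⟩)
    (measure_union_null ht0 htW)

end ShelahWeiss

open ShelahWeiss in
/-- **Shelah–Weiss.** Let `T` be an aperiodic Borel bijection of a standard Borel space
`X`. A Borel set `B` is null for every non-atomic `T`-nonsingular ergodic probability
measure if and only if `B` can be covered by countably many Borel `T`-wandering sets. -/
theorem stmt_10 {X : Type*} [MeasurableSpace X] [StandardBorelSpace X]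
    (T : X ≃ᵐ X) (hap : ∀ x : X, ∀ n : ℕ, 0 < n → (⇑T)^[n] x ≠ x)
    (B : Set X) (hB : MeasurableSet B) :
    (∀ μ : Measure X, IsProbabilityMeasure μ → (∀ x : X, μ {x} = 0) →
        QuasiInvariant' μ ⇑T → Ergodic' μ ⇑T → μ B = 0)
      ↔ ∃ W : ℕ → Set X, (∀ n, MeasurableSet (W n) ∧ Wandering' (⇑T) (W n)) ∧
          B ⊆ ⋃ n, W n := by
  refine ⟨fun h ↦ ?_, ?_⟩
  · by_contra hcw
    obtain ⟨φ, hφ, hinj, hφB, htail⟩ := exists_cantor_embedding T hap hB hcw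
    obtain ⟨ν, hν, hνa, h01⟩ := exists_measure_cantor_zero_one
    have := Measure.isProbabilityMeasure_map (μ := ν) hφ.aemeasurable
    have hiter (A : Set X) (hA : T ⁻¹' A = A) (x : X) (n : ℕ) : T^[n] x ∈ A ↔ x ∈ A := by
      induction n generalizing x with
      | zero => rfl
      | succ n ih =>
        rw [Function.iterate_succ_apply, ih, ← mem_preimage, hA]
    have hnull (x : X) : ν.map φ {x} = 0 := by
      rw [Measure.map_apply hφ (measurableSet_singleton x)]
      have hs : (φ ⁻¹' {x}).Subsingleton := subsingleton_singleton.preimage hinj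
      rcases hs.eq_empty_or_singleton with h | ⟨α, h⟩
      · rw [h, measure_empty]
      · rw [h, hνa]
    have herg (A : Set X) (hA : MeasurableSet A) (hTA : T ⁻¹' A = A) :
        ν.map φ A = 0 ∨ ν.map φ Aᶜ = 0 := by
      rw [Measure.map_apply hφ hA, Measure.map_apply hφ hA.compl, preimage_compl,
        prob_compl_eq_zero_iff (hφ hA)]
      refine h01 _ (hφ hA) fun α β hαβ hα ↦ ?_
      obtain ⟨a, b, hab⟩ := htail α β hαβ
      exact (hiter A hTA _ b).1 (hab ▸ (hiter A hTA _ a).2 hα)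
    obtain ⟨μ, hμ, hna, hq, he, hac⟩ := exists_quasiInvariant_ergodic T (ν.map φ) hnull herg
    have h0 := hac (h μ hμ hna hq he)
    rw [Measure.map_apply hφ hB, eq_univ_of_forall (s := φ ⁻¹' B) hφB, measure_univ] at h0
    exact one_ne_zero h0
  · rintro ⟨W, hW, hBW⟩ μ _ hna _ he
    exact measure_mono_null hBW (measure_iUnion_null fun n ↦
      measure_wandering_eq_zero T hna he (hW n).1 (hW n).2)
end
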